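/- Let n ≥ 4 and let (u, p) be a smooth solution of the steady Navier-Stokes equations on ℝⁿ \ B₁ with |u(x)| ≤ C/|x| for all |x| ≥ 1. Then |x| |u(x)| → 0 as |x| → ∞, i.e. u(x) = o(1/|x|) at infinity. -/

import Mathlib

section

open MeasureTheory Filter Topology Set
open scoped ContDiff

namespace SteadyNS

section

/-- Euclidean space of dimension `n`. -/
abbrev Eu (n : ℕ) := EuclideanSpace ℝ (Fin n)

/-- Smooth real-valued functions on Euclidean space. -/
abbrev Sm {n : ℕ} (f : Eu n → ℝ) : Prop := ContDiff ℝ ∞ f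

/-- The `i`-th partial derivative. -/
noncomputable def pd {n : ℕ} (i : Fin n) (f : Eu n → ℝ) (x : Eu n) : ℝ :=
  fderiv ℝ f x (EuclideanSpace.single i 1)

/-- The Laplacian. -/
noncomputable def lap {n : ℕ} (f : Eu n → ℝ) (x : Eu n) : ℝ := ∑ i, pd i (pd i f) x

variable {n : ℕ}

theorem Sm.diff {f : Eu n → ℝ} (hf : Sm f) (x : Eu n) : DifferentiableAt ℝ f x :=
  hf.differentiable (by simp) x

theorem Sm.pd {f : Eu n → ℝ} (hf : Sm f) (i : Fin n) : Sm (pd i f) := by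
  have h : ContDiff ℝ ∞ (fderiv ℝ f) := hf.fderiv_right (by simp)
  exact h.clm_apply contDiff_const

theorem Sm.lap {f : Eu n → ℝ} (hf : Sm f) : Sm (lap f) := by
  unfold SteadyNS.lap
  exact ContDiff.sum fun i _ => (hf.pd i).pd i

theorem sm_coord (i : Fin n) : Sm (fun x : Eu n => x i) := by
  exact (EuclideanSpace.proj (𝕜 := ℝ) i).contDiff

theorem sm_const (c : ℝ) : Sm (fun _ : Eu n => c) := contDiff_const

theorem fderiv_eq_sum {f : Eu n → ℝ} (x v : Eu n) :
    fderiv ℝ f x v = ∑ i, v i * pd i f x := by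
  have hv : v = ∑ i, v i • EuclideanSpace.single i (1 : ℝ) := by
    have := (EuclideanSpace.basisFun (Fin n) ℝ).sum_repr v
    simpa using this.symm
  conv_lhs => rw [hv]
  simp [map_sum, pd]

theorem pd_congr {f g : Eu n → ℝ} {x : Eu n} (h : f =ᶠ[𝓝 x] g) (i : Fin n) :
    pd i f x = pd i g x := by
  unfold pd; rw [h.fderiv_eq]

theorem pd_congr_on {f g : Eu n → ℝ} {S : Set (Eu n)} (hS : IsOpen S)
    (h : ∀ x ∈ S, f x = g x) {x : Eu n} (hx : x ∈ S) (i : Fin n) :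
    pd i f x = pd i g x :=
  pd_congr (by filter_upwards [hS.mem_nhds hx] with y hy using h y hy) i

theorem pd_const (c : ℝ) (i : Fin n) (x : Eu n) : pd i (fun _ => c) x = 0 := by
  simp [pd]

theorem pd_add {f g : Eu n → ℝ} (hf : Sm f) (hg : Sm g) (i : Fin n) (x : Eu n) :
    pd i (fun y => f y + g y) x = pd i f x + pd i g x := by
  unfold pd; rw [fderiv_fun_add (hf.diff x) (hg.diff x)]; rfl

theorem pd_sub {f g : Eu n → ℝ} (hf : Sm f) (hg : Sm g) (i : Fin n) (x : Eu n) :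
    pd i (fun y => f y - g y) x = pd i f x - pd i g x := by
  unfold pd; rw [fderiv_fun_sub (hf.diff x) (hg.diff x)]; rfl

theorem pd_mul {f g : Eu n → ℝ} (hf : Sm f) (hg : Sm g) (i : Fin n) (x : Eu n) :
    pd i (fun y => f y * g y) x = pd i f x * g x + f x * pd i g x := by
  unfold pd; rw [fderiv_fun_mul (hf.diff x) (hg.diff x)]
  simp; ring

theorem pd_const_mul {f : Eu n → ℝ} (hf : Sm f) (c : ℝ) (i : Fin n) (x : Eu n) :
    pd i (fun y => c * f y) x = c * pd i f x := by
  rw [pd_mul (sm_const c) hf, pd_const]; ring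

theorem pd_sum {ι : Type*} (s : Finset ι) {f : ι → Eu n → ℝ} (hf : ∀ k, Sm (f k)) (i : Fin n)
    (x : Eu n) : pd i (fun y => ∑ k ∈ s, f k y) x = ∑ k ∈ s, pd i (f k) x := by
  unfold pd
  rw [fderiv_fun_sum (fun k _ => (hf k).diff x)]
  simp

theorem pd_coord (i j : Fin n) (x : Eu n) :
    pd i (fun y : Eu n => y j) x = if i = j then 1 else 0 := by
  unfold pd
  have : (fun y : Eu n => y j) = (EuclideanSpace.proj (𝕜 := ℝ) j : Eu n → ℝ) := by
    ext y; simp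
  rw [this, ContinuousLinearMap.fderiv]
  by_cases h : i = j
  · subst h; simp
  · simp [h, Ne.symm h]

theorem pd_comp {β : ℝ → ℝ} {β' : ℝ} {f : Eu n → ℝ} (hf : Sm f) {x : Eu n}
    (hβ : HasDerivAt β β' (f x)) (i : Fin n) :
    pd i (fun y => β (f y)) x = β' * pd i f x := by
  unfold pd
  have := (hβ.comp_hasFDerivAt x (hf.diff x).hasFDerivAt)
  have h2 : (fun y => β (f y)) = β ∘ f := rfl
  rw [h2, this.fderiv]; simp

theorem pd_affine {f : Eu n → ℝ} (hf : Sm f) (a : Eu n) (s : ℝ) (i : Fin n) (x : Eu n) :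
    pd i (fun y => f (a + s • y)) x = s * pd i f (a + s • x) := by
  unfold pd
  have h1 : HasFDerivAt (fun y : Eu n => a + s • y) (s • ContinuousLinearMap.id ℝ (Eu n)) x := by
    simpa using ((hasFDerivAt_id (𝕜 := ℝ) x).const_smul s).const_add a
  have h2 := (hf.diff (a + s • x)).hasFDerivAt.comp x h1
  have h3 : (fun y => f (a + s • y)) = f ∘ (fun y : Eu n => a + s • y) := rfl
  rw [h3, h2.fderiv]; simp

theorem sm_affine {f : Eu n → ℝ} (hf : Sm f) (a : Eu n) (s : ℝ) :
    Sm (fun y => f (a + s • y)) :=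
  hf.comp (contDiff_const.add (contDiff_id.const_smul s))

theorem pd_comm {f : Eu n → ℝ} (hf : Sm f) (i j : Fin n) (x : Eu n) :
    pd i (pd j f) x = pd j (pd i f) x := by
  have h : ContDiff ℝ ∞ (fderiv ℝ f) := hf.fderiv_right (by simp)
  have key : ∀ v w : Eu n, fderiv ℝ (fun y => fderiv ℝ f y v) x w
      = fderiv ℝ (fderiv ℝ f) x w v := by
    intro v w
    rw [fderiv_clm_apply (h.differentiable (by simp) x) (differentiableAt_const v)]
    simp
  unfold pd
  rw [key, key]
  exact second_derivative_symmetric (fun y => (hf.diff y).hasFDerivAt)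
    (h.differentiable (by simp) x).hasFDerivAt _ _

/-- Smooth compactly supported test functions with support in `S`. -/
structure Test (S : Set (Eu n)) (f : Eu n → ℝ) : Prop where
  smooth : Sm f
  compact : HasCompactSupport f
  supp : tsupport f ⊆ S

theorem Test.zero {S : Set (Eu n)} {f : Eu n → ℝ} (h : Test S f) {x : Eu n} (hx : x ∉ S) :
    f x = 0 :=
  image_eq_zero_of_notMem_tsupport fun h' => hx (h.supp h')

theorem Test.pd {S : Set (Eu n)} {f : Eu n → ℝ} (h : Test S f) (i : Fin n) :
    Test S (pd i f) where
  smooth := h.smooth.pd i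
  compact := h.compact.fderiv_apply ℝ _
  supp := (tsupport_fderiv_apply_subset ℝ _).trans h.supp

theorem Test.add {S : Set (Eu n)} {f g : Eu n → ℝ} (h : Test S f) (hg : Test S g) :
    Test S (fun x => f x + g x) where
  smooth := h.smooth.add hg.smooth
  compact := h.compact.add hg.compact
  supp := (tsupport_add f g).trans (union_subset h.supp hg.supp)

theorem Test.mul {S : Set (Eu n)} {f g : Eu n → ℝ} (h : Test S f) (hg : Sm g) :
    Test S (fun x => g x * f x) where
  smooth := hg.mul h.smooth
  compact := h.compact.mul_left
  supp := (tsupport_mul_subset_right).trans h.supp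

theorem Test.const {S : Set (Eu n)} : Test S (fun _ : Eu n => 0) where
  smooth := sm_const 0
  compact := HasCompactSupport.zero
  supp := by simp [tsupport]

theorem Test.sum {ι : Type*} (s : Finset ι) {S : Set (Eu n)} {f : ι → Eu n → ℝ}
    (h : ∀ k, Test S (f k)) : Test S (fun x => ∑ k ∈ s, f k x) := by
  classical
  induction s using Finset.induction_on with
  | empty => simpa using Test.const
  | insert a s ha ih => simpa [Finset.sum_insert ha] using (h a).add ih

theorem Test.lap {S : Set (Eu n)} {f : Eu n → ℝ} (h : Test S f) : Test S (lap f) :=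
  Test.sum _ fun i => (h.pd i).pd i

theorem Test.int {S : Set (Eu n)} {f g : Eu n → ℝ} (h : Test S f) (hg : Continuous g) :
    Integrable (fun x => g x * f x) :=
  (hg.mul h.smooth.continuous).integrable_of_hasCompactSupport h.compact.mul_left

theorem ibp {S : Set (Eu n)} {f g : Eu n → ℝ} (h : Test S f) (hg : Sm g) (i : Fin n) :
    ∫ x, pd i g x * f x = -∫ x, g x * pd i f x := by
  have := integral_mul_fderiv_eq_neg_fderiv_mul_of_integrable (μ := (volume : Measure (Eu n)))
    (f := g) (g := f) (v := EuclideanSpace.single i (1 : ℝ))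
    (h.int (hg.pd i).continuous) ((h.pd i).int hg.continuous) (h.int hg.continuous)
    (fun x _ => hg.diff x) (fun x _ => h.smooth.diff x)
  unfold pd
  linarith

theorem ibp2 {S : Set (Eu n)} {f g : Eu n → ℝ} (h : Test S f) (hg : Sm g) (i j : Fin n) :
    ∫ x, pd i (pd j g) x * f x = ∫ x, g x * pd i (pd j f) x := by
  rw [ibp h (hg.pd j), ibp (h.pd i) hg]
  simp [fun x => pd_comm h.smooth i j x]

theorem lap_ibp {S : Set (Eu n)} {f g : Eu n → ℝ} (h : Test S f) (hg : Sm g) :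
    ∫ x, lap g x * f x = ∫ x, g x * lap f x := by
  unfold lap
  simp only [Finset.sum_mul, Finset.mul_sum]
  rw [integral_finsetSum _ fun i _ => h.int ((hg.pd i).pd i).continuous,
    integral_finsetSum _ fun i _ => ((h.pd i).pd i).int hg.continuous]
  exact Finset.sum_congr rfl fun i _ => ibp2 h hg i i

/-- Smooth functions `U`, `P` on the whole space solving the steady Navier-Stokes equations
on the open set `S`. -/
structure NSOn (S : Set (Eu n)) (U : Fin n → Eu n → ℝ) (P : Eu n → ℝ) : Prop where
  isOpen : IsOpen S
  smU : ∀ i, Sm (U i)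
  smP : Sm P
  ns : ∀ x ∈ S, ∀ j, lap (U j) x = ∑ i, U i x * pd i (U j) x + pd j P x
  div : ∀ x ∈ S, ∑ i, pd i (U i) x = 0

theorem NSOn.rescale {S : Set (Eu n)} {U : Fin n → Eu n → ℝ} {P : Eu n → ℝ} (h : NSOn S U P)
    (a : Eu n) (s : ℝ) : NSOn ((fun z => a + s • z) ⁻¹' S)
      (fun i z => s * U i (a + s • z)) (fun z => s ^ 2 * P (a + s • z)) := by
  have hU : ∀ i j z, pd i (fun z => s * U j (a + s • z)) z = s ^ 2 * pd i (U j) (a + s • z) := by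
    intro i j z
    rw [pd_const_mul (sm_affine (h.smU j) a s), pd_affine (h.smU j)]; ring
  refine ⟨h.isOpen.preimage (by fun_prop), fun i => contDiff_const.mul (sm_affine (h.smU i) a s),
    contDiff_const.mul (sm_affine h.smP a s), fun z hz j => ?_, fun z hz => ?_⟩
  · have hl : lap (fun z => s * U j (a + s • z)) z = s ^ 3 * lap (U j) (a + s • z) := by
      unfold lap
      rw [Finset.mul_sum]
      refine Finset.sum_congr rfl fun i _ => ?_
      rw [show pd i (fun z => s * U j (a + s • z)) = fun z => s ^ 2 * pd i (U j) (a + s • z) from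
        funext fun z => hU i j z, pd_const_mul (sm_affine ((h.smU j).pd i) a s),
        pd_affine ((h.smU j).pd i)]; ring
    rw [hl, h.ns _ hz, mul_add, Finset.mul_sum]
    congr 1
    · exact Finset.sum_congr rfl fun i _ => by rw [hU]; ring
    · rw [pd_const_mul (sm_affine h.smP a s), pd_affine h.smP]; ring
  · simp only [hU]
    rw [← Finset.mul_sum, h.div _ hz, mul_zero]

/-- For a divergence-free field, `∂ᵢ∂ⱼ((uᵢ - aᵢ)(uⱼ - aⱼ)) = ∂ᵢuⱼ ∂ⱼuᵢ`. -/
theorem NSOn.sum_pd_pd {S : Set (Eu n)} {U : Fin n → Eu n → ℝ} {P : Eu n → ℝ} (h : NSOn S U P)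
    (a : Fin n → ℝ) {x : Eu n} (hx : x ∈ S) :
    ∑ i, ∑ j, pd i (pd j (fun y => (U i y - a i) * (U j y - a j))) x
      = ∑ i, ∑ j, pd i (U j) x * pd j (U i) x := by
  have hs : ∀ i, Sm (fun y => U i y - a i) := fun i => (h.smU i).sub contDiff_const
  have h1 : ∀ i j y, pd i (fun y => U j y - a j) y = pd i (U j) y := by
    intro i j y; rw [pd_sub (h.smU j) (sm_const _), pd_const, sub_zero]
  have h2 : ∀ i, ∀ y ∈ S, ∑ j, pd j (fun y => (U i y - a i) * (U j y - a j)) y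
      = ∑ j, pd j (U i) y * (U j y - a j) := by
    intro i y hy
    have : ∀ j, pd j (fun y => (U i y - a i) * (U j y - a j)) y
      = pd j (U i) y * (U j y - a j) + (U i y - a i) * pd j (U j) y := by
      intro j; rw [pd_mul (hs i) (hs j), h1, h1]
    simp only [this, Finset.sum_add_distrib, ← Finset.mul_sum, h.div y hy, mul_zero, add_zero]
  have h3 : ∀ i, ∑ j, pd i (pd j (fun y => (U i y - a i) * (U j y - a j))) x
      = ∑ j, (pd i (pd j (U i)) x * (U j x - a j) + pd j (U i) x * pd i (U j) x) := by
    intro i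
    rw [← pd_sum _ (fun j => Sm.pd ((hs i).mul (hs j)) j)]
    rw [pd_congr_on h.isOpen (h2 i) hx, pd_sum _ (fun j => ((h.smU i).pd j).mul (hs j))]
    refine Finset.sum_congr rfl fun j _ => ?_
    rw [pd_mul ((h.smU i).pd j) (hs j), h1]
  simp only [h3, Finset.sum_add_distrib]
  have h4 : ∑ i, ∑ j, pd i (pd j (U i)) x * (U j x - a j) = 0 := by
    rw [Finset.sum_comm]
    refine Finset.sum_eq_zero fun j _ => ?_
    rw [← Finset.sum_mul]
    have : ∑ i, pd i (pd j (U i)) x = 0 := by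
      simp only [fun i => pd_comm (h.smU i) i j x]
      rw [← pd_sum _ (fun i => (h.smU i).pd i), pd_congr_on h.isOpen h.div hx, pd_const]
    rw [this, zero_mul]
  rw [h4, zero_add]
  exact Finset.sum_congr rfl fun i _ => Finset.sum_congr rfl fun j _ => mul_comm _ _

/-- The pressure equation. -/
theorem NSOn.lap_pressure {S : Set (Eu n)} {U : Fin n → Eu n → ℝ} {P : Eu n → ℝ}
    (h : NSOn S U P) {x : Eu n} (hx : x ∈ S) :
    lap P x = -∑ i, ∑ j, pd i (U j) x * pd j (U i) x := by
  have h1 : ∀ j, pd j (pd j P) x = pd j (lap (U j)) x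
      - ∑ i, (pd j (U i) x * pd i (U j) x + U i x * pd j (pd i (U j)) x) := by
    intro j
    have hsum : Sm (fun y => ∑ i, U i y * pd i (U j) y) :=
      ContDiff.sum fun i _ => (h.smU i).mul ((h.smU j).pd i)
    have e : ∀ y ∈ S, pd j P y = lap (U j) y - ∑ i, U i y * pd i (U j) y := by
      intro y hy; rw [h.ns y hy j]; ring
    rw [pd_congr_on h.isOpen e hx, pd_sub (h.smU j).lap hsum,
      pd_sum _ (fun i => (h.smU i).mul ((h.smU j).pd i))]
    congr 1
    exact Finset.sum_congr rfl fun i _ => pd_mul (h.smU i) ((h.smU j).pd i) j x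
  have h0 : ∀ i, ∑ j, pd i (pd j (U j)) x = 0 := by
    intro i
    rw [← pd_sum _ (fun i => (h.smU i).pd i), pd_congr_on h.isOpen h.div hx, pd_const]
  have h2 : ∑ j, pd j (lap (U j)) x = 0 := by
    unfold lap
    have : ∀ j, pd j (fun y => ∑ i, pd i (pd i (U j)) y) x
        = ∑ i, pd i (pd i (pd j (U j))) x := by
      intro j
      rw [pd_sum _ (fun i => ((h.smU j).pd i).pd i)]
      refine Finset.sum_congr rfl fun i _ => ?_
      rw [pd_comm ((h.smU j).pd i)]
      rw [show pd j (pd i (U j)) = pd i (pd j (U j)) from funext fun y => pd_comm (h.smU j) j i y]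
    simp only [this]
    rw [Finset.sum_comm]
    refine Finset.sum_eq_zero fun i _ => ?_
    rw [← pd_sum _ (fun j => ((h.smU j).pd j).pd i)]
    have e : ∀ y ∈ S, ∑ j, pd i (pd j (U j)) y = 0 := by
      intro y hy
      rw [← pd_sum _ (fun i => (h.smU i).pd i), pd_congr_on h.isOpen h.div hy, pd_const]
    rw [pd_congr_on h.isOpen e hx, pd_const]
  have h3 : ∑ j, ∑ i, U i x * pd j (pd i (U j)) x = 0 := by
    rw [Finset.sum_comm]
    refine Finset.sum_eq_zero fun i _ => ?_
    rw [← Finset.mul_sum]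
    simp only [fun j => pd_comm (h.smU j) j i x, h0, mul_zero]
  rw [show lap P x = ∑ j, pd j (pd j P) x from rfl]
  simp only [h1, Finset.sum_sub_distrib, h2, Finset.sum_add_distrib, h3]
  rw [zero_sub, add_zero]

end

section

variable {n : ℕ}

/-- `|u|²`. -/
noncomputable def nsq (U : Fin n → Eu n → ℝ) (x : Eu n) : ℝ := ∑ i, U i x ^ 2

/-- The total head pressure. -/
noncomputable def head (U : Fin n → Eu n → ℝ) (P : Eu n → ℝ) (x : Eu n) : ℝ :=
  nsq U x / 2 + P x

/-- The radial momentum `x · u`. -/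
noncomputable def radial (U : Fin n → Eu n → ℝ) (x : Eu n) : ℝ := ∑ i, x i * U i x

/-- The squared norm of the vorticity. -/
noncomputable def vortSq (U : Fin n → Eu n → ℝ) (x : Eu n) : ℝ :=
  (∑ i, ∑ j, (pd i (U j) x - pd j (U i) x) ^ 2) / 2

/-- The squared norm of the gradient. -/
noncomputable def gradSq (U : Fin n → Eu n → ℝ) (x : Eu n) : ℝ :=
  ∑ i, ∑ j, pd i (U j) x ^ 2

/-- The transport derivative `u · ∇f`. -/
noncomputable def transp (U : Fin n → Eu n → ℝ) (f : Eu n → ℝ) (x : Eu n) : ℝ :=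
  ∑ i, U i x * pd i f x

/-- The Euler derivative `x · ∇f`. -/
noncomputable def euler (f : Eu n → ℝ) (x : Eu n) : ℝ := ∑ i, x i * pd i f x

variable {S : Set (Eu n)} {U : Fin n → Eu n → ℝ} {P f w : Eu n → ℝ}

theorem sm_nsq (hU : ∀ i, Sm (U i)) : Sm (nsq U) :=
  ContDiff.sum fun i _ => (hU i).pow 2

theorem sm_head (hU : ∀ i, Sm (U i)) (hP : Sm P) : Sm (head U P) :=
  ((sm_nsq hU).div_const 2).add hP

theorem sm_radial (hU : ∀ i, Sm (U i)) : Sm (radial U) :=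
  ContDiff.sum fun i _ => (sm_coord i).mul (hU i)

theorem sm_vortSq (hU : ∀ i, Sm (U i)) : Sm (vortSq U) :=
  ContDiff.div_const (ContDiff.sum fun i _ => ContDiff.sum fun j _ =>
    (((hU j).pd i).sub ((hU i).pd j)).pow 2) 2

theorem sm_gradSq (hU : ∀ i, Sm (U i)) : Sm (gradSq U) :=
  ContDiff.sum fun i _ => ContDiff.sum fun j _ => ((hU j).pd i).pow 2

theorem sm_transp (hU : ∀ i, Sm (U i)) (hf : Sm f) : Sm (transp U f) :=
  ContDiff.sum fun i _ => (hU i).mul (hf.pd i)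

theorem sm_euler (hf : Sm f) : Sm (euler f) :=
  ContDiff.sum fun i _ => (sm_coord i).mul (hf.pd i)

theorem Test.transp (h : Test S f) (hU : ∀ i, Sm (U i)) : Test S (transp U f) :=
  Test.sum _ fun i => (h.pd i).mul (hU i)

theorem Test.euler (h : Test S f) : Test S (euler f) :=
  Test.sum _ fun i => (h.pd i).mul (sm_coord i)

/-- Two integrands agreeing on `S` have the same integral against a test function. -/
theorem Test.integral_congr (h : Test S f) {v w : Eu n → ℝ} (hvw : ∀ x ∈ S, v x = w x) :
    ∫ x, v x * f x = ∫ x, w x * f x := by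
  refine MeasureTheory.integral_congr_ae (Eventually.of_forall fun x => ?_)
  by_cases hx : x ∈ S
  · simp [hvw x hx]
  · simp [h.zero hx]

theorem Test.integral_mono (h : Test S f) (hf : ∀ x, 0 ≤ f x) {v w : Eu n → ℝ}
    (hv : Continuous v) (hw : Continuous w)
    (hvw : ∀ x ∈ S, v x ≤ w x) :
    ∫ x, v x * f x ≤ ∫ x, w x * f x := by
  refine MeasureTheory.integral_mono (h.int hv) (h.int hw) fun x => ?_
  by_cases hx : x ∈ S
  · exact mul_le_mul_of_nonneg_right (hvw x hx) (hf x)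
  · simp [h.zero hx]

theorem euler_ibp (h : Test S f) (hw : Sm w) :
    ∫ x, euler w x * f x = -∫ x, w x * (n * f x + euler f x) := by
  have e1 : ∀ x, euler w x * f x = ∑ i, pd i w x * (x i * f x) := by
    intro x; unfold euler; rw [Finset.sum_mul]
    exact Finset.sum_congr rfl fun i _ => by ring
  have e2 : ∀ x, w x * (n * f x + euler f x) = ∑ i, w x * pd i (fun y => y i * f y) x := by
    intro x
    have : ∀ i, pd i (fun y : Eu n => y i * f y) x = f x + x i * pd i f x := by
      intro i; rw [pd_mul (sm_coord i) h.smooth, pd_coord]; simp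
    simp only [this, ← Finset.mul_sum, Finset.sum_add_distrib]
    simp [euler]
  simp only [e1, e2]
  rw [integral_finsetSum _ fun i _ => (h.mul (sm_coord i)).int (hw.pd i).continuous,
    integral_finsetSum _ fun i _ => ((h.mul (sm_coord i)).pd i).int hw.continuous,
    ← Finset.sum_neg_distrib]
  exact Finset.sum_congr rfl fun i _ => ibp (h.mul (sm_coord i)) hw i

theorem NSOn.transp_ibp (hs : NSOn S U P) (h : Test S f) (hw : Sm w) :
    ∫ x, transp U w x * f x = -∫ x, w x * transp U f x := by
  have e1 : ∀ x, transp U w x * f x = ∑ i, pd i w x * (U i x * f x) := by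
    intro x; unfold transp; rw [Finset.sum_mul]
    exact Finset.sum_congr rfl fun i _ => by ring
  have e2 : ∀ x, w x * transp U f x = ∑ i, w x * pd i (fun y => U i y * f y) x := by
    intro x
    have : ∀ i, pd i (fun y : Eu n => U i y * f y) x = pd i (U i) x * f x + U i x * pd i f x :=
      fun i => pd_mul (hs.smU i) h.smooth i x
    simp only [this, ← Finset.mul_sum, Finset.sum_add_distrib]
    rw [← Finset.sum_mul]
    by_cases hx : x ∈ S
    · rw [hs.div x hx]; simp [transp]
    · rw [h.zero hx]; simp [transp]
  simp only [e1, e2]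
  rw [integral_finsetSum _ fun i _ => (h.mul (hs.smU i)).int (hw.pd i).continuous,
    integral_finsetSum _ fun i _ => ((h.mul (hs.smU i)).pd i).int hw.continuous,
    ← Finset.sum_neg_distrib]
  exact Finset.sum_congr rfl fun i _ => ibp (h.mul (hs.smU i)) hw i

theorem NSOn.weak (hs : NSOn S U P) (h : Test S f) (hw : Sm w) :
    ∫ x, (lap w x - transp U w x) * f x = ∫ x, w x * (lap f x + transp U f x) := by
  have e1 : ∀ x, (lap w x - transp U w x) * f x = lap w x * f x - transp U w x * f x :=
    fun x => by ring
  have e2 : ∀ x, w x * (lap f x + transp U f x) = w x * lap f x + w x * transp U f x :=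
    fun x => by ring
  simp only [e1, e2]
  rw [integral_sub (h.int hw.lap.continuous) (h.int (sm_transp hs.smU hw).continuous),
    integral_add (h.lap.int hw.continuous) ((h.transp hs.smU).int hw.continuous),
    lap_ibp h hw, hs.transp_ibp h hw]
  ring

theorem pd_nsq (hU : ∀ i, Sm (U i)) (i : Fin n) (x : Eu n) :
    pd i (nsq U) x = 2 * ∑ j, U j x * pd i (U j) x := by
  unfold nsq
  rw [pd_sum _ (fun k => (hU k).pow 2), Finset.mul_sum]
  refine Finset.sum_congr rfl fun j _ => ?_
  have : (fun y => U j y ^ 2) = fun y => U j y * U j y := funext fun y => sq _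
  rw [this, pd_mul (hU j) (hU j)]; ring

theorem pd_head (hU : ∀ i, Sm (U i)) (hP : Sm P) (i : Fin n) (x : Eu n) :
    pd i (head U P) x = ∑ j, U j x * pd i (U j) x + pd i P x := by
  have : head U P = fun x => (1 / 2 : ℝ) * nsq U x + P x := by
    funext y; unfold head; ring
  rw [this, pd_add (contDiff_const.mul (sm_nsq hU)) hP, pd_const_mul (sm_nsq hU), pd_nsq hU]
  ring

theorem vortSq_eq (U : Fin n → Eu n → ℝ) (x : Eu n) :
    vortSq U x = gradSq U x - ∑ i, ∑ j, pd i (U j) x * pd j (U i) x := by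
  have e : ∀ i j, (pd i (U j) x - pd j (U i) x) ^ 2
      = pd i (U j) x ^ 2 + pd j (U i) x ^ 2 - 2 * (pd i (U j) x * pd j (U i) x) :=
    fun i j => by ring
  unfold vortSq gradSq
  simp only [e, Finset.sum_sub_distrib, Finset.sum_add_distrib, ← Finset.mul_sum]
  have : ∑ i, ∑ j, pd j (U i) x ^ 2 = ∑ i, ∑ j, pd i (U j) x ^ 2 := Finset.sum_comm
  rw [this]; ring

theorem lap_head (hU : ∀ i, Sm (U i)) (hP : Sm P) (x : Eu n) :
    lap (head U P) x = gradSq U x + ∑ j, U j x * lap (U j) x + lap P x := by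
  have e : ∀ i, pd i (pd i (head U P)) x
      = ∑ j, pd i (U j) x ^ 2 + ∑ j, U j x * pd i (pd i (U j)) x + pd i (pd i P) x := by
    intro i
    rw [show pd i (head U P) = _ from funext fun y => pd_head hU hP i y,
      pd_add (ContDiff.sum fun j _ => (hU j).mul ((hU j).pd i)) (hP.pd i),
      pd_sum _ (fun j => (hU j).mul ((hU j).pd i)), ← Finset.sum_add_distrib]
    congr 1
    refine Finset.sum_congr rfl fun j _ => ?_
    rw [pd_mul (hU j) ((hU j).pd i)]; ring
  unfold lap gradSq
  simp only [e, Finset.sum_add_distrib]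
  congr 2
  rw [Finset.sum_comm]
  exact Finset.sum_congr rfl fun j _ => by rw [Finset.mul_sum]

/-- The equation of the head pressure. -/
theorem NSOn.head_eq (hs : NSOn S U P) {x : Eu n} (hx : x ∈ S) :
    lap (head U P) x - transp U (head U P) x = vortSq U x := by
  rw [lap_head hs.smU hs.smP, hs.lap_pressure hx, vortSq_eq]
  have e : transp U (head U P) x = ∑ j, U j x * lap (U j) x := by
    unfold transp
    simp only [pd_head hs.smU hs.smP, hs.ns x hx, mul_add, Finset.sum_add_distrib,
      Finset.mul_sum]
    congr 1
    rw [Finset.sum_comm]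
    exact Finset.sum_congr rfl fun j _ => Finset.sum_congr rfl fun i _ => by ring
  rw [e]; ring

theorem NSOn.integral_vortSq (hs : NSOn S U P) (h : Test S f) :
    ∫ x, vortSq U x * f x = ∫ x, head U P x * (lap f x + transp U f x) := by
  rw [← hs.weak h (sm_head hs.smU hs.smP)]
  exact h.integral_congr fun x hx => (hs.head_eq hx).symm

theorem pd_radial (hU : ∀ i, Sm (U i)) (i : Fin n) (x : Eu n) :
    pd i (radial U) x = U i x + ∑ j, x j * pd i (U j) x := by
  unfold radial
  rw [pd_sum _ (fun j => (sm_coord j).mul (hU j))]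
  have : ∀ j, pd i (fun y : Eu n => y j * U j y) x
      = (if i = j then U j x else 0) + x j * pd i (U j) x := by
    intro j; rw [pd_mul (sm_coord j) (hU j), pd_coord]; split_ifs <;> simp
  simp only [this, Finset.sum_add_distrib]
  simp

theorem NSOn.radial_eq (hs : NSOn S U P) {x : Eu n} (hx : x ∈ S) :
    lap (radial U) x - transp U (radial U) x = euler P x - nsq U x := by
  have e : ∀ i, pd i (pd i (radial U)) x
      = 2 * pd i (U i) x + ∑ j, x j * pd i (pd i (U j)) x := by
    intro i
    rw [show pd i (radial U) = _ from funext fun y => pd_radial hs.smU i y,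
      pd_add (hs.smU i) (ContDiff.sum fun j _ => (sm_coord j).mul ((hs.smU j).pd i)),
      pd_sum _ (fun j => (sm_coord j).mul ((hs.smU j).pd i))]
    have : ∀ j, pd i (fun y : Eu n => y j * pd i (U j) y) x
        = (if i = j then pd i (U j) x else 0) + x j * pd i (pd i (U j)) x := by
      intro j; rw [pd_mul (sm_coord j) ((hs.smU j).pd i), pd_coord]; split_ifs <;> simp
    simp only [this, Finset.sum_add_distrib]
    simp; ring
  have hl : lap (radial U) x = ∑ j, x j * lap (U j) x := by
    conv_lhs => unfold lap
    simp only [e, Finset.sum_add_distrib, ← Finset.mul_sum, hs.div x hx]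
    rw [Finset.sum_comm]
    simp only [lap, Finset.mul_sum]
    simp
  rw [hl]
  unfold transp euler nsq
  simp only [hs.ns x hx, pd_radial hs.smU, mul_add, Finset.sum_add_distrib, Finset.mul_sum]
  have : ∑ j, ∑ i, x j * (U i x * pd i (U j) x) = ∑ i, ∑ j, U i x * (x j * pd i (U j) x) := by
    rw [Finset.sum_comm]
    exact Finset.sum_congr rfl fun j _ => Finset.sum_congr rfl fun i _ => by ring
  rw [this]
  simp only [sq]; ring

theorem NSOn.integral_radial (hs : NSOn S U P) (h : Test S f) :
    (∫ x, nsq U x * f x) + ∫ x, P x * (n * f x + euler f x)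
      = -∫ x, radial U x * (lap f x + transp U f x) := by
  rw [← hs.weak h (sm_radial hs.smU), h.integral_congr fun x hx => hs.radial_eq hx]
  simp only [sub_mul]
  rw [integral_sub (h.int (sm_euler hs.smP).continuous) (h.int (sm_nsq hs.smU).continuous),
    euler_ibp h hs.smP]
  ring

theorem NSOn.integral_gradSq_sub (hs : NSOn S U P) (h : Test S f) :
    ∫ x, (gradSq U x - vortSq U x) * f x
      = ∫ x, ∑ i, ∑ j, U i x * U j x * pd i (pd j f) x := by
  have e : ∀ x ∈ S, gradSq U x - vortSq U x
      = ∑ i, ∑ j, pd i (pd j (fun y => U i y * U j y)) x := by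
    intro x hx
    have := hs.sum_pd_pd (fun _ => 0) hx
    simp only [sub_zero] at this
    rw [this, vortSq_eq]; ring
  rw [h.integral_congr e]
  have hm : ∀ i j, Sm (fun y => U i y * U j y) := fun i j => (hs.smU i).mul (hs.smU j)
  simp only [Finset.sum_mul]
  rw [integral_finsetSum _ fun i _ => integrable_finsetSum _ fun j _ =>
      h.int (((hm i j).pd j).pd i).continuous,
    integral_finsetSum _ fun i _ => integrable_finsetSum _ fun j _ =>
      ((h.pd j).pd i).int (hm i j).continuous]
  refine Finset.sum_congr rfl fun i _ => ?_
  rw [integral_finsetSum _ fun j _ => h.int (((hm i j).pd j).pd i).continuous,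
    integral_finsetSum _ fun j _ => ((h.pd j).pd i).int (hm i j).continuous]
  exact Finset.sum_congr rfl fun j _ => ibp2 h (hm i j) i j

/-- Energy estimate for a convex nondecreasing function of the head pressure. -/
theorem NSOn.convex_head (hs : NSOn S U P) (h : Test S f) (hf : ∀ x, 0 ≤ f x)
    {β β' β'' : ℝ → ℝ} (hβs : ContDiff ℝ ∞ β) (hβs'' : Continuous β'')
    (hβ : ∀ s, HasDerivAt β (β' s) s) (hβ' : ∀ s, HasDerivAt β' (β'' s) s)
    (hpos : ∀ s, 0 ≤ β' s) :
    ∫ x, (β'' (head U P x) * ∑ i, pd i (head U P) x ^ 2) * f x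
      ≤ ∫ x, β (head U P x) * (lap f x + transp U f x) := by
  have hH := sm_head hs.smU hs.smP
  have hβs' : ContDiff ℝ ∞ β' := by
    have : deriv β = β' := funext fun s => (hβ s).deriv
    rw [← this]
    exact ((contDiff_infty_iff_deriv).1 hβs).2
  have hw : Sm (fun x => β (head U P x)) := hβs.comp hH
  rw [← hs.weak h hw]
  have e1 : ∀ i x, pd i (fun x => β (head U P x)) x = β' (head U P x) * pd i (head U P) x :=
    fun i x => pd_comp hH (hβ _) i
  have e2 : ∀ i x, pd i (pd i (fun x => β (head U P x))) x
      = β'' (head U P x) * pd i (head U P) x ^ 2 + β' (head U P x) * pd i (pd i (head U P)) x := by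
    intro i x
    rw [show pd i (fun x => β (head U P x)) = _ from funext fun y => e1 i y,
      pd_mul (f := fun y => β' (head U P y)) (hβs'.comp hH) (hH.pd i), pd_comp hH (hβ' _)]
    ring
  refine h.integral_mono hf ?_ ?_ fun x hx => ?_
  · exact (hβs''.comp hH.continuous).mul
      (continuous_finsetSum _ fun i _ => (hH.pd i).continuous.pow 2)
  · exact hw.lap.continuous.sub (sm_transp hs.smU hw).continuous
  · have e3 : lap (fun x => β (head U P x)) x - transp U (fun x => β (head U P x)) x
        = β'' (head U P x) * ∑ i, pd i (head U P) x ^ 2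
          + β' (head U P x) * (lap (head U P) x - transp U (head U P) x) := by
      unfold lap transp
      simp only [e1, e2, Finset.sum_add_distrib, ← Finset.mul_sum]
      have : ∑ i, U i x * (β' (head U P x) * pd i (head U P) x)
          = β' (head U P x) * ∑ i, U i x * pd i (head U P) x := by
        rw [Finset.mul_sum]; exact Finset.sum_congr rfl fun i _ => by ring
      rw [this]; ring
    rw [e3, hs.head_eq hx]
    have : 0 ≤ vortSq U x := by unfold vortSq; positivity
    nlinarith [mul_nonneg (hpos (head U P x)) this]

end

section

variable {n : ℕ}

theorem sm_normSq : Sm (fun x : Eu n => ‖x‖ ^ 2) := contDiff_norm_sq ℝ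

theorem pd_normSq (i : Fin n) (x : Eu n) : pd i (fun x : Eu n => ‖x‖ ^ 2) x = 2 * x i := by
  have : (fun x : Eu n => ‖x‖ ^ 2) = nsq (fun i x => x i) := by
    funext y; simp [nsq, EuclideanSpace.real_norm_sq_eq]
  rw [this, pd_nsq (fun i => sm_coord i)]
  simp [pd_coord]

theorem pd_comp_normSq {F : ℝ → ℝ} {F' : ℝ} {x : Eu n} (h : HasDerivAt F F' (‖x‖ ^ 2))
    (i : Fin n) : pd i (fun x : Eu n => F (‖x‖ ^ 2)) x = 2 * x i * F' := by
  rw [pd_comp (f := fun x : Eu n => ‖x‖ ^ 2) sm_normSq h, pd_normSq]; ring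

theorem test_of_zero {K : Set (Eu n)} (hK : IsCompact K) {f : Eu n → ℝ} (hf : Sm f)
    (h0 : ∀ x, x ∉ K → f x = 0) : Test K f where
  smooth := hf
  compact := HasCompactSupport.intro hK h0
  supp := closure_minimal (fun x hx => by
    by_contra h; exact hx (h0 x h)) hK.isClosed

/-- A mollifier `φ` such that `z φ(z)` is the gradient of the Laplacian of a test function `ψ`. -/
structure Kern (ψ φ : Eu n → ℝ) : Prop where
  potential : Test (Metric.closedBall 0 1) ψ
  test : Test (Metric.closedBall 0 1) φ
  integral_eq : ∫ z, φ z = 1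
  grad : ∀ i z, z i * φ z = pd i (lap ψ) z

theorem exists_kern (n : ℕ) : ∃ ψ φ : Eu n → ℝ, Kern ψ φ := by
  let p : ℕ → Polynomial ℝ := fun k =>
    Nat.rec 1 (fun _ q => Polynomial.X ^ 2 * (q - Polynomial.derivative q)) k
  let G : ℕ → ℝ → ℝ := fun k t => (-1) ^ k * ((p k).eval (1 / 4 - t)⁻¹ * expNegInvGlue (1 / 4 - t))
  have hG : ∀ k t, HasDerivAt (G k) (G (k + 1) t) t := by
    intro k t
    have h1 : HasDerivAt (fun t : ℝ => 1 / 4 - t) (-1) t := by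
      simpa using (hasDerivAt_id t).const_sub (1 / 4 : ℝ)
    have h2 := ((expNegInvGlue.hasDerivAt_polynomial_eval_inv_mul (p k) (1 / 4 - t)).comp t
      h1).const_mul ((-1 : ℝ) ^ k)
    refine h2.congr_deriv ?_
    change _ = (-1) ^ (k + 1) * (Polynomial.eval (1 / 4 - t)⁻¹
      (Polynomial.X ^ 2 * (p k - Polynomial.derivative (p k))) * expNegInvGlue (1 / 4 - t))
    ring
  have hGs : ∀ k, ContDiff ℝ ∞ (G k) := fun k =>
    contDiff_const.mul ((expNegInvGlue.contDiff_polynomial_eval_inv_mul (p k)).comp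
      (contDiff_const.sub contDiff_id))
  have hG0 : ∀ k t, 1 / 4 ≤ t → G k t = 0 := by
    intro k t ht
    simp only [G]
    rw [expNegInvGlue.zero_of_nonpos (by linarith)]; ring
  have hK : IsCompact (Metric.closedBall (0 : Eu n) 1) := isCompact_closedBall 0 1
  have hq : ∀ x : Eu n, x ∉ Metric.closedBall (0 : Eu n) 1 → 1 / 4 ≤ ‖x‖ ^ 2 := by
    intro x hx
    have : 1 < ‖x‖ := by simpa using hx
    nlinarith
  have hT : ∀ k, Test (Metric.closedBall 0 1) (fun x : Eu n => G k (‖x‖ ^ 2)) := fun k =>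
    test_of_zero hK ((hGs k).comp sm_normSq) fun x hx => hG0 k _ (hq x hx)
  have hpd : ∀ k i (x : Eu n), pd i (fun x : Eu n => G k (‖x‖ ^ 2)) x
      = 2 * x i * G (k + 1) (‖x‖ ^ 2) := fun k i x => pd_comp_normSq (hG k _) i
  have hE : ∀ k (x : Eu n), euler (fun x : Eu n => G k (‖x‖ ^ 2)) x
      = 2 * ‖x‖ ^ 2 * G (k + 1) (‖x‖ ^ 2) := by
    intro k x
    unfold euler
    simp only [hpd]
    rw [EuclideanSpace.real_norm_sq_eq, Finset.mul_sum, Finset.sum_mul]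
    exact Finset.sum_congr rfl fun i _ => by ring
  have hlap : lap (fun x : Eu n => G 0 (‖x‖ ^ 2))
      = fun x => 2 * n * G 1 (‖x‖ ^ 2) + 4 * (‖x‖ ^ 2 * G 2 (‖x‖ ^ 2)) := by
    funext x
    have : ∀ i, pd i (pd i (fun x : Eu n => G 0 (‖x‖ ^ 2))) x
        = 2 * G 1 (‖x‖ ^ 2) + 4 * (x i ^ 2 * G 2 (‖x‖ ^ 2)) := by
      intro i
      have hpd0 : pd i (fun x : Eu n => G 0 (‖x‖ ^ 2)) = fun x => (2 * x i) * G 1 (‖x‖ ^ 2) :=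
        funext fun y => hpd 0 i y
      have e := pd_mul (f := fun x : Eu n => 2 * x i) (contDiff_const.mul (sm_coord i))
        (hT 1).smooth i x
      rw [hpd0, e, hpd, pd_const_mul (sm_coord i), pd_coord]
      simp only [if_true, Nat.reduceAdd]; ring
    unfold lap
    simp only [this, Finset.sum_add_distrib, ← Finset.mul_sum, ← Finset.sum_mul,
      ← EuclideanSpace.real_norm_sq_eq]
    simp; ring
  let φ₀ : Eu n → ℝ := fun x => (8 + 4 * n) * G 2 (‖x‖ ^ 2) + 8 * (‖x‖ ^ 2 * G 3 (‖x‖ ^ 2))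
  have hφ₀ : Test (Metric.closedBall 0 1) φ₀ :=
    ((hT 2).mul (sm_const (8 + 4 * n))).add (((hT 3).mul sm_normSq).mul (sm_const 8))
  have hker : ∀ i (z : Eu n), z i * φ₀ z = pd i (lap (fun x : Eu n => G 0 (‖x‖ ^ 2))) z := by
    intro i z
    rw [hlap, pd_add ((sm_const _).mul (hT 1).smooth)
      ((sm_const _).mul (sm_normSq.mul (hT 2).smooth)),
      pd_const_mul (hT 1).smooth, pd_const_mul (sm_normSq.mul (hT 2).smooth),
      pd_mul sm_normSq (hT 2).smooth, hpd, hpd, pd_normSq]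
    simp only [φ₀]; ring_nf
  have h_int : ∫ z, φ₀ z = 8 * ∫ z : Eu n, G 2 (‖z‖ ^ 2) := by
    have h1 := euler_ibp (hT 2) (sm_const 1)
    have h2 : euler (fun _ : Eu n => (1 : ℝ)) = fun _ => 0 := by
      funext x; simp [euler, pd_const]
    simp only [h2, hE, zero_mul, integral_zero, one_mul, Nat.reduceAdd] at h1
    have i1 : Integrable (fun z : Eu n => G 2 (‖z‖ ^ 2)) := by
      simpa using (hT 2).int (continuous_const (y := (1 : ℝ)))
    have i2 : Integrable (fun z : Eu n => 2 * ‖z‖ ^ 2 * G 3 (‖z‖ ^ 2)) :=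
      (hT 3).int (continuous_const.mul sm_normSq.continuous)
    have h3 : 0 = (n : ℝ) * (∫ z : Eu n, G 2 (‖z‖ ^ 2))
        + ∫ z : Eu n, 2 * ‖z‖ ^ 2 * G 3 (‖z‖ ^ 2) := by
      rw [← integral_const_mul, ← integral_add (i1.const_mul _) i2]; linarith
    have h4 : ∫ z, φ₀ z = (8 + 4 * n) * (∫ z : Eu n, G 2 (‖z‖ ^ 2))
        + 4 * ∫ z : Eu n, 2 * ‖z‖ ^ 2 * G 3 (‖z‖ ^ 2) := by
      rw [← integral_const_mul, ← integral_const_mul,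
        ← integral_add (i1.const_mul _) (i2.const_mul _)]
      exact integral_congr_ae (Eventually.of_forall fun z => by simp only [φ₀]; ring)
    rw [h4]; linarith
  have hp2 : ∀ y, (p 2).eval y = y ^ 2 * (y ^ 2 - 2 * y) := by
    intro y
    change Polynomial.eval y (Polynomial.X ^ 2 * (Polynomial.X ^ 2 * (1 - Polynomial.derivative 1)
      - Polynomial.derivative (Polynomial.X ^ 2 * (1 - Polynomial.derivative 1)))) = _
    simp
    left; norm_num
  have hG2 : ∀ t, 0 ≤ t → 0 ≤ G 2 t := by
    intro t ht
    rcases le_or_gt (1 / 4) t with h | h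
    · rw [hG0 2 t h]
    · simp only [G, hp2]
      have h1 : 4 ≤ (1 / 4 - t)⁻¹ := by
        rw [le_inv_comm₀ (by norm_num) (by linarith)]; linarith
      have h2 : 0 ≤ (1 / 4 - t)⁻¹ ^ 2 - 2 * (1 / 4 - t)⁻¹ := by nlinarith
      have := expNegInvGlue.nonneg (1 / 4 - t)
      positivity
  have hpos : 0 < ∫ z : Eu n, G 2 (‖z‖ ^ 2) := by
    refine (hT 2).smooth.continuous.integral_pos_of_hasCompactSupport_nonneg_nonzero
      (hT 2).compact (fun z => hG2 _ (by positivity)) (x := 0) ?_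
    simp only [G, hp2, norm_zero]
    have := expNegInvGlue.pos_of_pos (x := 1 / 4) (by norm_num)
    norm_num
  refine ⟨fun x => (∫ z, φ₀ z)⁻¹ * G 0 (‖x‖ ^ 2), fun x => (∫ z, φ₀ z)⁻¹ * φ₀ x,
    (hT 0).mul (sm_const _), hφ₀.mul (sm_const _), ?_, fun i z => ?_⟩
  · rw [integral_const_mul, inv_mul_cancel₀]
    rw [h_int]; positivity
  · have e1 : ∀ c : ℝ, lap (fun x : Eu n => c * G 0 (‖x‖ ^ 2))
        = fun x => c * lap (fun x : Eu n => G 0 (‖x‖ ^ 2)) x := by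
      intro c; funext x
      unfold lap
      rw [Finset.mul_sum]
      refine Finset.sum_congr rfl fun i _ => ?_
      rw [show pd i (fun x : Eu n => c * G 0 (‖x‖ ^ 2)) = _ from
        funext fun y => pd_const_mul (hT 0).smooth c i y,
        pd_const_mul ((hT 0).smooth.pd i)]
    rw [e1, pd_const_mul (hT 0).smooth.lap, ← hker]; ring

end

section

variable {n : ℕ}

/-- The closed unit ball. -/
abbrev Bl (n : ℕ) : Set (Eu n) := Metric.closedBall 0 1

theorem Test.abs_integral_le {S : Set (Eu n)} {κ w : Eu n → ℝ} (h : Test S κ)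
    (hw : Continuous w) {m : ℝ} (hm : ∀ z ∈ S, |w z| ≤ m) :
    |∫ z, w z * κ z| ≤ (∫ z, |κ z|) * m := by
  rw [mul_comm, ← integral_const_mul]
  refine (abs_integral_le_integral_abs).trans ?_
  have i2 : Integrable (fun z => |κ z|) := by
    simpa using (h.int (continuous_const (y := (1 : ℝ)))).abs
  refine MeasureTheory.integral_mono (h.int hw).abs (i2.const_mul m) fun z => ?_
  simp only [abs_mul]
  by_cases hz : z ∈ S
  · exact mul_le_mul_of_nonneg_right (hm z hz) (abs_nonneg _)
  · simp [h.zero hz]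

theorem pd_lap {f : Eu n → ℝ} (hf : Sm f) (k : Fin n) (x : Eu n) :
    pd k (lap f) x = lap (pd k f) x := by
  unfold lap
  rw [pd_sum _ fun i => (hf.pd i).pd i]
  refine Finset.sum_congr rfl fun i _ => ?_
  rw [pd_comm (hf.pd i)]
  congr 1; funext y; exact pd_comm hf k i y

theorem NSOn.integral_pressure_lap {S T : Set (Eu n)} {U : Fin n → Eu n → ℝ} {P f : Eu n → ℝ}
    (h : NSOn S U P) (ht : Test T f) (hTS : T ⊆ S) (a : Fin n → ℝ) :
    ∫ x, P x * lap f x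
      = -∑ i, ∑ j, ∫ x, (U i x - a i) * (U j x - a j) * pd i (pd j f) x := by
  have hs : ∀ i, Sm (fun y => U i y - a i) := fun i => (h.smU i).sub contDiff_const
  have hs2 : ∀ i j, Sm (fun y => (U i y - a i) * (U j y - a j)) := fun i j => (hs i).mul (hs j)
  rw [← lap_ibp ht h.smP]
  have e : ∀ x ∈ T, lap P x
      = -∑ i, ∑ j, pd i (pd j (fun y => (U i y - a i) * (U j y - a j))) x := fun x hx => by
    rw [h.lap_pressure (hTS hx), h.sum_pd_pd a (hTS hx)]
  rw [ht.integral_congr e]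
  simp only [neg_mul, integral_neg, Finset.sum_mul]
  have i1 : ∀ i j, Integrable (fun x =>
      pd i (pd j (fun y => (U i y - a i) * (U j y - a j))) x * f x) := fun i j =>
    ht.int (((hs2 i j).pd j).pd i).continuous
  rw [integral_finsetSum _ fun i _ => integrable_finsetSum _ fun j _ => i1 i j]
  congr 1
  refine Finset.sum_congr rfl fun i _ => ?_
  rw [integral_finsetSum _ fun j _ => i1 i j]
  exact Finset.sum_congr rfl fun j _ => ibp2 ht (hs2 i j) i j

theorem NSOn.abs_integral_pressure_lap_le {S : Set (Eu n)} {U : Fin n → Eu n → ℝ}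
    {P f : Eu n → ℝ} (h : NSOn S U P) (ht : Test (Bl n) f) (hTS : Bl n ⊆ S) (a : Fin n → ℝ)
    {m : ℝ} (hm : ∀ k, ∀ z ∈ Bl n, |U k z - a k| ≤ m) :
    |∫ x, P x * lap f x| ≤ (∑ i, ∑ j, ∫ x, |pd i (pd j f) x|) * m ^ 2 := by
  rw [h.integral_pressure_lap ht hTS a, abs_neg, Finset.sum_mul]
  refine (Finset.abs_sum_le_sum_abs _ _).trans (Finset.sum_le_sum fun i _ => ?_)
  rw [Finset.sum_mul]
  refine (Finset.abs_sum_le_sum_abs _ _).trans (Finset.sum_le_sum fun j _ => ?_)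
  have hs : ∀ i, Continuous (fun y => U i y - a i) := fun i =>
    (h.smU i).continuous.sub continuous_const
  refine ((ht.pd j).pd i).abs_integral_le ((hs i).mul (hs j)) fun z hz => ?_
  simp only [Pi.mul_apply, abs_mul, sq]
  exact mul_le_mul (hm i z hz) (hm j z hz) (abs_nonneg _) ((abs_nonneg _).trans (hm i z hz))

theorem Kern.integral_euler {ψ φ : Eu n → ℝ} (h : Kern ψ φ) {w : Eu n → ℝ} (hw : Sm w) :
    ∫ z, euler w z * φ z = -∫ z, w z * lap (lap ψ) z := by
  have e : ∀ z, euler w z * φ z = ∑ i, pd i w z * pd i (lap ψ) z := by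
    intro z
    simp only [euler, Finset.sum_mul, ← h.grad]
    exact Finset.sum_congr rfl fun i _ => by ring
  simp only [e]
  rw [integral_finsetSum _ fun i _ => (h.potential.lap.pd i).int (hw.pd i).continuous]
  rw [show (fun z => w z * lap (lap ψ) z) = fun z => ∑ i, w z * pd i (pd i (lap ψ)) z from
    funext fun z => by rw [← Finset.mul_sum]; rfl]
  rw [integral_finsetSum _ fun i _ => ((h.potential.lap.pd i).pd i).int hw.continuous,
    ← Finset.sum_neg_distrib]
  exact Finset.sum_congr rfl fun i _ => ibp (h.potential.lap.pd i) hw i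

theorem Kern.euler_velocity {ψ φ : Eu n → ℝ} (h : Kern ψ φ) : ∃ K, 0 ≤ K ∧
    ∀ (S : Set (Eu n)) (U : Fin n → Eu n → ℝ) (P : Eu n → ℝ) (m : ℝ), NSOn S U P → Bl n ⊆ S →
      (∀ k, ∀ z ∈ Bl n, |U k z| ≤ m) → ∀ k, |∫ z, euler (U k) z * φ z| ≤ K * m ^ 2 := by
  have hl := h.potential.lap
  refine ⟨(∑ i, ∫ z, |pd i (lap ψ) z|) + ∑ k, ∑ i, ∑ j, ∫ x, |pd i (pd j (pd k ψ)) x|,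
    add_nonneg (Finset.sum_nonneg fun i _ => integral_nonneg fun _ => abs_nonneg _)
      (Finset.sum_nonneg fun k _ => Finset.sum_nonneg fun i _ => Finset.sum_nonneg fun j _ =>
        integral_nonneg fun _ => abs_nonneg _), ?_⟩
  intro S U P m hs hB hm k
  have e1 : ∫ z, euler (U k) z * φ z
      = (∑ i, ∫ z, U k z * U i z * pd i (lap ψ) z) + ∫ z, P z * lap (pd k ψ) z := by
    rw [h.integral_euler (hs.smU k), ← lap_ibp hl (hs.smU k)]
    have e2 : ∀ z ∈ Bl n, lap (U k) z = transp U (U k) z + pd k P z := fun z hz =>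
      hs.ns z (hB hz) k
    rw [hl.integral_congr e2]
    simp only [add_mul]
    have hl' : Test S (lap ψ) := ⟨hl.smooth, hl.compact, hl.supp.trans hB⟩
    rw [integral_add (hl.int (sm_transp hs.smU (hs.smU k)).continuous)
      (hl.int (hs.smP.pd k).continuous), hs.transp_ibp hl' (hs.smU k), ibp hl hs.smP,
      neg_add, neg_neg, neg_neg]
    simp only [pd_lap h.potential.smooth]
    congr 1
    rw [← integral_finsetSum _ fun i _ => ?_]
    · refine integral_congr_ae (Eventually.of_forall fun z => ?_)
      simp only [transp, Finset.mul_sum, pd_lap h.potential.smooth, mul_assoc]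
    · have := (hl.pd i).int ((hs.smU k).mul (hs.smU i)).continuous
      simpa only [pd_lap h.potential.smooth] using this
  rw [e1, add_mul]
  refine (abs_add_le _ _).trans (add_le_add ?_ ?_)
  · rw [Finset.sum_mul]
    refine (Finset.abs_sum_le_sum_abs _ _).trans (Finset.sum_le_sum fun i _ => ?_)
    refine (hl.pd i).abs_integral_le ((hs.smU k).mul (hs.smU i)).continuous fun z hz => ?_
    rw [abs_mul, sq]
    exact mul_le_mul (hm k z hz) (hm i z hz) (abs_nonneg _) ((abs_nonneg _).trans (hm i z hz))
  · refine (hs.abs_integral_pressure_lap_le (h.potential.pd k) hB (fun _ => 0)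
      (by simpa using hm)).trans (mul_le_mul_of_nonneg_right ?_ (sq_nonneg m))
    exact Finset.single_le_sum (f := fun k => ∑ i, ∑ j, ∫ x, |pd i (pd j (pd k ψ)) x|)
      (fun k _ => Finset.sum_nonneg fun i _ => Finset.sum_nonneg fun j _ =>
        integral_nonneg fun _ => abs_nonneg _) (Finset.mem_univ k)

theorem Kern.euler_pressure {ψ φ : Eu n → ℝ} (h : Kern ψ φ) : ∃ K, 0 ≤ K ∧
    ∀ (S : Set (Eu n)) (U : Fin n → Eu n → ℝ) (P : Eu n → ℝ) (m : ℝ) (a : Fin n → ℝ),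
      NSOn S U P → Bl n ⊆ S → (∀ k, ∀ z ∈ Bl n, |U k z - a k| ≤ m) →
      |∫ z, euler P z * φ z| ≤ K * m ^ 2 := by
  refine ⟨∑ i, ∑ j, ∫ x, |pd i (pd j (lap ψ)) x|, Finset.sum_nonneg fun i _ =>
    Finset.sum_nonneg fun j _ => integral_nonneg fun _ => abs_nonneg _, ?_⟩
  intro S U P m a hs hB hm
  rw [h.integral_euler hs.smP, abs_neg]
  exact hs.abs_integral_pressure_lap_le h.potential.lap hB a hm

theorem Kern.grad_bounds {ψ φ : Eu n → ℝ} (h : Kern ψ φ) : ∃ K, 0 ≤ K ∧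
    ∀ (S : Set (Eu n)) (U : Fin n → Eu n → ℝ) (P : Eu n → ℝ) (m : ℝ), NSOn S U P → Bl n ⊆ S →
      (∀ k, ∀ z ∈ Bl n, |U k z| ≤ m) → ∀ k, |∫ z, pd k P z * φ z| ≤ K * (m + m ^ 2) ∧
        ∀ i, |∫ z, pd i (U k) z * φ z| ≤ K * m := by
  have hn : ∀ i, 0 ≤ ∫ z, |pd i φ z| := fun i => integral_nonneg fun _ => abs_nonneg _
  have hn' : 0 ≤ ∫ z, |lap φ z| := integral_nonneg fun _ => abs_nonneg _
  refine ⟨(∫ z, |lap φ z|) + ∑ i, ∫ z, |pd i φ z|, add_nonneg hn'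
    (Finset.sum_nonneg fun i _ => hn i), ?_⟩
  intro S U P m hs hB hm k
  have hm0 : 0 ≤ m := (abs_nonneg _).trans (hm k 0 (by simp))
  have ht := h.test
  have ht' : Test S φ := ⟨ht.smooth, ht.compact, ht.supp.trans hB⟩
  have hsum : 0 ≤ ∑ i, ∫ z, |pd i φ z| := Finset.sum_nonneg fun i _ => hn i
  constructor
  · have e2 : ∀ z ∈ Bl n, pd k P z = lap (U k) z - transp U (U k) z := fun z hz => by
      rw [hs.ns z (hB hz) k]; unfold transp; ring
    rw [ht.integral_congr e2, hs.weak ht' (hs.smU k)]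
    have e3 : ∀ z, U k z * (lap φ z + transp U φ z)
        = U k z * lap φ z + ∑ i, U k z * U i z * pd i φ z := fun z => by
      simp only [transp, mul_add, Finset.mul_sum, mul_assoc]
    simp only [e3]
    have i1 : ∀ i, Integrable (fun z => U k z * U i z * pd i φ z) := fun i =>
      (ht.pd i).int ((hs.smU k).mul (hs.smU i)).continuous
    rw [integral_add (ht.lap.int (hs.smU k).continuous) (integrable_finsetSum _ fun i _ => i1 i),
      integral_finsetSum _ fun i _ => i1 i]
    have b1 := ht.lap.abs_integral_le (hs.smU k).continuous (hm k)
    have b2 : |∑ i, ∫ z, U k z * U i z * pd i φ z| ≤ (∑ i, ∫ z, |pd i φ z|) * m ^ 2 := by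
      rw [Finset.sum_mul]
      refine (Finset.abs_sum_le_sum_abs _ _).trans (Finset.sum_le_sum fun i _ => ?_)
      refine (ht.pd i).abs_integral_le ((hs.smU k).mul (hs.smU i)).continuous fun z hz => ?_
      rw [abs_mul, sq]
      exact mul_le_mul (hm k z hz) (hm i z hz) (abs_nonneg _)
        ((abs_nonneg _).trans (hm i z hz))
    refine (abs_add_le _ _).trans ((add_le_add b1 b2).trans ?_)
    nlinarith [mul_nonneg hn' (sq_nonneg m), mul_nonneg hsum hm0]
  · intro i
    rw [ibp ht (hs.smU k), abs_neg]
    refine ((ht.pd i).abs_integral_le (hs.smU k).continuous (hm k)).trans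
      (mul_le_mul_of_nonneg_right ?_ hm0)
    have := Finset.single_le_sum (f := fun i => ∫ z, |pd i φ z|) (fun i _ => hn i)
      (Finset.mem_univ i)
    linarith

theorem hasDerivAt_integral_path {φ w : Eu n → ℝ} (hφ : Test (Bl n) φ) (hw : Sm w)
    {a b : Eu n → Eu n} (ha : Continuous a) (hb : Continuous b) (t : ℝ) :
    HasDerivAt (fun t : ℝ => ∫ z, w (a z + t • b z) * φ z)
      (∫ z, (∑ i, b z i * pd i w (a z + t • b z)) * φ z) t := by
  have hc : Continuous fun q : ℝ × Eu n => fderiv ℝ w (a q.2 + q.1 • b q.2) (b q.2) :=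
    ((hw.continuous_fderiv (by simp)).comp (by fun_prop)).clm_apply (by fun_prop)
  obtain ⟨M, hM⟩ := ((isCompact_closedBall t 1).prod
    (isCompact_closedBall (0 : Eu n) 1)).exists_bound_of_continuousOn hc.continuousOn
  have hd : ∀ z t, HasDerivAt (fun t : ℝ => w (a z + t • b z) * φ z)
      (fderiv ℝ w (a z + t • b z) (b z) * φ z) t := by
    intro z t
    have h1 : HasDerivAt (fun t : ℝ => a z + t • b z) (b z) t := by
      simpa using ((hasDerivAt_id t).smul_const (b z)).const_add (a z)
    exact ((hw.diff (a z + t • b z)).hasFDerivAt.comp_hasDerivAt t h1).mul_const _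
  have h_int : Integrable (fun z => |φ z|) := by
    simpa using (hφ.int (continuous_const (y := (1 : ℝ)))).abs
  have := (hasDerivAt_integral_of_dominated_loc_of_deriv_le
    (μ := (volume : Measure (Eu n))) (F := fun t z => w (a z + t • b z) * φ z)
    (F' := fun t z => fderiv ℝ w (a z + t • b z) (b z) * φ z)
    (bound := fun z => M * |φ z|) (x₀ := t) (Metric.ball_mem_nhds t one_pos)
    (Eventually.of_forall fun s => Continuous.aestronglyMeasurable
      ((hw.continuous.comp (by fun_prop)).mul hφ.smooth.continuous))
    (hφ.int (hw.continuous.comp (by fun_prop)))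
    (Continuous.aestronglyMeasurable
      ((hc.comp (by fun_prop : Continuous fun z : Eu n => (t, z))).mul hφ.smooth.continuous))
    (Eventually.of_forall fun z s hs => ?_) (h_int.const_mul M)
    (Eventually.of_forall fun z s _ => hd z s)).2
  · simpa only [fderiv_eq_sum] using this
  · by_cases hz : z ∈ Bl n
    · rw [norm_mul, Real.norm_eq_abs (φ z)]
      exact mul_le_mul_of_nonneg_right
        (hM (s, z) ⟨Metric.ball_subset_closedBall hs, hz⟩) (abs_nonneg _)
    · simp [hφ.zero hz]

end

section

variable {n : ℕ}

/-- The average of `w` at scale `s` around `x` with weight `φ`. -/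
noncomputable def avg (φ w : Eu n → ℝ) (x : Eu n) (s : ℝ) : ℝ := ∫ z, w (x + s • z) * φ z

theorem abs_sub_le_of_hasDerivAt {L L' : ℝ → ℝ} (h : ∀ t, HasDerivAt L (L' t) t) {s B : ℝ}
    (hs : 0 < s) (hB : ∀ t ∈ Ioo 0 s, |L' t| ≤ B) : |L s - L 0| ≤ B * s := by
  obtain ⟨t, ht, he⟩ := exists_hasDerivAt_eq_slope L L' hs
    (fun t _ => (h t).continuousAt.continuousWithinAt) fun t _ => h t
  have h1 : L s - L 0 = L' t * s := by
    rw [he, sub_zero, div_mul_cancel₀ _ hs.ne']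
  rw [h1, abs_mul, abs_of_pos hs]
  exact mul_le_mul_of_nonneg_right (hB t ht) hs.le

theorem Kern.abs_avg_sub_le {ψ φ : Eu n → ℝ} (h : Kern ψ φ) {w : Eu n → ℝ} (hw : Sm w)
    (x : Eu n) {s B : ℝ} (hs : 0 < s)
    (hB : ∀ t ∈ Ioo 0 s, |∫ z, (∑ i, z i * pd i w (x + t • z)) * φ z| ≤ B) :
    |avg φ w x s - w x| ≤ B * s := by
  have h1 := abs_sub_le_of_hasDerivAt (L := fun s => avg φ w x s)
    (fun t => hasDerivAt_integral_path h.test hw continuous_const continuous_id t) hs hB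
  have h2 : avg φ w x 0 = w x := by
    simp [avg, integral_const_mul, h.integral_eq]
  rwa [h2] at h1

theorem Kern.abs_avg_sub_avg_le {ψ φ : Eu n → ℝ} (h : Kern ψ φ) {w : Eu n → ℝ} (hw : Sm w)
    (x y : Eu n) {s B : ℝ}
    (hB : ∀ t ∈ Ioo (0 : ℝ) 1, ∀ i,
      |∫ z, pd i w ((y + t • (x - y)) + s • z) * φ z| ≤ B) :
    |avg φ w x s - avg φ w y s| ≤ n * B * dist x y := by
  have h1 := abs_sub_le_of_hasDerivAt
    (L := fun t => ∫ z, w ((y + s • z) + t • (x - y)) * φ z)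
    (B := n * B * dist x y)
    (fun t => hasDerivAt_integral_path h.test hw (a := fun z => y + s • z)
      (b := fun _ => x - y) (by fun_prop) continuous_const t) one_pos ?_
  · have e0 : ∀ z : Eu n, (y + s • z) + (0 : ℝ) • (x - y) = y + s • z := fun z => by simp
    have e1 : ∀ z : Eu n, (y + s • z) + (1 : ℝ) • (x - y) = x + s • z := fun z => by
      rw [one_smul]; abel
    simp only [e0, e1, mul_one] at h1
    exact h1
  · intro t ht
    have e : ∀ z, (∑ i, (x - y) i * pd i w ((y + s • z) + t • (x - y))) * φ z
        = ∑ i, (x - y) i * (pd i w ((y + t • (x - y)) + s • z) * φ z) := fun z => by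
      rw [Finset.sum_mul, add_right_comm]
      exact Finset.sum_congr rfl fun i _ => by ring
    simp only [e]
    have i1 : ∀ i, Integrable (fun z => pd i w ((y + t • (x - y)) + s • z) * φ z) := fun i =>
      h.test.int (sm_affine (hw.pd i) _ s).continuous
    rw [integral_finsetSum _ fun i _ => (i1 i).const_mul _]
    refine (Finset.abs_sum_le_sum_abs _ _).trans ?_
    refine (Finset.sum_le_card_nsmul _ _ (dist x y * B) fun i _ => ?_).trans (le_of_eq ?_)
    · rw [integral_const_mul, abs_mul]
      refine mul_le_mul ?_ (hB t ht i) (abs_nonneg _) dist_nonneg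
      rw [dist_eq_norm]
      exact PiLp.norm_apply_le (x - y) i
    · simp; ring

theorem dist_add_smul_le {s : ℝ} (hs : 0 ≤ s) {z : Eu n} (hz : z ∈ Bl n) (x : Eu n) :
    dist (x + s • z) x ≤ s := by
  have : ‖z‖ ≤ 1 := by simpa using hz
  rw [dist_eq_norm, add_sub_cancel_left, norm_smul, Real.norm_of_nonneg hs]
  nlinarith

theorem Kern.velocity_avg {ψ φ : Eu n → ℝ} (h : Kern ψ φ) : ∃ K, 0 ≤ K ∧
    ∀ (S : Set (Eu n)) (U : Fin n → Eu n → ℝ) (P : Eu n → ℝ) (x : Eu n) (s M : ℝ),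
      NSOn S U P → 0 < s → (∀ y, dist y x ≤ s → y ∈ S ∧ ∀ k, |U k y| ≤ M) →
      ∀ k, |avg φ (U k) x s - U k x| ≤ K * M ^ 2 * s := by
  obtain ⟨K, hK, hA⟩ := h.euler_velocity
  refine ⟨K, hK, fun S U P x s M hs hs0 hy k => h.abs_avg_sub_le (hs.smU k) x hs0 ?_⟩
  intro t ht
  have ht0 := ht.1
  have key := hA _ _ _ (t * M) (hs.rescale x t)
    (fun z hz => (hy _ ((dist_add_smul_le ht0.le hz x).trans ht.2.le)).1)
    (fun k z hz => by
      rw [abs_mul, abs_of_pos ht0]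
      exact mul_le_mul_of_nonneg_left
        ((hy _ ((dist_add_smul_le ht0.le hz x).trans ht.2.le)).2 k) ht0.le) k
  have e : ∀ z, euler (fun z => t * U k (x + t • z)) z * φ z
      = t ^ 2 * ((∑ i, z i * pd i (U k) (x + t • z)) * φ z) := by
    intro z
    simp only [euler, pd_const_mul (sm_affine (hs.smU k) x t), pd_affine (hs.smU k)]
    rw [← mul_assoc, Finset.mul_sum]
    congr 1
    exact Finset.sum_congr rfl fun i _ => by ring
  simp only [e] at key
  rw [integral_const_mul, abs_mul, abs_of_pos (by positivity)] at key
  refine le_of_mul_le_mul_left (key.trans (le_of_eq (by ring))) (by positivity : 0 < t ^ 2)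

theorem Kern.velocity_translate {ψ φ : Eu n → ℝ} (h : Kern ψ φ) : ∃ K, 0 ≤ K ∧
    ∀ (S : Set (Eu n)) (U : Fin n → Eu n → ℝ) (P : Eu n → ℝ) (x y : Eu n) (s M : ℝ),
      NSOn S U P → 0 < s → (∀ w, dist w x ≤ s + dist x y → w ∈ S ∧ ∀ k, |U k w| ≤ M) →
      ∀ k, |avg φ (U k) x s - avg φ (U k) y s| ≤ K * M / s * dist x y := by
  obtain ⟨K, hK, hA⟩ := h.grad_bounds
  refine ⟨n * K, by positivity, fun S U P x y s M hs hs0 hy k => ?_⟩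
  have hd : ∀ t ∈ Ioo (0 : ℝ) 1, ∀ z ∈ Bl n,
      dist ((y + t • (x - y)) + s • z) x ≤ s + dist x y := by
    intro t ht z hz
    refine (dist_triangle _ (y + t • (x - y)) _).trans
      (add_le_add (dist_add_smul_le hs0.le hz _) ?_)
    have : y + t • (x - y) - x = (1 - t) • (y - x) := by module
    rw [dist_eq_norm, this, norm_smul, Real.norm_of_nonneg (by linarith [ht.2]), dist_comm,
      dist_eq_norm]
    nlinarith [ht.1, norm_nonneg (y - x)]
  refine (h.abs_avg_sub_avg_le (hs.smU k) x y (s := s) (B := K * M / s) ?_).trans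
    (le_of_eq (by ring))
  intro t ht i
  have key := (hA _ _ _ (s * M) (hs.rescale (y + t • (x - y)) s)
    (fun z hz => (hy _ (hd t ht z hz)).1)
    (fun k z hz => by
      rw [abs_mul, abs_of_pos hs0]
      exact mul_le_mul_of_nonneg_left ((hy _ (hd t ht z hz)).2 k) hs0.le) k).2 i
  simp only [pd_const_mul (sm_affine (hs.smU k) _ s), pd_affine (hs.smU k), mul_assoc] at key
  rw [integral_const_mul, integral_const_mul, abs_mul, abs_mul, abs_of_pos hs0] at key
  rw [le_div_iff₀ hs0]
  nlinarith

theorem Kern.holder {ψ φ : Eu n → ℝ} (h : Kern ψ φ) : ∃ K, 0 ≤ K ∧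
    ∀ (S : Set (Eu n)) (U : Fin n → Eu n → ℝ) (P : Eu n → ℝ) (x y : Eu n) (m : ℝ),
      NSOn S U P → 0 ≤ m → dist x y ≤ 1 → (∀ w, dist w x ≤ 2 → w ∈ S ∧ ∀ k, |U k w| ≤ m) →
      ∀ k, |U k x - U k y| ≤ K * (m + m ^ 2) * √(dist x y) := by
  obtain ⟨K₁, hK₁, h1⟩ := h.velocity_avg
  obtain ⟨K₂, hK₂, h2⟩ := h.velocity_translate
  refine ⟨2 * K₁ + K₂, by positivity, fun S U P x y m hs hm hxy hw k => ?_⟩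
  rcases (dist_nonneg (x := x) (y := y)).eq_or_lt with hd | hd
  · rw [dist_eq_zero.1 hd.symm]; simp
  set s := √(dist x y) with hsdef
  have hs0 : 0 < s := Real.sqrt_pos.2 hd
  have hs2 : s ^ 2 = dist x y := Real.sq_sqrt hd.le
  have hs1 : s ≤ 1 := by nlinarith
  have a1 := h1 S U P x s m hs hs0 (fun w hwx => hw w (by linarith)) k
  have a2 := h1 S U P y s m hs hs0 (fun w hwx => hw w (by
    have := dist_triangle w y x
    rw [dist_comm y x] at this; linarith)) k
  have a3 := h2 S U P x y s m hs hs0 (fun w hwx => hw w (by linarith)) k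
  rw [← hs2] at a3
  have e : K₂ * m / s * s ^ 2 = K₂ * m * s := by field_simp
  rw [e] at a3
  rw [abs_le] at a1 a2 a3 ⊢
  have p1 : 0 ≤ K₁ * m * s := by positivity
  have p2 : 0 ≤ K₂ * m ^ 2 * s := by positivity
  constructor <;> nlinarith

theorem Kern.pressure_avg {ψ φ : Eu n → ℝ} (h : Kern ψ φ) : ∃ K, 0 ≤ K ∧
    ∀ (S : Set (Eu n)) (U : Fin n → Eu n → ℝ) (P : Eu n → ℝ) (x : Eu n) (m : ℝ),
      NSOn S U P → 0 ≤ m → (∀ w, dist w x ≤ 2 → w ∈ S ∧ ∀ k, |U k w| ≤ m) →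
      |avg φ P x 1 - P x| ≤ K * (m + m ^ 2) ^ 2 := by
  obtain ⟨K₁, hK₁, h1⟩ := h.holder
  obtain ⟨K₂, hK₂, h2⟩ := h.euler_pressure
  refine ⟨K₂ * K₁ ^ 2, by positivity, fun S U P x m hs hm hw => ?_⟩
  refine (h.abs_avg_sub_le hs.smP x one_pos (B := K₂ * K₁ ^ 2 * (m + m ^ 2) ^ 2) ?_).trans
    (le_of_eq (mul_one _))
  intro t ht
  have ht0 := ht.1
  have hd : ∀ z ∈ Bl n, dist (x + t • z) x ≤ t := fun z hz => dist_add_smul_le ht0.le hz x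
  have key := h2 _ _ _ (t * (K₁ * (m + m ^ 2) * √t)) (fun k => t * U k x) (hs.rescale x t)
    (fun z hz => (hw _ ((hd z hz).trans (by linarith [ht.2]))).1)
    (fun k z hz => by
      rw [← mul_sub, abs_mul, abs_of_pos ht0, abs_sub_comm]
      refine mul_le_mul_of_nonneg_left ?_ ht0.le
      have hz' := hd z hz
      rw [dist_comm] at hz'
      refine (h1 S U P x (x + t • z) m hs hm (hz'.trans ht.2.le) hw k).trans ?_
      exact mul_le_mul_of_nonneg_left (Real.sqrt_le_sqrt hz') (by positivity))
  have e : ∀ z, euler (fun z => t ^ 2 * P (x + t • z)) z * φ z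
      = t ^ 3 * ((∑ i, z i * pd i P (x + t • z)) * φ z) := by
    intro z
    simp only [euler, pd_const_mul (sm_affine hs.smP x t), pd_affine hs.smP]
    rw [← mul_assoc, Finset.mul_sum]
    congr 1
    exact Finset.sum_congr rfl fun i _ => by ring
  simp only [e] at key
  rw [integral_const_mul, abs_mul, abs_of_pos (by positivity)] at key
  refine le_of_mul_le_mul_left (key.trans (le_of_eq ?_)) (by positivity : 0 < t ^ 3)
  have := Real.sq_sqrt ht0.le
  calc K₂ * (t * (K₁ * (m + m ^ 2) * √t)) ^ 2
      = K₂ * t ^ 2 * K₁ ^ 2 * (m + m ^ 2) ^ 2 * √t ^ 2 := by ring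
    _ = _ := by rw [this]; ring

theorem Kern.pressure_osc {ψ φ : Eu n → ℝ} (h : Kern ψ φ) : ∃ K, 0 ≤ K ∧
    ∀ (S : Set (Eu n)) (U : Fin n → Eu n → ℝ) (P : Eu n → ℝ) (x y : Eu n) (m : ℝ),
      NSOn S U P → 0 ≤ m → dist x y ≤ 1 → (∀ w, dist w x ≤ 3 → w ∈ S ∧ ∀ k, |U k w| ≤ m) →
      |P x - P y| ≤ K * ((m + m ^ 2) + (m + m ^ 2) ^ 2) := by
  rcases Nat.eq_zero_or_pos n with hn | hn
  · subst hn
    refine ⟨0, le_rfl, fun S U P x y m _ _ _ _ => ?_⟩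
    rw [Subsingleton.elim x y]; simp
  obtain ⟨K₁, hK₁, h1⟩ := h.pressure_avg
  obtain ⟨K₂, hK₂, h2⟩ := h.grad_bounds
  refine ⟨2 * K₁ + n * K₂, by positivity, fun S U P x y m hs hm hxy hw => ?_⟩
  have a1 := h1 S U P x m hs hm (fun w hwx => hw w (by linarith))
  have a2 := h1 S U P y m hs hm (fun w hwx => hw w (by
    have := dist_triangle w y x
    rw [dist_comm y x] at this; linarith))
  have a3 : |avg φ P x 1 - avg φ P y 1| ≤ n * (K₂ * (m + m ^ 2)) * dist x y := by
    refine h.abs_avg_sub_avg_le hs.smP x y fun t ht i => ?_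
    have hd : ∀ z ∈ Bl n, dist ((y + t • (x - y)) + (1 : ℝ) • z) x ≤ 3 := by
      intro z hz
      refine (dist_triangle _ (y + t • (x - y)) _).trans
        ((add_le_add (dist_add_smul_le zero_le_one hz _) (?_ : _ ≤ (2 : ℝ))).trans (by norm_num))
      have : y + t • (x - y) - x = (1 - t) • (y - x) := by module
      rw [dist_eq_norm, this, norm_smul, Real.norm_of_nonneg (by linarith [ht.2])]
      rw [dist_comm, dist_eq_norm] at hxy
      nlinarith [ht.1, norm_nonneg (y - x)]
    have key := (h2 _ _ _ m (hs.rescale (y + t • (x - y)) 1)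
      (fun z hz => (hw _ (hd z hz)).1)
      (fun k z hz => by simpa using (hw _ (hd z hz)).2 k) i).1
    simp only [pd_affine hs.smP, one_pow, one_mul] at key
    exact key
  have a4 : (n : ℝ) * (K₂ * (m + m ^ 2)) * dist x y ≤ n * (K₂ * (m + m ^ 2)) :=
    mul_le_of_le_one_right (by positivity) hxy
  have p1 : 0 ≤ K₁ * (m + m ^ 2) := by positivity
  have p2 : 0 ≤ n * K₂ * (m + m ^ 2) ^ 2 := by positivity
  rw [abs_le] at a1 a2 a3 ⊢
  constructor <;> nlinarith

end

section

variable {n : ℕ}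

/-- A solution in the exterior of the ball of radius `2` that is bounded by `C / ‖x‖`. -/
structure Ext (C : ℝ) (U : Fin n → Eu n → ℝ) (P : Eu n → ℝ) : Prop where
  sol : NSOn {x | 2 < ‖x‖} U P
  nonneg : 0 ≤ C
  bound : ∀ x : Eu n, 2 < ‖x‖ → ∀ k, |U k x| ≤ C / ‖x‖

theorem Ext.pressure_osc {C : ℝ} {U : Fin n → Eu n → ℝ} {P : Eu n → ℝ} (h : Ext C U P) :
    ∃ K, 0 ≤ K ∧ ∀ x y : Eu n, 8 ≤ ‖x‖ → dist x y ≤ ‖x‖ / 6 → |P x - P y| ≤ K / ‖x‖ ^ 2 := by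
  obtain ⟨ψ, φ, hk⟩ := exists_kern n
  obtain ⟨K, hK, h1⟩ := hk.pressure_osc
  have hC := h.nonneg
  refine ⟨36 * (K * ((C + C ^ 2) + (C + C ^ 2) ^ 2)), by positivity, fun x y hx hxy => ?_⟩
  set s := ‖x‖ / 6 with hs
  have hs0 : 0 < s := by positivity
  have hy : x + s • (s⁻¹ • (y - x)) = y := by
    rw [smul_smul, mul_inv_cancel₀ hs0.ne', one_smul]; abel
  have key := h1 _ _ _ 0 (s⁻¹ • (y - x)) C (h.sol.rescale x s) hC ?_ ?_
  · simp only [hy, smul_zero, add_zero] at key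
    rw [← mul_sub, abs_mul, abs_of_pos (by positivity)] at key
    rw [le_div_iff₀ (by positivity)]
    have e : ‖x‖ ^ 2 = 36 * s ^ 2 := by rw [hs]; ring
    rw [e]; linarith
  · rw [dist_comm, dist_zero_right, norm_smul, norm_inv, Real.norm_of_nonneg hs0.le,
      ← dist_eq_norm, dist_comm, inv_mul_le_iff₀ hs0]
    linarith
  · intro w hw
    rw [dist_zero_right] at hw
    have hb : ‖x‖ / 2 ≤ ‖x + s • w‖ := by
      have h2 : ‖x‖ - ‖s • w‖ ≤ ‖x + s • w‖ := by
        simpa using norm_sub_norm_le x (-(s • w))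
      rw [norm_smul, Real.norm_of_nonneg hs0.le] at h2
      nlinarith
    have hb2 : 2 < ‖x + s • w‖ := by linarith
    refine ⟨hb2, fun k => ?_⟩
    rw [abs_mul, abs_of_pos hs0]
    have h3 := h.bound _ hb2 k
    have h4 : |U k (x + s • w)| * ‖x + s • w‖ ≤ C := by
      rwa [le_div_iff₀ (by linarith)] at h3
    have : s ≤ ‖x + s • w‖ := by linarith
    nlinarith [mul_le_mul_of_nonneg_right this (abs_nonneg (U k (x + s • w)))]

theorem Ext.exists_pressure_limit (hn : 2 ≤ n) {C : ℝ} {U : Fin n → Eu n → ℝ} {P : Eu n → ℝ}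
    (h : Ext C U P) :
    ∃ c K, 0 ≤ K ∧ ∀ x : Eu n, 8 ≤ ‖x‖ → |P x - c| ≤ K / ‖x‖ ^ 2 := by
  obtain ⟨K, hK, hosc⟩ := h.pressure_osc
  let q : ℕ → Eu n → ℝ := fun k x => P ((7 / 6 : ℝ) ^ k • x)
  have hnorm : ∀ (k : ℕ) (x : Eu n), ‖(7 / 6 : ℝ) ^ k • x‖ = (7 / 6 : ℝ) ^ k * ‖x‖ := fun k x => by
    rw [norm_smul, Real.norm_of_nonneg (by positivity)]
  have hone : ∀ k : ℕ, (1 : ℝ) ≤ (7 / 6 : ℝ) ^ k := fun k => one_le_pow₀ (by norm_num)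
  have hstep : ∀ x : Eu n, 8 ≤ ‖x‖ → ∀ k, dist (q k x) (q (k + 1) x)
      ≤ K / ‖x‖ ^ 2 * (36 / 49 : ℝ) ^ k := by
    intro x hx k
    rw [Real.dist_eq]
    refine (hosc _ _ ?_ ?_).trans (le_of_eq ?_)
    · rw [hnorm]; nlinarith [hone k]
    · have : (7 / 6 : ℝ) ^ k • x - (7 / 6 : ℝ) ^ (k + 1) • x
          = -((1 / 6 : ℝ) • ((7 / 6 : ℝ) ^ k • x)) := by
        rw [pow_succ]; module
      rw [dist_eq_norm, this, norm_neg, norm_smul, Real.norm_of_nonneg (by norm_num)]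
      linarith
    · rw [hnorm, mul_pow, ← pow_mul, mul_comm k 2, pow_mul,
        show (36 / 49 : ℝ) = ((7 / 6 : ℝ) ^ 2)⁻¹ by norm_num, inv_pow]
      field_simp
  have hlim8 : ∀ x : Eu n, 8 ≤ ‖x‖ → ∃ c, Tendsto (fun k => q k x) atTop (𝓝 c) ∧
      |P x - c| ≤ (K / (1 - 36 / 49)) / ‖x‖ ^ 2 := by
    intro x hx
    have hc := cauchySeq_of_le_geometric _ _ (by norm_num) (hstep x hx)
    obtain ⟨c, hc⟩ := cauchySeq_tendsto_of_complete hc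
    refine ⟨c, hc, ?_⟩
    have := dist_le_of_le_geometric_of_tendsto₀ _ _ (by norm_num) (hstep x hx) hc
    simp only [q, pow_zero, one_smul, Real.dist_eq] at this
    rwa [div_right_comm]
  have hbig : ∀ x : Eu n, x ≠ 0 → ∃ k : ℕ, 8 ≤ ‖(7 / 6 : ℝ) ^ k • x‖ := by
    intro x hx
    obtain ⟨k, hk⟩ := pow_unbounded_of_one_lt (8 / ‖x‖) (by norm_num : (1 : ℝ) < 7 / 6)
    refine ⟨k, ?_⟩
    rw [hnorm]
    exact ((div_lt_iff₀ (norm_pos_iff.2 hx)).1 hk).le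
  have hlim : ∀ x : Eu n, x ≠ 0 → ∃ c, Tendsto (fun k => q k x) atTop (𝓝 c) := by
    intro x hx
    obtain ⟨k, hk⟩ := hbig x hx
    obtain ⟨c, hc, -⟩ := hlim8 _ hk
    refine ⟨c, (tendsto_add_atTop_iff_nat k).1 ?_⟩
    simpa only [q, smul_smul, ← pow_add] using hc
  choose! c hc using hlim
  have hloc : ∀ x y : Eu n, x ≠ 0 → y ≠ 0 → dist x y ≤ ‖x‖ / 6 → c y = c x := by
    intro x y hx hy hxy
    have h1 : Tendsto (fun k => q k x - q k y) atTop (𝓝 (c x - c y)) := (hc x hx).sub (hc y hy)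
    have h2 : Tendsto (fun k => q k x - q k y) atTop (𝓝 0) := by
      refine squeeze_zero_norm' (a := fun k => K / ‖x‖ ^ 2 * (36 / 49 : ℝ) ^ k) ?_ ?_
      · obtain ⟨k₀, hk₀⟩ := hbig x hx
        filter_upwards [eventually_ge_atTop k₀] with k hk
        refine (hosc _ _ ?_ ?_).trans (le_of_eq ?_)
        · refine hk₀.trans ?_
          rw [hnorm, hnorm]
          exact mul_le_mul_of_nonneg_right (pow_le_pow_right₀ (by norm_num) hk) (norm_nonneg _)
        · rw [dist_smul₀, hnorm, Real.norm_of_nonneg (by positivity), mul_div_assoc]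
          exact mul_le_mul_of_nonneg_left hxy (by positivity)
        · rw [hnorm, mul_pow, ← pow_mul, mul_comm k 2, pow_mul,
            show (36 / 49 : ℝ) = ((7 / 6 : ℝ) ^ 2)⁻¹ by norm_num, inv_pow]
          have : ‖x‖ ≠ 0 := norm_ne_zero_iff.2 hx
          field_simp
      · simpa using (tendsto_pow_atTop_nhds_zero_of_lt_one (by norm_num)
          (by norm_num : (36 / 49 : ℝ) < 1)).const_mul (K / ‖x‖ ^ 2)
    linarith [tendsto_nhds_unique h1 h2]
  have hpre : IsPreconnected ({0}ᶜ : Set (Eu n)) := by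
    refine (isConnected_compl_singleton_of_one_lt_rank ?_ 0).isPreconnected
    rw [← Module.finrank_eq_rank, finrank_euclideanSpace_fin]
    exact_mod_cast hn
  have hconst : ∀ x y : Eu n, x ≠ 0 → y ≠ 0 → c x = c y := by
    have := isPreconnected_iff_preconnectedSpace.1 hpre
    have hl : IsLocallyConstant (fun x : ({0}ᶜ : Set (Eu n)) => c x) := by
      rw [IsLocallyConstant.iff_eventually_eq]
      intro x
      have hx : (x : Eu n) ≠ 0 := x.2
      have hpos : 0 < ‖(x : Eu n)‖ / 6 := by positivity
      filter_upwards [Metric.closedBall_mem_nhds x hpos] with y hy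
      refine hloc x y hx y.2 ?_
      rw [dist_comm]; exact hy
    intro x y hx hy
    exact hl.apply_eq_of_preconnectedSpace ⟨x, hx⟩ ⟨y, hy⟩
  let e : Eu n := EuclideanSpace.single ⟨0, by lia⟩ 1
  have he : e ≠ 0 := by
    rw [← norm_ne_zero_iff]; simp [e]
  refine ⟨c e, K / (1 - 36 / 49), div_nonneg hK (by norm_num), fun x hx => ?_⟩
  have hx0 : x ≠ 0 := by
    rw [← norm_pos_iff]; linarith
  obtain ⟨c', hc', hb⟩ := hlim8 x hx
  rw [hconst e x he hx0, tendsto_nhds_unique (hc x hx0) hc']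
  exact hb

theorem NSOn.sub_const {S : Set (Eu n)} {U : Fin n → Eu n → ℝ} {P : Eu n → ℝ}
    (h : NSOn S U P) (c : ℝ) : NSOn S U (fun x => P x - c) where
  isOpen := h.isOpen
  smU := h.smU
  smP := h.smP.sub contDiff_const
  ns x hx j := by rw [h.ns x hx j, pd_sub h.smP (sm_const c), pd_const, sub_zero]
  div := h.div

end

section

variable {n : ℕ}

/-- The radial weight `‖x‖ ^ (-2 k) θ(log ‖x‖²)`. -/
noncomputable def rad (k : ℝ) (θ : ℝ → ℝ) (x : Eu n) : ℝ :=
  Real.exp (-k * Real.log (‖x‖ ^ 2)) * θ (Real.log (‖x‖ ^ 2))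

/-- The annulus `a ≤ log ‖x‖² ≤ b`. -/
def Ann (n : ℕ) (a b : ℝ) : Set (Eu n) := {x | Real.exp a ≤ ‖x‖ ^ 2 ∧ ‖x‖ ^ 2 ≤ Real.exp b}

theorem isCompact_ann (a b : ℝ) : IsCompact (Ann n a b) := by
  refine (isCompact_closedBall (0 : Eu n) √(Real.exp b)).of_isClosed_subset ?_ ?_
  · have hc : Continuous fun x : Eu n => ‖x‖ ^ 2 := by fun_prop
    exact (isClosed_le continuous_const hc).inter (isClosed_le hc continuous_const)
  · intro x hx
    rw [mem_closedBall_zero_iff]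
    exact Real.le_sqrt_of_sq_le hx.2

/-- Continuous radial profiles supported in `[a, b]`, where `5 ≤ a`. -/
structure CCut (a b : ℝ) (θ : ℝ → ℝ) : Prop where
  five : 5 ≤ a
  cont : Continuous θ
  zero : ∀ t, t ∉ Icc a b → θ t = 0

/-- Smooth radial profiles supported in `[a, b]`, where `5 ≤ a`. -/
structure Cut (a b : ℝ) (θ : ℝ → ℝ) : Prop where
  five : 5 ≤ a
  smooth : ContDiff ℝ ∞ θ
  zero : ∀ t, t ∉ Icc a b → θ t = 0

theorem Cut.ccut {a b : ℝ} {θ : ℝ → ℝ} (h : Cut a b θ) : CCut a b θ :=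
  ⟨h.five, h.smooth.continuous, h.zero⟩

theorem CCut.mono {a b a' b' : ℝ} {θ : ℝ → ℝ} (h : CCut a b θ) (h5 : 5 ≤ a') (ha : a' ≤ a)
    (hb : b ≤ b') : CCut a' b' θ :=
  ⟨h5, h.cont, fun t ht => h.zero t fun h' => ht ⟨ha.trans h'.1, h'.2.trans hb⟩⟩

theorem Cut.deriv_cut {a b : ℝ} {θ : ℝ → ℝ} (h : Cut a b θ) : Cut a b (deriv θ) where
  five := h.five
  smooth := ((contDiff_infty_iff_deriv (f := θ)).1 h.smooth).2
  zero t ht := by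
    have : θ =ᶠ[𝓝 t] fun _ => 0 := by
      filter_upwards [isClosed_Icc.isOpen_compl.mem_nhds ht] with s hs using h.zero s hs
    rw [this.deriv_eq]; simp

theorem Cut.add {a b : ℝ} {θ η : ℝ → ℝ} (h : Cut a b θ) (h' : Cut a b η) :
    Cut a b (fun t => θ t + η t) :=
  ⟨h.five, h.smooth.add h'.smooth, fun t ht => by simp [h.zero t ht, h'.zero t ht]⟩

theorem Cut.const_mul {a b : ℝ} {θ : ℝ → ℝ} (h : Cut a b θ) (c : ℝ) :
    Cut a b (fun t => c * θ t) :=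
  ⟨h.five, contDiff_const.mul h.smooth, fun t ht => by simp [h.zero t ht]⟩

theorem CCut.add {a b : ℝ} {θ η : ℝ → ℝ} (h : CCut a b θ) (h' : CCut a b η) :
    CCut a b (fun t => θ t + η t) :=
  ⟨h.five, h.cont.add h'.cont, fun t ht => by simp [h.zero t ht, h'.zero t ht]⟩

theorem CCut.abs {a b : ℝ} {θ : ℝ → ℝ} (h : CCut a b θ) : CCut a b (fun t => |θ t|) :=
  ⟨h.five, h.cont.abs, fun t ht => by simp [h.zero t ht]⟩

/-- The profile of the radial derivative of `rad k θ`. -/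
noncomputable def dprof (k : ℝ) (θ : ℝ → ℝ) (t : ℝ) : ℝ := deriv θ t + -k * θ t

theorem Cut.dprof_cut {a b : ℝ} {θ : ℝ → ℝ} (h : Cut a b θ) (k : ℝ) : Cut a b (dprof k θ) :=
  h.deriv_cut.add (h.const_mul (-k))

theorem CCut.rad_zero {a b : ℝ} {θ : ℝ → ℝ} (h : CCut a b θ) (k : ℝ) {x : Eu n}
    (hx : x ∉ Ann n a b) : rad k θ x = 0 := by
  unfold rad
  rw [h.zero, mul_zero]
  rintro ⟨h1, h2⟩
  have hpos : 0 < ‖x‖ ^ 2 := by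
    refine (sq_nonneg ‖x‖).lt_of_ne fun h0 => ?_
    rw [← h0, Real.log_zero] at h1
    linarith [h.five]
  exact hx ⟨(Real.le_log_iff_exp_le hpos).1 h1, (Real.log_le_iff_le_exp hpos).1 h2⟩

theorem CCut.rad_eventually_zero {a b : ℝ} {θ : ℝ → ℝ} (h : CCut a b θ) (k : ℝ) :
    (rad k θ : Eu n → ℝ) =ᶠ[𝓝 0] fun _ => 0 := by
  have : {x : Eu n | ‖x‖ ^ 2 < Real.exp a} ∈ 𝓝 (0 : Eu n) := by
    refine (isOpen_lt (by fun_prop) continuous_const).mem_nhds ?_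
    simpa using Real.exp_pos a
  filter_upwards [this] with x hx
  refine h.rad_zero k fun h' => ?_
  exact absurd h'.1 (not_le.2 hx)

theorem CCut.continuous_rad {a b : ℝ} {θ : ℝ → ℝ} (h : CCut a b θ) (k : ℝ) :
    Continuous (rad k θ : Eu n → ℝ) := by
  rw [continuous_iff_continuousAt]
  intro x
  by_cases hx : x = 0
  · subst hx
    exact continuousAt_const.congr (h.rad_eventually_zero k).symm
  · have hx' : ‖x‖ ^ 2 ≠ 0 := by simpa using hx
    have hl : ContinuousAt (fun x : Eu n => Real.log (‖x‖ ^ 2)) x :=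
      ContinuousAt.log (by fun_prop) hx'
    exact (Real.continuous_exp.continuousAt.comp (continuousAt_const.mul hl)).mul
      (h.cont.continuousAt.comp hl)

theorem CCut.int {a b : ℝ} {θ : ℝ → ℝ} (h : CCut a b θ) (k : ℝ) {f : Eu n → ℝ}
    (hf : Continuous f) : Integrable (fun x => f x * rad k θ x) :=
  (hf.mul (h.continuous_rad k)).integrable_of_hasCompactSupport
    (HasCompactSupport.intro (isCompact_ann a b) fun x hx => by simp [h.rad_zero k hx])

theorem Cut.test {a b : ℝ} {θ : ℝ → ℝ} (h : Cut a b θ) (k : ℝ) :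
    Test (Ann n a b) (rad k θ) := by
  refine test_of_zero (isCompact_ann a b) ?_ fun x hx => h.ccut.rad_zero k hx
  refine contDiff_iff_contDiffAt.2 ?_
  intro x
  by_cases hx : x = 0
  · subst hx
    exact contDiffAt_const.congr_of_eventuallyEq (h.ccut.rad_eventually_zero k)
  · have hx' : ‖x‖ ^ 2 ≠ 0 := by simpa using hx
    have hl : ContDiffAt ℝ ∞ (fun x : Eu n => Real.log (‖x‖ ^ 2)) x :=
      ContDiffAt.log sm_normSq.contDiffAt hx'
    exact (Real.contDiff_exp.contDiffAt.comp x (contDiffAt_const.mul hl)).mul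
      (h.smooth.contDiffAt.comp x hl)

theorem exp_mul_log_succ (k : ℝ) {r : ℝ} (hr : 0 < r) :
    Real.exp (-(k + 1) * Real.log r) = Real.exp (-k * Real.log r) * r⁻¹ := by
  rw [show -(k + 1) * Real.log r = -k * Real.log r + -Real.log r by ring, Real.exp_add,
    Real.exp_neg (Real.log r), Real.exp_log hr]

theorem CCut.normSq_mul_rad {a b : ℝ} {θ : ℝ → ℝ} (h : CCut a b θ) (k : ℝ) (x : Eu n) :
    ‖x‖ ^ 2 * rad (k + 1) θ x = rad k θ x := by
  by_cases hx : x = 0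
  · subst hx
    rw [show rad k θ (0 : Eu n) = 0 from (h.rad_eventually_zero k).eq_of_nhds]
    simp
  · have hx' : 0 < ‖x‖ ^ 2 := by positivity
    unfold rad
    rw [exp_mul_log_succ k hx']
    field_simp

theorem Cut.pd_rad {a b : ℝ} {θ : ℝ → ℝ} (h : Cut a b θ) (k : ℝ) (i : Fin n) (x : Eu n) :
    pd i (rad k θ) x = 2 * x i * rad (k + 1) (dprof k θ) x := by
  by_cases hx : x = 0
  · subst hx
    rw [pd_congr (h.ccut.rad_eventually_zero k), pd_const]
    simp
  · have hx' : 0 < ‖x‖ ^ 2 := by positivity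
    have hθ : HasDerivAt θ (deriv θ (Real.log (‖x‖ ^ 2))) (Real.log (‖x‖ ^ 2)) :=
      (h.smooth.differentiable (by simp) _).hasDerivAt
    have hl := Real.hasDerivAt_log hx'.ne'
    have := pd_comp_normSq (x := x)
      (F := fun r => Real.exp (-k * Real.log r) * θ (Real.log r))
      ((hl.const_mul (-k)).exp.mul (hθ.comp _ hl)) i
    unfold rad
    rw [this, exp_mul_log_succ k hx']
    unfold dprof
    ring

theorem Cut.transp_rad {a b : ℝ} {θ : ℝ → ℝ} (h : Cut a b θ) (k : ℝ) (U : Fin n → Eu n → ℝ)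
    (x : Eu n) : transp U (rad k θ) x = 2 * radial U x * rad (k + 1) (dprof k θ) x := by
  unfold transp radial
  simp only [h.pd_rad, Finset.mul_sum, Finset.sum_mul]
  exact Finset.sum_congr rfl fun i _ => by ring

theorem Cut.euler_rad {a b : ℝ} {θ : ℝ → ℝ} (h : Cut a b θ) (k : ℝ) (x : Eu n) :
    euler (rad k θ) x = 2 * rad k (dprof k θ) x := by
  rw [← (h.dprof_cut k).ccut.normSq_mul_rad k x]
  unfold euler
  simp only [h.pd_rad]
  rw [EuclideanSpace.real_norm_sq_eq, Finset.sum_mul, Finset.mul_sum]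
  exact Finset.sum_congr rfl fun i _ => by ring

theorem Cut.pd_pd_rad {a b : ℝ} {θ : ℝ → ℝ} (h : Cut a b θ) (k : ℝ) (i j : Fin n) (x : Eu n) :
    pd i (pd j (rad k θ)) x = (if i = j then 2 * rad (k + 1) (dprof k θ) x else 0)
      + 4 * x i * x j * rad (k + 2) (dprof (k + 1) (dprof k θ)) x := by
  have e : pd j (rad k θ : Eu n → ℝ) = fun x => (2 * x j) * rad (k + 1) (dprof k θ) x :=
    funext fun x => h.pd_rad k j x
  have e2 := pd_mul (f := fun x : Eu n => 2 * x j) (contDiff_const.mul (sm_coord j))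
    ((h.dprof_cut k).test (k + 1)).smooth i x
  rw [e, e2, pd_const_mul (sm_coord j), pd_coord, (h.dprof_cut k).pd_rad,
    show k + 1 + 1 = k + 2 by ring]
  split_ifs <;> ring

theorem Cut.lap_rad {a b : ℝ} {θ : ℝ → ℝ} (h : Cut a b θ) (k : ℝ) (x : Eu n) :
    lap (rad k θ) x = rad (k + 1) (fun t => 2 * n * dprof k θ t
      + 4 * dprof (k + 1) (dprof k θ) t) x := by
  unfold lap
  simp only [h.pd_pd_rad, if_true, Finset.sum_add_distrib]
  have e : ∑ i, 4 * x i * x i * rad (k + 2) (dprof (k + 1) (dprof k θ)) x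
      = 4 * rad (k + 1) (dprof (k + 1) (dprof k θ)) x := by
    rw [← ((h.dprof_cut k).dprof_cut (k + 1)).ccut.normSq_mul_rad (k + 1) x,
      EuclideanSpace.real_norm_sq_eq, Finset.sum_mul, Finset.mul_sum,
      show k + 1 + 1 = k + 2 by ring]
    exact Finset.sum_congr rfl fun i _ => by ring
  rw [e]
  simp [rad]
  ring

theorem rad_integral_mono {a b a' b' k : ℝ} {θ η : ℝ → ℝ} (h : CCut a b θ) (h' : CCut a' b' η)
    {f g : Eu n → ℝ} (hf : Continuous f) (hg : Continuous g)
    (hle : ∀ x : Eu n, 5 ≤ Real.log (‖x‖ ^ 2) →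
      f x * θ (Real.log (‖x‖ ^ 2)) ≤ g x * η (Real.log (‖x‖ ^ 2))) :
    ∫ x, f x * rad k θ x ≤ ∫ x, g x * rad k η x := by
  refine integral_mono (h.int k hf) (h'.int k hg) fun x => ?_
  by_cases hx : 5 ≤ Real.log (‖x‖ ^ 2)
  · have := mul_le_mul_of_nonneg_left (hle x hx) (Real.exp_pos (-k * Real.log (‖x‖ ^ 2))).le
    unfold rad
    linarith
  · have e1 : θ (Real.log (‖x‖ ^ 2)) = 0 := h.zero _ fun h1 => hx (h.five.trans h1.1)
    have e2 : η (Real.log (‖x‖ ^ 2)) = 0 := h'.zero _ fun h1 => hx (h'.five.trans h1.1)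
    simp only [rad, e1, e2, mul_zero, le_refl]

theorem eight_le_norm {x : Eu n} (hx : 5 ≤ Real.log (‖x‖ ^ 2)) : 8 ≤ ‖x‖ := by
  have hpos : 0 < ‖x‖ ^ 2 := by
    refine (sq_nonneg ‖x‖).lt_of_ne fun h0 => ?_
    rw [← h0, Real.log_zero] at hx
    linarith
  have h1 := (Real.le_log_iff_exp_le hpos).1 hx
  have h2 : (64 : ℝ) ≤ Real.exp 5 := by
    have h3 := Real.exp_one_gt_d9
    have h4 : Real.exp 5 = Real.exp 1 ^ 5 := by rw [← Real.exp_nat_mul]; norm_num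
    rw [h4]
    calc (64 : ℝ) ≤ 2.7 ^ 5 := by norm_num
      _ ≤ _ := pow_le_pow_left₀ (by norm_num) (by linarith) 5
  nlinarith [norm_nonneg x]

theorem ann_subset {a b : ℝ} (ha : 5 ≤ a) : Ann n a b ⊆ {x | 2 < ‖x‖} := by
  intro x hx
  have hpos : 0 < ‖x‖ ^ 2 := (Real.exp_pos a).trans_le hx.1
  have := eight_le_norm (x := x) (ha.trans ((Real.le_log_iff_exp_le hpos).2 hx.1))
  simp only [mem_ofPred_eq]; linarith

/-- The weighted volume of the region between two spheres is at most logarithmic. -/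
theorem exists_rad_volume (hn : 1 ≤ n) : ∃ V, 0 ≤ V ∧ ∀ (a b : ℝ) (η : ℝ → ℝ), a ≤ b →
    CCut a b η → (∀ t, 0 ≤ η t) → (∀ t, η t ≤ 1) →
      ∫ x : Eu n, rad (n / 2) η x ≤ V * (b - a) := by
  have : Nontrivial (Eu n) := by
    have : Nonempty (Fin n) := ⟨⟨0, hn⟩⟩
    infer_instance
  refine ⟨n * (volume : Measure (Eu n)).real (Metric.ball 0 1), by positivity, ?_⟩
  intro a b η hab h h0 h1
  have e := integral_fun_norm_addHaar (volume : Measure (Eu n))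
    (fun r => Real.exp (-(n / 2) * Real.log (r ^ 2)) * η (Real.log (r ^ 2)))
  have e' : ∫ x : Eu n, rad (n / 2) η x = _ := e
  rw [e', finrank_euclideanSpace_fin, nsmul_eq_mul, smul_eq_mul, mul_assoc]
  refine mul_le_mul_of_nonneg_left ?_ (by positivity)
  refine mul_le_mul_of_nonneg_left ?_ (by positivity)
  set α := Real.exp (a / 2)
  set β := Real.exp (b / 2)
  have hα : 0 < α := Real.exp_pos _
  have hαβ : α ≤ β := Real.exp_le_exp.2 (by linarith)
  have hI : IntegrableOn (fun y : ℝ => 1 / y) (Icc α β) :=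
    ContinuousOn.integrableOn_Icc
      (continuousOn_const.div continuousOn_id fun y hy => (hα.trans_le hy.1).ne')
  have hg : ∫ y in Ioi (0 : ℝ), (Icc α β).indicator (fun y => 1 / y) y = (b - a) / 2 := by
    rw [setIntegral_indicator measurableSet_Icc,
      inter_eq_self_of_subset_right (s := Ioi 0) (t := Icc α β) fun y hy => hα.trans_le hy.1,
      integral_Icc_eq_integral_Ioc, ← intervalIntegral.integral_of_le hαβ,
      integral_one_div_of_pos hα (hα.trans_le hαβ), Real.log_div (hα.trans_le hαβ).ne' hα.ne',
      Real.log_exp, Real.log_exp]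
    ring
  refine (integral_mono_of_nonneg (g := (Icc α β).indicator fun y => 1 / y) ?_ ?_ ?_).trans
    (by rw [hg]; linarith)
  · exact (ae_restrict_iff' measurableSet_Ioi).2 (Eventually.of_forall fun y hy =>
      smul_nonneg (pow_nonneg (le_of_lt hy) _) (mul_nonneg (Real.exp_pos _).le (h0 _)))
  · exact (hI.integrable_indicator measurableSet_Icc).integrableOn
  · refine (ae_restrict_iff' measurableSet_Ioi).2 (Eventually.of_forall fun y hy => ?_)
    have hy : 0 < y := hy
    have hl : Real.log (y ^ 2) = 2 * Real.log y := by rw [Real.log_pow]; norm_num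
    simp only [hl, smul_eq_mul]
    by_cases hm : 2 * Real.log y ∈ Icc a b
    · have hy' : y ∈ Icc α β :=
        ⟨(Real.le_log_iff_exp_le hy).1 (by linarith [hm.1]),
          (Real.log_le_iff_le_exp hy).1 (by linarith [hm.2])⟩
      rw [indicator_of_mem hy']
      have e1 : Real.exp (-(n / 2) * (2 * Real.log y)) = (y ^ n)⁻¹ := by
        rw [show -((n : ℝ) / 2) * (2 * Real.log y) = -(n * Real.log y) by ring, Real.exp_neg,
          Real.exp_nat_mul, Real.exp_log hy]
      have e2 : y ^ n = y ^ (n - 1) * y := by rw [← pow_succ, Nat.sub_add_cancel hn]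
      rw [e1, e2, one_div, mul_inv, ← mul_assoc, ← mul_assoc,
        mul_inv_cancel₀ (pow_pos hy _).ne', one_mul]
      exact mul_le_of_le_one_right (by positivity) (h1 _)
    · rw [h.zero _ hm, mul_zero, mul_zero]
      exact indicator_nonneg (fun z hz => one_div_nonneg.2 (hα.trans_le hz.1).le) y

end

section

variable {n : ℕ}

/-- The sum of the absolute values of the first two derivatives. -/
noncomputable def edge (θ : ℝ → ℝ) (t : ℝ) : ℝ := |deriv θ t| + |deriv (deriv θ) t|

theorem edge_nonneg (θ : ℝ → ℝ) (t : ℝ) : 0 ≤ edge θ t := by unfold edge; positivity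

theorem Cut.edge_ccut {a b : ℝ} {θ : ℝ → ℝ} (h : Cut a b θ) : CCut a b (edge θ) :=
  h.deriv_cut.ccut.abs.add h.deriv_cut.deriv_cut.ccut.abs

/-- A smooth cutoff which equals one on `[a + N, b - N]` and vanishes off `[a, b]`. -/
noncomputable def plateau (a b N t : ℝ) : ℝ :=
  Real.smoothTransition ((t - a) / N) * Real.smoothTransition ((b - t) / N)

theorem smoothTransition_mono {s t : ℝ} (h : s ≤ t) :
    Real.smoothTransition s ≤ Real.smoothTransition t := by
  unfold Real.smoothTransition
  have h1 : expNegInvGlue s ≤ expNegInvGlue t := expNegInvGlue.monotone h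
  have h2 : expNegInvGlue (1 - t) ≤ expNegInvGlue (1 - s) :=
    expNegInvGlue.monotone (by linarith)
  rw [div_le_div_iff₀ (Real.smoothTransition.pos_denom s) (Real.smoothTransition.pos_denom t)]
  nlinarith [mul_le_mul h1 h2 (expNegInvGlue.nonneg _) (expNegInvGlue.nonneg _)]

theorem plateau_nonneg (a b N t : ℝ) : 0 ≤ plateau a b N t :=
  mul_nonneg (Real.smoothTransition.nonneg _) (Real.smoothTransition.nonneg _)

theorem plateau_le_one (a b N t : ℝ) : plateau a b N t ≤ 1 :=
  mul_le_one₀ (Real.smoothTransition.le_one _) (Real.smoothTransition.nonneg _)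
    (Real.smoothTransition.le_one _)

theorem plateau_eq_one {a b N t : ℝ} (hN : 0 < N) (ha : a + N ≤ t) (hb : t ≤ b - N) :
    plateau a b N t = 1 := by
  unfold plateau
  rw [Real.smoothTransition.one_of_one_le ((one_le_div hN).2 (by linarith)),
    Real.smoothTransition.one_of_one_le ((one_le_div hN).2 (by linarith)), one_mul]

theorem plateau_cut {a b N : ℝ} (h5 : 5 ≤ a) (hN : 0 < N) : Cut a b (plateau a b N) where
  five := h5
  smooth := by
    unfold plateau
    exact (Real.smoothTransition.contDiff.comp ((contDiff_id.sub contDiff_const).div_const N)).mul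
      (Real.smoothTransition.contDiff.comp ((contDiff_const.sub contDiff_id).div_const N))
  zero t ht := by
    unfold plateau
    by_cases h1 : a ≤ t
    · have h2 : b < t := not_le.1 fun h2 => ht ⟨h1, h2⟩
      rw [Real.smoothTransition.zero_of_nonpos
        (x := (b - t) / N) (div_nonpos_of_nonpos_of_nonneg (by linarith) hN.le), mul_zero]
    · rw [Real.smoothTransition.zero_of_nonpos
        (x := (t - a) / N) (div_nonpos_of_nonpos_of_nonneg (by linarith) hN.le), zero_mul]

theorem plateau_mono {a b b' N : ℝ} (hN : 0 < N) (hb : b ≤ b') (t : ℝ) :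
    plateau a b N t ≤ plateau a b' N t :=
  mul_le_mul_of_nonneg_left (smoothTransition_mono (by gcongr))
    (Real.smoothTransition.nonneg _)

theorem deriv_smoothTransition_eventually_zero {t : ℝ} (ht : t ∉ Icc (0 : ℝ) 1) :
    deriv Real.smoothTransition =ᶠ[𝓝 t] fun _ => 0 := by
  by_cases h0 : 0 ≤ t
  · have h3 : 1 < t := not_le.1 fun h3 => ht ⟨h0, h3⟩
    filter_upwards [Ioi_mem_nhds h3] with s hs
    have : Real.smoothTransition =ᶠ[𝓝 s] fun _ => 1 := by
      filter_upwards [Ioi_mem_nhds hs] with r hr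
        using Real.smoothTransition.one_of_one_le (le_of_lt hr)
    rw [this.deriv_eq]; simp
  · filter_upwards [Iio_mem_nhds (not_le.1 h0)] with s hs
    have : Real.smoothTransition =ᶠ[𝓝 s] fun _ => 0 := by
      filter_upwards [Iio_mem_nhds hs] with r hr
        using Real.smoothTransition.zero_of_nonpos (le_of_lt hr)
    rw [this.deriv_eq]; simp

theorem exists_smoothTransition_bound : ∃ K : ℝ, 0 ≤ K ∧
    ∀ t, |deriv Real.smoothTransition t| ≤ K ∧ |deriv (deriv Real.smoothTransition) t| ≤ K := by
  have h1 : Continuous (deriv Real.smoothTransition) :=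
    (Real.smoothTransition.contDiff (n := 1)).continuous_deriv le_rfl
  have h2 : Continuous (deriv (deriv Real.smoothTransition)) := by
    have h : ContDiff ℝ 1 (deriv Real.smoothTransition) :=
      ((contDiff_succ_iff_deriv (n := 1)).1
        (Real.smoothTransition.contDiff (n := 1 + 1))).2.2
    exact h.continuous_deriv le_rfl
  obtain ⟨K1, hK1⟩ := isCompact_Icc.exists_bound_of_continuousOn (s := Icc (0 : ℝ) 1)
    h1.continuousOn
  obtain ⟨K2, hK2⟩ := isCompact_Icc.exists_bound_of_continuousOn (s := Icc (0 : ℝ) 1)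
    h2.continuousOn
  refine ⟨max 0 (max K1 K2), le_max_left _ _, fun t => ?_⟩
  by_cases ht : t ∈ Icc (0 : ℝ) 1
  · exact ⟨(hK1 t ht).trans ((le_max_left _ _).trans (le_max_right _ _)),
      (hK2 t ht).trans ((le_max_right _ _).trans (le_max_right _ _))⟩
  · rw [(deriv_smoothTransition_eventually_zero ht).deriv_eq,
      (deriv_smoothTransition_eventually_zero ht).eq_of_nhds]
    simp

theorem deriv_plateau (a b N : ℝ) : deriv (plateau a b N) = fun t =>
    deriv Real.smoothTransition ((t - a) / N) / N * Real.smoothTransition ((b - t) / N)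
      - Real.smoothTransition ((t - a) / N) * (deriv Real.smoothTransition ((b - t) / N) / N) := by
  have hS : ∀ t, HasDerivAt Real.smoothTransition (deriv Real.smoothTransition t) t := fun t =>
    ((Real.smoothTransition.contDiff (n := 1)).differentiable (by simp) t).hasDerivAt
  funext t
  have h1 : HasDerivAt (fun t : ℝ => (t - a) / N) (1 / N) t :=
    ((hasDerivAt_id t).sub_const a).div_const N
  have h2 : HasDerivAt (fun t : ℝ => (b - t) / N) (-1 / N) t :=
    ((hasDerivAt_id t).const_sub b).div_const N
  have := ((hS _).comp t h1).mul ((hS _).comp t h2)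
  refine (HasDerivAt.deriv (this : HasDerivAt (plateau a b N) _ t)).trans ?_
  simp only [Function.comp]
  ring

theorem deriv_deriv_plateau (a b N : ℝ) : deriv (deriv (plateau a b N)) = fun t =>
    deriv (deriv Real.smoothTransition) ((t - a) / N) / N ^ 2
        * Real.smoothTransition ((b - t) / N)
      - 2 * (deriv Real.smoothTransition ((t - a) / N)
        * deriv Real.smoothTransition ((b - t) / N) / N ^ 2)
      + Real.smoothTransition ((t - a) / N)
        * (deriv (deriv Real.smoothTransition) ((b - t) / N) / N ^ 2) := by
  have hS : ∀ t, HasDerivAt Real.smoothTransition (deriv Real.smoothTransition t) t := fun t =>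
    ((Real.smoothTransition.contDiff (n := 1)).differentiable (by simp) t).hasDerivAt
  have hS' : ∀ t, HasDerivAt (deriv Real.smoothTransition)
      (deriv (deriv Real.smoothTransition) t) t := fun t => by
    have h : ContDiff ℝ 1 (deriv Real.smoothTransition) :=
      ((contDiff_succ_iff_deriv (n := 1)).1
        (Real.smoothTransition.contDiff (n := 1 + 1))).2.2
    exact (h.differentiable (by simp) t).hasDerivAt
  rw [deriv_plateau]
  funext t
  have h1 : HasDerivAt (fun t : ℝ => (t - a) / N) (1 / N) t :=
    ((hasDerivAt_id t).sub_const a).div_const N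
  have h2 : HasDerivAt (fun t : ℝ => (b - t) / N) (-1 / N) t :=
    ((hasDerivAt_id t).const_sub b).div_const N
  have := ((((hS' _).comp t h1).div_const N).mul ((hS _).comp t h2)).sub
    (((hS _).comp t h1).mul (((hS' _).comp t h2).div_const N))
  refine (HasDerivAt.deriv (this : HasDerivAt (fun t => deriv Real.smoothTransition
    ((t - a) / N) / N * Real.smoothTransition ((b - t) / N)
      - Real.smoothTransition ((t - a) / N) * (deriv Real.smoothTransition ((b - t) / N) / N))
    _ t)).trans ?_
  simp only [Function.comp]
  ring

/-- The derivatives of a plateau live near its two ends. -/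
theorem exists_edge_plateau_le : ∃ K : ℝ, 0 ≤ K ∧ ∀ a b N t, 1 ≤ N →
    edge (plateau a b N) t ≤
      K / N * (plateau (a - N) (a + 2 * N) N t + plateau (b - 2 * N) (b + N) N t) := by
  obtain ⟨K, hK0, hK⟩ := exists_smoothTransition_bound
  refine ⟨4 * K + 2 * K ^ 2, by positivity, fun a b N t hN => ?_⟩
  have hN0 : 0 < N := by linarith
  have p1 := plateau_nonneg (a - N) (a + 2 * N) N t
  have p2 := plateau_nonneg (b - 2 * N) (b + N) N t
  have hpos : 0 ≤ (4 * K + 2 * K ^ 2) / N := by positivity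
  have hbd : edge (plateau a b N) t ≤ (4 * K + 2 * K ^ 2) / N := by
    unfold edge
    rw [deriv_deriv_plateau, deriv_plateau]
    set s1 := Real.smoothTransition ((t - a) / N)
    set s2 := Real.smoothTransition ((b - t) / N)
    have hs1 : |s1| ≤ 1 := abs_le.2 ⟨by linarith [Real.smoothTransition.nonneg ((t - a) / N)],
      Real.smoothTransition.le_one _⟩
    have hs2 : |s2| ≤ 1 := abs_le.2 ⟨by linarith [Real.smoothTransition.nonneg ((b - t) / N)],
      Real.smoothTransition.le_one _⟩
    obtain ⟨k1, l1⟩ := hK ((t - a) / N)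
    obtain ⟨k2, l2⟩ := hK ((b - t) / N)
    set d1 := deriv Real.smoothTransition ((t - a) / N)
    set d2 := deriv Real.smoothTransition ((b - t) / N)
    set e1 := deriv (deriv Real.smoothTransition) ((t - a) / N)
    set e2 := deriv (deriv Real.smoothTransition) ((b - t) / N)
    have hm : ∀ x y X Y : ℝ, |x| ≤ X → |y| ≤ Y → |x * y| ≤ X * Y := fun x y X Y hx hy => by
      rw [abs_mul]; exact mul_le_mul hx hy (abs_nonneg _) ((abs_nonneg _).trans hx)
    have q1 : |d1 / N * s2 - s1 * (d2 / N)| ≤ 2 * K / N := by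
      rw [show d1 / N * s2 - s1 * (d2 / N) = (d1 * s2 - s1 * d2) / N by ring, abs_div,
        abs_of_pos hN0]
      gcongr
      exact (abs_sub _ _).trans (by linarith [hm _ _ _ _ k1 hs2, hm _ _ _ _ hs1 k2])
    have q2 : |e1 / N ^ 2 * s2 - 2 * (d1 * d2 / N ^ 2) + s1 * (e2 / N ^ 2)|
        ≤ (2 * K + 2 * K ^ 2) / N := by
      rw [show e1 / N ^ 2 * s2 - 2 * (d1 * d2 / N ^ 2) + s1 * (e2 / N ^ 2)
        = (e1 * s2 - 2 * (d1 * d2) + s1 * e2) / N ^ 2 by ring, abs_div,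
        abs_of_pos (pow_pos hN0 2)]
      calc _ ≤ (2 * K + 2 * K ^ 2) / N ^ 2 := by
            refine div_le_div_of_nonneg_right ?_ (sq_nonneg N)
            have h1 := hm _ _ _ _ l1 hs2
            have h2 := hm _ _ _ _ hs1 l2
            have h3 := hm _ _ _ _ k1 k2
            rw [abs_le] at h1 h2 h3 ⊢
            constructor <;> nlinarith
        _ ≤ _ := div_le_div_of_nonneg_left (by positivity) hN0 (by nlinarith)
    calc _ ≤ 2 * K / N + (2 * K + 2 * K ^ 2) / N := add_le_add q1 q2
      _ = _ := by ring
  by_cases h1 : (t - a) / N ∈ Icc (0 : ℝ) 1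
  · have e1 : plateau (a - N) (a + 2 * N) N t = 1 := by
      have := h1.2
      rw [div_le_one hN0] at this
      have h0 := mul_nonneg h1.1 hN0.le
      rw [div_mul_cancel₀ _ hN0.ne'] at h0
      exact plateau_eq_one hN0 (by linarith) (by linarith)
    rw [e1]
    exact hbd.trans (le_mul_of_one_le_right hpos (by linarith))
  by_cases h2 : (b - t) / N ∈ Icc (0 : ℝ) 1
  · have e1 : plateau (b - 2 * N) (b + N) N t = 1 := by
      have := h2.2
      rw [div_le_one hN0] at this
      have h0 := mul_nonneg h2.1 hN0.le
      rw [div_mul_cancel₀ _ hN0.ne'] at h0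
      exact plateau_eq_one hN0 (by linarith) (by linarith)
    rw [e1]
    exact hbd.trans (le_mul_of_one_le_right hpos (by linarith))
  have z1 := deriv_smoothTransition_eventually_zero h1
  have z2 := deriv_smoothTransition_eventually_zero h2
  have : edge (plateau a b N) t = 0 := by
    unfold edge
    rw [deriv_deriv_plateau, deriv_plateau]
    simp [z1.eq_of_nhds, z2.eq_of_nhds, z1.deriv_eq, z2.deriv_eq]
  rw [this]
  positivity

/-- Windows of an integrable tail are small. -/
theorem tail_window_small {m : Eu n → ℝ} (hm : Continuous m) (h0 : ∀ x, 0 ≤ m x) {a C : ℝ}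
    (ha : 5 ≤ a)
    (hC : ∀ b, a + 2 ≤ b → ∫ x, m x * rad (n / 2) (plateau a b 1) x ≤ C) (L : ℝ) :
    ∀ δ, 0 < δ → ∃ T, 5 + L + 1 ≤ T ∧ ∀ t, T ≤ t → ∀ η, CCut (t - L) (t + L) η →
      (∀ s, η s ≤ 1) → ∫ x, m x * rad (n / 2) η x ≤ δ := by
  intro δ hδ
  set I : ℝ → ℝ := fun b => ∫ x, m x * rad (n / 2) (plateau a b 1) x
  set A := I '' Ici (a + 2)
  have hbdd : BddAbove A := ⟨C, by rintro _ ⟨b, hb, rfl⟩; exact hC b hb⟩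
  have hne : A.Nonempty := ⟨_, a + 2, self_mem_Ici, rfl⟩
  obtain ⟨_, ⟨b, hb, rfl⟩, hlt⟩ := exists_lt_of_lt_csSup hne (sub_lt_self (sSup A) hδ)
  have hb : a + 2 ≤ b := hb
  refine ⟨b + |L| + 1, by linarith [le_abs_self L], fun t ht η hη h1 => ?_⟩
  have hL := le_abs_self L
  have hL' := neg_abs_le L
  have hc1 : Cut a b (plateau a b 1) := plateau_cut ha one_pos
  have hc2 : Cut a (t + |L| + 1) (plateau a (t + |L| + 1) 1) := plateau_cut ha one_pos
  have hI : I (t + |L| + 1) ≤ sSup A := le_csSup hbdd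
    ⟨_, by simp only [mem_Ici]; linarith [abs_nonneg L], rfl⟩
  have key : ∫ x, m x * rad (n / 2) (fun s => η s + plateau a b 1 s) x ≤ I (t + |L| + 1) := by
    have hη' : CCut a (t + |L| + 1) η := hη.mono ha (by linarith) (by linarith)
    refine rad_integral_mono (hη'.add (hc1.ccut.mono ha le_rfl
      (by linarith [abs_nonneg L]))) hc2.ccut hm hm
      fun x _ => mul_le_mul_of_nonneg_left ?_ (h0 x)
    set s := Real.log (‖x‖ ^ 2)
    by_cases hs : s ∈ Icc (t - L) (t + L)
    · rw [hc1.zero s fun h => by linarith [h.2, hs.1],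
        plateau_eq_one one_pos (by linarith [hs.1]) (by linarith [hs.2])]
      linarith [h1 s]
    · rw [hη.zero s hs, zero_add]
      exact plateau_mono one_pos (by linarith [abs_nonneg L]) s
  have e : ∫ x, m x * rad (n / 2) (fun s => η s + plateau a b 1 s) x
      = (∫ x, m x * rad (n / 2) η x) + I b := by
    rw [← integral_add (hη.int _ hm) (hc1.ccut.int _ hm)]
    refine integral_congr_ae (Eventually.of_forall fun x => ?_)
    simp only [rad]
    ring
  linarith

end

section

variable {n : ℕ}

/-- The scale-invariant square of the velocity. -/
noncomputable def velSq (U : Fin n → Eu n → ℝ) (x : Eu n) : ℝ := ‖x‖ ^ 2 * nsq U x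

/-- The scale-invariant head pressure. -/
noncomputable def scHead (U : Fin n → Eu n → ℝ) (P : Eu n → ℝ) (x : Eu n) : ℝ :=
  ‖x‖ ^ 2 * head U P x

/-- The density controlling cutoff errors. -/
noncomputable def errDens (U : Fin n → Eu n → ℝ) (P : Eu n → ℝ) (x : Eu n) : ℝ :=
  |scHead U P x| + √(velSq U x)

/-- Solutions in an exterior domain with scale-invariant bounds on velocity and pressure. -/
structure Scale (C : ℝ) (U : Fin n → Eu n → ℝ) (P : Eu n → ℝ) : Prop where
  sol : NSOn {x | 2 < ‖x‖} U P
  one : 1 ≤ C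
  vel : ∀ x, 8 ≤ ‖x‖ → velSq U x ≤ C
  pres : ∀ x, 8 ≤ ‖x‖ → |scHead U P x| ≤ C

variable {C : ℝ} {U : Fin n → Eu n → ℝ} {P : Eu n → ℝ}

theorem nsq_nonneg (U : Fin n → Eu n → ℝ) (x : Eu n) : 0 ≤ nsq U x :=
  Finset.sum_nonneg fun _ _ => sq_nonneg _

theorem velSq_nonneg (U : Fin n → Eu n → ℝ) (x : Eu n) : 0 ≤ velSq U x :=
  mul_nonneg (sq_nonneg _) (nsq_nonneg U x)

theorem radial_sq_le (U : Fin n → Eu n → ℝ) (x : Eu n) : radial U x ^ 2 ≤ velSq U x := by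
  unfold radial velSq nsq
  rw [EuclideanSpace.real_norm_sq_eq]
  exact Finset.sum_mul_sq_le_sq_mul_sq _ _ _

theorem Scale.continuous_velSq (h : Scale C U P) : Continuous (velSq U) :=
  (continuous_norm.pow 2).mul (sm_nsq h.sol.smU).continuous

theorem Scale.continuous_scHead (h : Scale C U P) : Continuous (scHead U P) :=
  (continuous_norm.pow 2).mul (sm_head h.sol.smU h.sol.smP).continuous

theorem Scale.continuous_radial (h : Scale C U P) : Continuous (radial U) :=
  (sm_radial h.sol.smU).continuous

theorem Scale.continuous_errDens (h : Scale C U P) : Continuous (errDens U P) :=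
  h.continuous_scHead.abs.add h.continuous_velSq.sqrt

theorem errDens_nonneg (U : Fin n → Eu n → ℝ) (P : Eu n → ℝ) (x : Eu n) : 0 ≤ errDens U P x := by
  unfold errDens; positivity

/-- Pointwise bounds by the error density. -/
theorem Scale.bounds (h : Scale C U P) {x : Eu n} (hx : 5 ≤ Real.log (‖x‖ ^ 2)) :
    |scHead U P x| ≤ errDens U P x ∧ |radial U x| ≤ errDens U P x ∧ |radial U x| ≤ C
      ∧ velSq U x ≤ C * errDens U P x := by
  have h8 := eight_le_norm hx
  have hA := h.vel x h8
  have hA0 := velSq_nonneg U x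
  have hg := Real.abs_le_sqrt (radial_sq_le U x)
  have hs := Real.sq_sqrt hA0
  have hs0 := Real.sqrt_nonneg (velSq U x)
  have h1 := h.one
  have hsC : √(velSq U x) ≤ C := Real.sqrt_le_iff.2 ⟨by linarith, by nlinarith⟩
  have hp := abs_nonneg (scHead U P x)
  unfold errDens
  refine ⟨by linarith, by linarith, by linarith, ?_⟩
  nlinarith

theorem mul_rad_half_sub_one {a b : ℝ} {θ : ℝ → ℝ} (h : CCut a b θ) (r : ℝ) (x : Eu n) :
    r * rad (n / 2 - 1) θ x = ‖x‖ ^ 2 * r * rad (n / 2) θ x := by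
  rw [← h.normSq_mul_rad (n / 2 - 1) x, sub_add_cancel]
  ring

theorem mul_rad_half_sub_two {a b : ℝ} {θ : ℝ → ℝ} (h : CCut a b θ) (r : ℝ) (x : Eu n) :
    r * rad (n / 2 - 2) θ x = ‖x‖ ^ 4 * r * rad (n / 2) θ x := by
  rw [← h.normSq_mul_rad (n / 2 - 2) x, show (n / 2 - 2 + 1 : ℝ) = n / 2 - 1 by ring,
    ← mul_assoc, mul_rad_half_sub_one h]
  ring

theorem Cut.dprof_dprof {a b : ℝ} {θ : ℝ → ℝ} (h : Cut a b θ) (k l t : ℝ) :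
    dprof l (dprof k θ) t = deriv (deriv θ) t - (k + l) * deriv θ t + k * l * θ t := by
  have d1 : DifferentiableAt ℝ θ t := h.smooth.differentiable (by simp) t
  have d2 : DifferentiableAt ℝ (deriv θ) t := h.deriv_cut.smooth.differentiable (by simp) t
  have e : HasDerivAt (dprof k θ) (deriv (deriv θ) t + -k * deriv θ t) t :=
    d2.hasDerivAt.add (d1.hasDerivAt.const_mul (-k))
  rw [dprof, e.deriv, dprof]
  ring

/-- Terms in which the cutoff is differentiated are errors. -/
theorem Scale.integral_err (h : Scale C U P) {a b k c : ℝ} {θ : ℝ → ℝ} (hθ : Cut a b θ)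
    {w f₀ f₁ f₂ : Eu n → ℝ} (hf₀ : Continuous f₀) (hf₁ : Continuous f₁) (hf₂ : Continuous f₂)
    (hc₁ : ∀ x : Eu n, 5 ≤ Real.log (‖x‖ ^ 2) → |f₁ x| ≤ c * errDens U P x)
    (hc₂ : ∀ x : Eu n, 5 ≤ Real.log (‖x‖ ^ 2) → |f₂ x| ≤ c * errDens U P x)
    (hw : ∀ x, w x = f₀ x * rad k θ x + (f₁ x * rad k (deriv θ) x
      + f₂ x * rad k (deriv (deriv θ)) x)) :
    |(∫ x, w x) - ∫ x, f₀ x * rad k θ x| ≤ c * ∫ x, errDens U P x * rad k (edge θ) x := by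
  have i0 := hθ.ccut.int k hf₀
  have i1 := hθ.deriv_cut.ccut.int k hf₁
  have i2 := hθ.deriv_cut.deriv_cut.ccut.int k hf₂
  have i12 : Integrable fun x => f₁ x * rad k (deriv θ) x + f₂ x * rad k (deriv (deriv θ)) x :=
    i1.add i2
  simp only [hw]
  rw [integral_add i0 i12, add_sub_cancel_left, ← integral_const_mul]
  refine (abs_integral_le_integral_abs).trans
    (integral_mono i12.abs ?_ fun x => ?_)
  · exact (hθ.edge_ccut.int k h.continuous_errDens).const_mul c
  · by_cases hx : 5 ≤ Real.log (‖x‖ ^ 2)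
    · unfold rad edge
      set E := Real.exp (-k * Real.log (‖x‖ ^ 2))
      have hE : 0 < E := Real.exp_pos _
      set s := Real.log (‖x‖ ^ 2)
      refine (abs_add_le _ _).trans ?_
      rw [abs_mul, abs_mul, abs_mul, abs_mul, abs_of_pos hE]
      have h1 := mul_le_mul_of_nonneg_right (hc₁ x hx)
        (mul_nonneg hE.le (abs_nonneg (deriv θ s)))
      have h2 := mul_le_mul_of_nonneg_right (hc₂ x hx)
        (mul_nonneg hE.le (abs_nonneg (deriv (deriv θ) s)))
      linarith
    · have hz : ∀ {η}, CCut a b η → rad k η x = 0 := fun hη => by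
        unfold rad
        rw [hη.zero _ fun h1 => hx (hη.five.trans h1.1), mul_zero]
      simp [hz hθ.deriv_cut.ccut, hz hθ.deriv_cut.deriv_cut.ccut, hz hθ.edge_ccut]

theorem Scale.enstrophy (h : Scale C U P) : ∃ c, 0 ≤ c ∧ ∀ (a b : ℝ) (θ : ℝ → ℝ), Cut a b θ →
    |(∫ x, ‖x‖ ^ 4 * vortSq U x * rad (n / 2) θ x)
        - ∫ x, -(n - 4) * (scHead U P x * (2 + radial U x)) * rad (n / 2) θ x|
      ≤ c * ∫ x, errDens U P x * rad (n / 2) (edge θ) x := by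
  have hC := h.one
  refine ⟨16 + 2 * n + 2 * C, by positivity, fun a b θ hθ => ?_⟩
  have e := h.sol.integral_vortSq (⟨(hθ.test (n := n) (n / 2 - 2)).smooth, (hθ.test _).compact,
    (hθ.test _).supp.trans (ann_subset hθ.five)⟩ : Test {x | 2 < ‖x‖} _)
  simp only [mul_rad_half_sub_two hθ.ccut] at e
  rw [e]
  have hch := h.continuous_scHead
  have hcg := h.continuous_radial
  refine h.integral_err hθ (f₁ := fun x => scHead U P x * (12 - 2 * n + 2 * radial U x))
    (f₂ := fun x => scHead U P x * 4) ?_ ?_ ?_ ?_ ?_ ?_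
  · fun_prop
  · fun_prop
  · fun_prop
  · intro x hx
    obtain ⟨h1, -, h3, -⟩ := h.bounds hx
    rw [abs_mul, mul_comm]
    refine mul_le_mul ?_ h1 (abs_nonneg _) (by positivity)
    rw [abs_le] at h3 ⊢
    constructor <;> linarith [n.cast_nonneg (α := ℝ)]
  · intro x hx
    obtain ⟨h1, -, h3, -⟩ := h.bounds hx
    rw [abs_mul, mul_comm]
    refine mul_le_mul ?_ h1 (abs_nonneg _) (by positivity)
    rw [abs_of_pos (by norm_num)]
    linarith [n.cast_nonneg (α := ℝ)]
  · intro x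
    rw [hθ.lap_rad, hθ.transp_rad, show (n / 2 - 2 + 1 : ℝ) = n / 2 - 1 by ring, mul_add,
      mul_rad_half_sub_one (((hθ.dprof_cut _).const_mul _).add
        (((hθ.dprof_cut _).dprof_cut _).const_mul _)).ccut, ← mul_assoc,
      mul_rad_half_sub_one (hθ.dprof_cut _).ccut]
    simp only [rad, hθ.dprof_dprof, scHead]
    unfold dprof
    ring

theorem Scale.pressure (h : Scale C U P) : ∃ c, 0 ≤ c ∧ ∀ (a b : ℝ) (θ : ℝ → ℝ), Cut a b θ →
    |∫ x, (2 * scHead U P x - (n - 2) * radial U x ^ 2) * rad (n / 2) θ x|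
      ≤ c * ∫ x, errDens U P x * rad (n / 2) (edge θ) x := by
  have hC := h.one
  refine ⟨8 + 2 * n + 3 * C, by positivity, fun a b θ hθ => ?_⟩
  have ht : Test {x | 2 < ‖x‖} (rad (n / 2 - 1) θ : Eu n → ℝ) :=
    ⟨(hθ.test _).smooth, (hθ.test _).compact, (hθ.test _).supp.trans (ann_subset hθ.five)⟩
  have e := h.sol.integral_radial ht
  have e' : ∫ x, (nsq U x * rad (n / 2 - 1) θ x + (P x * (n * rad (n / 2 - 1) θ x
      + euler (rad (n / 2 - 1) θ) x) + radial U x * (lap (rad (n / 2 - 1) θ) x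
        + transp U (rad (n / 2 - 1) θ) x))) = 0 := by
    have i1 := ht.int (sm_nsq h.sol.smU).continuous
    have i2 := ((ht.mul (sm_const (n : ℝ))).add ht.euler).int h.sol.smP.continuous
    have i3 := (ht.lap.add (ht.transp h.sol.smU)).int h.continuous_radial
    have i23 : Integrable fun x => P x * (n * rad (n / 2 - 1) θ x + euler (rad (n / 2 - 1) θ) x)
      + radial U x * (lap (rad (n / 2 - 1) θ) x + transp U (rad (n / 2 - 1) θ) x) := i2.add i3
    rw [integral_add i1 i23, integral_add i2 i3]
    linarith
  have hch := h.continuous_scHead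
  have hcg := h.continuous_radial
  have hcA := h.continuous_velSq
  have := h.integral_err hθ (k := n / 2)
    (w := fun x => nsq U x * rad (n / 2 - 1) θ x + (P x * (n * rad (n / 2 - 1) θ x
      + euler (rad (n / 2 - 1) θ) x) + radial U x * (lap (rad (n / 2 - 1) θ) x
        + transp U (rad (n / 2 - 1) θ) x)))
    (f₀ := fun x => 2 * scHead U P x - (n - 2) * radial U x ^ 2)
    (f₁ := fun x => 2 * scHead U P x - velSq U x + radial U x * (4 - 2 * n) + 2 * radial U x ^ 2)
    (f₂ := fun x => 4 * radial U x) (c := 8 + 2 * n + 3 * C)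
    (by fun_prop) (by fun_prop) (by fun_prop) ?_ ?_ fun x => ?_
  · rwa [e', zero_sub, abs_neg] at this
  · intro x hx
    obtain ⟨h1, h2, h3, h4⟩ := h.bounds hx
    have h5 := radial_sq_le U x
    have h6 := velSq_nonneg U x
    have h7 := errDens_nonneg U P x
    have h8 := sq_nonneg (radial U x)
    have hn := n.cast_nonneg (α := ℝ)
    have h9 : |radial U x * (4 - 2 * n)| ≤ errDens U P x * (4 + 2 * n) := by
      rw [abs_mul]
      refine mul_le_mul h2 ?_ (abs_nonneg _) h7
      rw [abs_le]
      constructor <;> linarith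
    rw [abs_le] at h1 h9 ⊢
    constructor <;> linarith
  · intro x hx
    obtain ⟨h1, h2, h3, h4⟩ := h.bounds hx
    have h7 := errDens_nonneg U P x
    rw [abs_mul, abs_of_pos (by norm_num)]
    refine mul_le_mul ?_ h2 (abs_nonneg _) (by positivity)
    linarith [n.cast_nonneg (α := ℝ)]
  · have eP : P x = head U P x - nsq U x / 2 := by unfold head; ring
    have e1 : n * rad (n / 2 - 1) θ x + 2 * rad (n / 2 - 1) (dprof (n / 2 - 1) θ) x
        = rad (n / 2 - 1) (fun t => 2 * θ t + 2 * deriv θ t) x := by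
      simp only [rad]; unfold dprof; ring
    rw [hθ.lap_rad, hθ.transp_rad, hθ.euler_rad, e1,
      mul_rad_half_sub_one hθ.ccut,
      mul_rad_half_sub_one ((hθ.const_mul 2).add (hθ.deriv_cut.const_mul 2)).ccut, eP]
    simp only [sub_add_cancel, rad, hθ.dprof_dprof, scHead, velSq]
    unfold dprof
    ring

theorem Scale.gradient (h : Scale C U P) : ∃ c, 0 ≤ c ∧ ∀ (a b : ℝ) (θ : ℝ → ℝ), Cut a b θ →
    |(∫ x, ‖x‖ ^ 4 * (gradSq U x - vortSq U x) * rad (n / 2) θ x)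
        - ∫ x, (-(n - 4) * velSq U x + (n - 4) * (n - 2) * radial U x ^ 2) * rad (n / 2) θ x|
      ≤ c * ∫ x, errDens U P x * rad (n / 2) (edge θ) x := by
  have hC := h.one
  refine ⟨(14 + 4 * n) * C, by positivity, fun a b θ hθ => ?_⟩
  have e := h.sol.integral_gradSq_sub (⟨(hθ.test (n := n) (n / 2 - 2)).smooth,
    (hθ.test _).compact, (hθ.test _).supp.trans (ann_subset hθ.five)⟩ : Test {x | 2 < ‖x‖} _)
  simp only [mul_rad_half_sub_two hθ.ccut] at e
  rw [e]
  have hcA := h.continuous_velSq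
  have hcg := h.continuous_radial
  refine h.integral_err hθ (f₁ := fun x => 2 * velSq U x - 4 * (n - 3) * radial U x ^ 2)
    (f₂ := fun x => 4 * radial U x ^ 2) (by fun_prop) (by fun_prop) (by fun_prop) ?_ ?_ ?_
  · intro x hx
    obtain ⟨-, -, -, h4⟩ := h.bounds hx
    have h5 := radial_sq_le U x
    have h6 := velSq_nonneg U x
    have h7 := errDens_nonneg U P x
    have h8 := sq_nonneg (radial U x)
    have hn := n.cast_nonneg (α := ℝ)
    have h9 : |2 * velSq U x - 4 * (n - 3) * radial U x ^ 2| ≤ (14 + 4 * n) * velSq U x := by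
      rw [abs_le]
      constructor <;> nlinarith
    calc _ ≤ _ := h9
      _ ≤ (14 + 4 * n) * (C * errDens U P x) := by gcongr
      _ = _ := by ring
  · intro x hx
    obtain ⟨-, -, -, h4⟩ := h.bounds hx
    have h5 := radial_sq_le U x
    have h7 := errDens_nonneg U P x
    have hn := n.cast_nonneg (α := ℝ)
    rw [abs_of_nonneg (by positivity)]
    have : 0 ≤ (10 + 4 * n) * (C * errDens U P x) := by positivity
    linarith
  · intro x
    have e1 : ∑ i, ∑ j, U i x * U j x * pd i (pd j (rad (n / 2 - 2) θ)) x
        = 2 * nsq U x * rad (n / 2 - 1) (dprof (n / 2 - 2) θ) x + 4 * radial U x ^ 2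
          * rad (n / 2) (dprof (n / 2 - 1) (dprof (n / 2 - 2) θ)) x := by
      have e2 : radial U x ^ 2 = ∑ i, ∑ j, (x i * U i x) * (x j * U j x) := by
        rw [sq, radial, Finset.sum_mul_sum]
      rw [e2, nsq, Finset.mul_sum, Finset.mul_sum, Finset.sum_mul, Finset.sum_mul,
        ← Finset.sum_add_distrib]
      refine Finset.sum_congr rfl fun i _ => ?_
      simp only [hθ.pd_pd_rad, mul_add, Finset.sum_add_distrib, mul_ite, mul_zero,
        Finset.sum_ite_eq, Finset.mem_univ, if_true]
      rw [Finset.mul_sum, Finset.sum_mul, show (n / 2 - 2 + 1 : ℝ) = n / 2 - 1 by ring,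
        sub_add_cancel]
      congr 1
      · ring
      · exact Finset.sum_congr rfl fun j _ => by ring
    rw [e1, mul_rad_half_sub_one (hθ.dprof_cut _).ccut]
    simp only [rad, hθ.dprof_dprof, velSq]
    unfold dprof
    ring

theorem neg_euler_nsq_le (hU : ∀ i, Sm (U i)) (x : Eu n) :
    -euler (nsq U) x ≤ nsq U x + ‖x‖ ^ 2 * gradSq U x := by
  have e : -euler (nsq U) x = ∑ j, 2 * (-U j x * ∑ i, x i * pd i (U j) x) := by
    unfold euler
    simp only [pd_nsq hU, Finset.mul_sum]
    rw [Finset.sum_comm, ← Finset.sum_neg_distrib]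
    refine Finset.sum_congr rfl fun j _ => ?_
    rw [← Finset.sum_neg_distrib]
    exact Finset.sum_congr rfl fun i _ => by ring
  have e2 : nsq U x + ‖x‖ ^ 2 * gradSq U x
      = ∑ j, (U j x ^ 2 + (∑ i, x i ^ 2) * ∑ i, pd i (U j) x ^ 2) := by
    unfold nsq gradSq
    rw [EuclideanSpace.real_norm_sq_eq, Finset.sum_add_distrib, ← Finset.mul_sum,
      Finset.sum_comm (f := fun i j => pd i (U j) x ^ 2)]
  rw [e, e2]
  refine Finset.sum_le_sum fun j _ => ?_
  have := Finset.sum_mul_sq_le_sq_mul_sq Finset.univ (fun i => x i) fun i => pd i (U j) x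
  nlinarith [sq_nonneg (U j x + ∑ i, x i * pd i (U j) x)]

theorem Scale.hardy (h : Scale C U P) : ∃ c, 0 ≤ c ∧ ∀ (a b : ℝ) (θ : ℝ → ℝ), Cut a b θ →
    (∀ t, 0 ≤ θ t) → ∫ x, velSq U x * rad (n / 2) θ x
      ≤ (∫ x, ‖x‖ ^ 4 * gradSq U x * rad (n / 2) θ x)
        + c * ∫ x, errDens U P x * rad (n / 2) (edge θ) x := by
  have hC := h.one
  refine ⟨2 * C, by positivity, fun a b θ hθ h0 => ?_⟩
  have ht : Test {x | 2 < ‖x‖} (rad (n / 2 - 1) θ : Eu n → ℝ) :=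
    ⟨(hθ.test _).smooth, (hθ.test _).compact, (hθ.test _).supp.trans (ann_subset hθ.five)⟩
  have e := euler_ibp ht (sm_nsq h.sol.smU)
  have hcA := h.continuous_velSq
  have hcD : Continuous fun x => ‖x‖ ^ 4 * gradSq U x :=
    (continuous_norm.pow 4).mul (sm_gradSq h.sol.smU).continuous
  have := h.integral_err hθ (k := n / 2) (c := 2 * C)
    (w := fun x => nsq U x * (n * rad (n / 2 - 1) θ x + euler (rad (n / 2 - 1) θ) x))
    (f₀ := fun x => 2 * velSq U x) (f₁ := fun x => 2 * velSq U x) (f₂ := fun x => 0)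
    (by fun_prop) (by fun_prop) (by fun_prop) ?_ ?_ fun x => ?_
  · have h1 := (abs_le.1 this).1
    have h2 : ∫ x, 2 * velSq U x * rad (n / 2) θ x
        = 2 * ∫ x, velSq U x * rad (n / 2) θ x := by
      rw [← integral_const_mul]
      simp only [mul_assoc]
    have h3 : -∫ x, euler (nsq U) x * rad (n / 2 - 1) θ x
        ≤ ∫ x, (velSq U x * rad (n / 2) θ x + ‖x‖ ^ 4 * gradSq U x * rad (n / 2) θ x) := by
      rw [← integral_neg]
      refine integral_mono (ht.int (sm_euler (sm_nsq h.sol.smU)).continuous).neg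
        ((hθ.ccut.int _ hcA).add (hθ.ccut.int _ hcD)) fun x => ?_
      have hr : 0 ≤ rad (n / 2) θ x := mul_nonneg (Real.exp_pos _).le (h0 _)
      have := mul_le_mul_of_nonneg_left (neg_euler_nsq_le h.sol.smU x)
        (mul_nonneg (sq_nonneg ‖x‖) hr)
      simp only [mul_rad_half_sub_one hθ.ccut, velSq]
      linarith
    rw [integral_add (hθ.ccut.int _ hcA) (hθ.ccut.int _ hcD)] at h3
    linarith
  · intro x hx
    obtain ⟨-, -, -, h4⟩ := h.bounds hx
    rw [abs_of_nonneg (by linarith [velSq_nonneg U x])]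
    linarith
  · intro x hx
    have h7 := errDens_nonneg U P x
    rw [abs_zero]
    positivity
  · have e1 : n * rad (n / 2 - 1) θ x + 2 * rad (n / 2 - 1) (dprof (n / 2 - 1) θ) x
        = rad (n / 2 - 1) (fun t => 2 * θ t + 2 * deriv θ t) x := by
      simp only [rad]; unfold dprof; ring
    rw [hθ.euler_rad, e1,
      mul_rad_half_sub_one ((hθ.const_mul 2).add (hθ.deriv_cut.const_mul 2)).ccut]
    simp only [rad, velSq]
    ring

end

section

variable {n : ℕ} {C : ℝ} {U : Fin n → Eu n → ℝ} {P : Eu n → ℝ}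

theorem CCut.integral_lin {a b : ℝ} {θ : ℝ → ℝ} (h : CCut a b θ) (k c d : ℝ) {f g : Eu n → ℝ}
    (hf : Continuous f) (hg : Continuous g) :
    ∫ x, (c * f x + d * g x) * rad k θ x
      = c * (∫ x, f x * rad k θ x) + d * ∫ x, g x * rad k θ x := by
  rw [← integral_const_mul, ← integral_const_mul,
    ← integral_add ((h.int k hf).const_mul c) ((h.int k hg).const_mul d)]
  exact integral_congr_ae (Eventually.of_forall fun x => by ring)

theorem rad_nonneg {k : ℝ} {θ : ℝ → ℝ} (hθ : ∀ t, 0 ≤ θ t) (x : Eu n) : 0 ≤ rad k θ x :=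
  mul_nonneg (Real.exp_pos _).le (hθ _)

/-- The velocity and the head pressure are controlled by the positive part of the latter. -/
theorem Scale.control (h : Scale C U P) (hn : 4 ≤ n) : ∃ c, 0 ≤ c ∧
    ∀ (a b : ℝ) (θ : ℝ → ℝ), Cut a b θ → (∀ t, 0 ≤ θ t) →
      ∫ x, velSq U x * rad (n / 2) θ x ≤ c * ((n - 4) * (∫ x, max (scHead U P x) 0
        * rad (n / 2) θ x) + ∫ x, errDens U P x * rad (n / 2) (edge θ) x) ∧
      ∫ x, |scHead U P x| * rad (n / 2) θ x ≤ c * ((∫ x, max (scHead U P x) 0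
        * rad (n / 2) θ x) + ∫ x, errDens U P x * rad (n / 2) (edge θ) x) := by
  obtain ⟨c1, hc1, H1⟩ := h.enstrophy
  obtain ⟨c2, hc2, H2⟩ := h.pressure
  obtain ⟨c3, hc3, H3⟩ := h.gradient
  obtain ⟨c4, hc4, H4⟩ := h.hardy
  have hC := h.one
  have hn' : (4 : ℝ) ≤ n := by exact_mod_cast hn
  have hn4 : (0 : ℝ) ≤ n - 4 := by linarith
  refine ⟨2 * C + (n - 4) * C * c2 + (c1 + c3 + c4 + (n - 4) * c2) + c2 + 2, by positivity,
    fun a b θ hθ h0 => ?_⟩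
  have H1 := H1 a b θ hθ
  have H2 := H2 a b θ hθ
  have H3 := H3 a b θ hθ
  have H4 := H4 a b θ hθ h0
  have hch := h.continuous_scHead
  have hcg := h.continuous_radial
  have hcA := h.continuous_velSq
  have hcD : Continuous fun x => ‖x‖ ^ 4 * gradSq U x :=
    (continuous_norm.pow 4).mul (sm_gradSq h.sol.smU).continuous
  have hcO : Continuous fun x => ‖x‖ ^ 4 * vortSq U x :=
    (continuous_norm.pow 4).mul (sm_vortSq h.sol.smU).continuous
  have hcp : Continuous fun x => scHead U P x * radial U x := hch.mul hcg
  have hcn : Continuous fun x => -(scHead U P x * radial U x) := hcp.neg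
  have hcq : Continuous fun x => radial U x ^ 2 := hcg.pow 2
  have hcc := hθ.ccut
  have e1 : ∫ x, -(n - 4) * (scHead U P x * (2 + radial U x)) * rad (n / 2) θ x
      = (-2 * (n - 4)) * (∫ x, scHead U P x * rad (n / 2) θ x)
        + -(n - 4) * ∫ x, (scHead U P x * radial U x) * rad (n / 2) θ x := by
    rw [← hcc.integral_lin _ _ _ hch hcp]
    exact integral_congr_ae (Eventually.of_forall fun x => by ring)
  have e2 : ∫ x, (2 * scHead U P x - (n - 2) * radial U x ^ 2) * rad (n / 2) θ x
      = 2 * (∫ x, scHead U P x * rad (n / 2) θ x)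
        + -(n - 2) * ∫ x, radial U x ^ 2 * rad (n / 2) θ x := by
    rw [← hcc.integral_lin _ _ _ hch hcq]
    exact integral_congr_ae (Eventually.of_forall fun x => by ring)
  have e3 : ∫ x, (-(n - 4) * velSq U x + (n - 4) * (n - 2) * radial U x ^ 2) * rad (n / 2) θ x
      = -(n - 4) * (∫ x, velSq U x * rad (n / 2) θ x)
        + (n - 4) * (n - 2) * ∫ x, radial U x ^ 2 * rad (n / 2) θ x := by
    rw [← hcc.integral_lin _ _ _ hcA hcq]
  have e4 : ∫ x, ‖x‖ ^ 4 * (gradSq U x - vortSq U x) * rad (n / 2) θ x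
      = 1 * (∫ x, ‖x‖ ^ 4 * gradSq U x * rad (n / 2) θ x)
        + -1 * ∫ x, ‖x‖ ^ 4 * vortSq U x * rad (n / 2) θ x := by
    rw [← hcc.integral_lin _ _ _ hcD hcO]
    exact integral_congr_ae (Eventually.of_forall fun x => by ring)
  have e5 : ∫ x, |scHead U P x| * rad (n / 2) θ x
      = 2 * (∫ x, max (scHead U P x) 0 * rad (n / 2) θ x)
        + -1 * ∫ x, scHead U P x * rad (n / 2) θ x := by
    rw [← hcc.integral_lin _ _ _ (hch.max continuous_const) hch]
    refine integral_congr_ae (Eventually.of_forall fun x => ?_)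
    simp only
    congr 1
    rcases le_total 0 (scHead U P x) with h' | h'
    · rw [abs_of_nonneg h', max_eq_left h']; ring
    · rw [abs_of_nonpos h', max_eq_right h']; ring
  have e6 : -∫ x, (scHead U P x * radial U x) * rad (n / 2) θ x
      ≤ C * ∫ x, |scHead U P x| * rad (n / 2) θ x := by
    rw [← integral_neg, ← integral_const_mul]
    have := rad_integral_mono (k := n / 2) hcc hcc hcn (hch.abs.const_mul C)
      fun x hx => by
        refine mul_le_mul_of_nonneg_right ?_ (h0 _)
        obtain ⟨-, -, h3, -⟩ := h.bounds hx
        calc _ ≤ |scHead U P x * radial U x| := neg_le_abs _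
          _ = |radial U x| * |scHead U P x| := by rw [abs_mul, mul_comm]
          _ ≤ _ := mul_le_mul_of_nonneg_right h3 (abs_nonneg _)
    simpa only [neg_mul, mul_assoc] using this
  have hE : 0 ≤ ∫ x, errDens U P x * rad (n / 2) (edge θ) x :=
    integral_nonneg fun x => mul_nonneg (errDens_nonneg U P x) (rad_nonneg (edge_nonneg θ) x)
  have hA : 0 ≤ ∫ x, velSq U x * rad (n / 2) θ x :=
    integral_nonneg fun x => mul_nonneg (velSq_nonneg U x) (rad_nonneg h0 x)
  have hg : 0 ≤ ∫ x, radial U x ^ 2 * rad (n / 2) θ x :=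
    integral_nonneg fun x => mul_nonneg (sq_nonneg _) (rad_nonneg h0 x)
  have hp : 0 ≤ ∫ x, max (scHead U P x) 0 * rad (n / 2) θ x :=
    integral_nonneg fun x => mul_nonneg (le_max_right _ _) (rad_nonneg h0 x)
  rw [e1] at H1
  rw [e2] at H2
  rw [e3, e4] at H3
  generalize (∫ x, errDens U P x * rad (n / 2) (edge θ) x) = E at *
  generalize (∫ x, velSq U x * rad (n / 2) θ x) = XA at *
  generalize (∫ x, radial U x ^ 2 * rad (n / 2) θ x) = Xg at *
  generalize (∫ x, max (scHead U P x) 0 * rad (n / 2) θ x) = Xp at *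
  generalize (∫ x, |scHead U P x| * rad (n / 2) θ x) = Xa at *
  generalize (∫ x, (scHead U P x * radial U x) * rad (n / 2) θ x) = Xhg at *
  generalize (∫ x, scHead U P x * rad (n / 2) θ x) = Xh at *
  generalize (∫ x, ‖x‖ ^ 4 * gradSq U x * rad (n / 2) θ x) = XD at *
  generalize (∫ x, ‖x‖ ^ 4 * vortSq U x * rad (n / 2) θ x) = XO at *
  rw [abs_le] at H1 H2 H3
  have q1 : Xa ≤ 2 * Xp + c2 * E := by nlinarith
  have q2 : (n - 3) * XA ≤ (n - 4) * -Xhg + (c1 + c3 + c4 + (n - 4) * c2) * E := by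
    have := mul_le_mul_of_nonneg_left H2.1 hn4
    have := mul_le_mul_of_nonneg_left H2.2 hn4
    linarith
  have q3 : (n - 4) * -Xhg ≤ (n - 4) * (C * (2 * Xp + c2 * E)) :=
    mul_le_mul_of_nonneg_left (e6.trans (mul_le_mul_of_nonneg_left q1 (by linarith))) hn4
  have q4 : XA ≤ (n - 3) * XA := le_mul_of_one_le_left hA (by linarith)
  have p1 : 0 ≤ (n - 4) * Xp := by positivity
  constructor
  · have r1 : 0 ≤ (2 * C + c2 + 2) * E := by positivity
    have r2 : 0 ≤ ((n - 4) * C * c2 + (c1 + c3 + c4 + (n - 4) * c2) + c2 + 2)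
      * ((n - 4) * Xp) := by positivity
    linarith
  · have r1 : 0 ≤ (2 * C + (n - 4) * C * c2 + (c1 + c3 + c4 + (n - 4) * c2) + 2) * E := by
      positivity
    have r2 : 0 ≤ (2 * C + (n - 4) * C * c2 + (c1 + c3 + c4 + (n - 4) * c2) + c2) * Xp := by
      positivity
    linarith

/-- A smooth convex regularization of `s ↦ (2 s₊) ^ q`. -/
theorem exists_convex_profile {q ε : ℝ} (hq : 1 < q) (hε : 0 < ε) :
    ∃ β β' β'' : ℝ → ℝ, ContDiff ℝ ∞ β ∧ Continuous β' ∧ Continuous β''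
      ∧ (∀ s, HasDerivAt β (β' s) s) ∧ (∀ s, HasDerivAt β' (β'' s) s) ∧ (∀ s, 0 ≤ β' s)
      ∧ (∀ s, 0 ≤ β s) ∧ (∀ s, 0 ≤ β'' s) ∧ (∀ s, β' s ^ 2 ≤ q / (q - 1) * (β s * β'' s))
      ∧ (∀ s, (max s 0) ^ q ≤ β s) ∧ ∀ s, β s ≤ (2 * |s| + ε) ^ q := by
  have hq1 : 0 < q - 1 := by linarith
  have hq0 : 0 < q := by linarith
  set R : ℝ → ℝ := fun s => √(s ^ 2 + ε ^ 2) with hRdef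
  have hR0 : ∀ s, s ^ 2 + ε ^ 2 ≠ 0 := fun s => by positivity
  have hR : ∀ s, 0 < R s := fun s => Real.sqrt_pos.2 (by positivity)
  have hRs : ∀ s, |s| < R s := fun s =>
    Real.lt_sqrt_of_sq_lt (by rw [sq_abs]; nlinarith [sq_pos_of_pos hε])
  have hRle : ∀ s, R s ≤ |s| + ε := fun s =>
    Real.sqrt_le_iff.2 ⟨by positivity, by nlinarith [sq_abs s, mul_nonneg (abs_nonneg s) hε.le]⟩
  have hy : ∀ s, 0 < s + R s := fun s => by linarith [hRs s, neg_abs_le s]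
  have hRsm : ContDiff ℝ ∞ R := contDiff_iff_contDiffAt.2 fun s =>
    ContDiffAt.sqrt (by fun_prop) (hR0 s)
  have hRd : ∀ s, HasDerivAt R (s / R s) s := fun s => by
    have := (((hasDerivAt_id s).pow 2).add_const (ε ^ 2)).sqrt (hR0 s)
    refine this.congr_deriv ?_
    simp only [id, Pi.pow_apply, Nat.cast_ofNat, Nat.add_one_sub_one, pow_one, mul_one]
    exact mul_div_mul_left _ _ two_ne_zero
  set β : ℝ → ℝ := fun s => Real.exp (q * Real.log (s + R s)) with hβdef
  have hβ : ∀ s, 0 < β s := fun s => Real.exp_pos _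
  have hβsm : ContDiff ℝ ∞ β := Real.contDiff_exp.comp (contDiff_const.mul
    ((contDiff_id.add hRsm).log fun s => (hy s).ne'))
  have hβd : ∀ s, HasDerivAt β (q * β s / R s) s := fun s => by
    have := ((((hasDerivAt_id s).add (hRd s)).log (hy s).ne').const_mul q).exp
    refine HasDerivAt.congr_deriv this ?_
    have h1 := (hR s).ne'
    have h2 := (hy s).ne'
    change β s * (q * ((1 + s / R s) / (s + R s))) = _
    field_simp
    ring
  have hβc := hβsm.continuous
  have hRc := hRsm.continuous
  have hβ'' : ∀ s, q * (q - 1) * β s / R s ^ 2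
      ≤ (q * (q * β s / R s) * R s - q * β s * (s / R s)) / R s ^ 2 := fun s => by
    refine div_le_div_of_nonneg_right ?_ (sq_nonneg _)
    have h1 : q * (q * β s / R s) * R s = q * q * β s := by
      have := (hR s).ne'
      field_simp
    have h2 : s / R s ≤ 1 := (div_le_one (hR s)).2 ((le_abs_self s).trans (hRs s).le)
    have h3 := mul_le_mul_of_nonneg_left h2 (mul_nonneg hq0.le (hβ s).le)
    rw [h1]
    linarith
  refine ⟨β, fun s => q * β s / R s,
    fun s => (q * (q * β s / R s) * R s - q * β s * (s / R s)) / R s ^ 2, hβsm,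
    (continuous_const.mul hβc).div hRc fun s => (hR s).ne', ?_, hβd,
    fun s => ((hβd s).const_mul q).div (hRd s) (hR s).ne', fun s => ?_, fun s => (hβ s).le,
    fun s => ?_, fun s => ?_, fun s => ?_, fun s => ?_⟩
  · refine Continuous.div ?_ (hRc.pow 2) fun s => pow_ne_zero _ (hR s).ne'
    refine Continuous.sub ((continuous_const.mul ((continuous_const.mul hβc).div hRc
      fun s => (hR s).ne')).mul hRc) ((continuous_const.mul hβc).mul
        (continuous_id.div hRc fun s => (hR s).ne'))
  · have := hR s
    have := hβ s
    positivity
  · refine le_trans ?_ (hβ'' s)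
    have := hR s
    have := hβ s
    positivity
  · have h1 := mul_le_mul_of_nonneg_left (hβ'' s)
      (mul_nonneg (div_pos hq0 hq1).le (hβ s).le)
    rw [← mul_assoc]
    refine le_trans (le_of_eq ?_) h1
    have := (hR s).ne'
    field_simp
  · have h1 : β s = (s + R s) ^ q := by
      rw [Real.rpow_def_of_pos (hy s), mul_comm]
    rw [h1]
    refine Real.rpow_le_rpow (le_max_right _ _) (max_le ?_ (hy s).le) hq0.le
    linarith [hR s]
  · have h1 : β s = (s + R s) ^ q := by
      rw [Real.rpow_def_of_pos (hy s), mul_comm]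
    rw [h1]
    refine Real.rpow_le_rpow (hy s).le ?_ hq0.le
    linarith [hRle s, le_abs_self s]

end

section

variable {n : ℕ} {C : ℝ} {U : Fin n → Eu n → ℝ} {P : Eu n → ℝ}

/-- The weighted volume of the transition regions of a plateau is bounded. -/
theorem exists_edge_volume (hn : 1 ≤ n) : ∃ V, 0 ≤ V ∧ ∀ a b N : ℝ, 1 ≤ N → 5 + N ≤ a →
    5 + 2 * N ≤ b → ∫ x : Eu n, rad (n / 2) (edge (plateau a b N)) x ≤ V := by
  obtain ⟨V, hV, hvol⟩ := exists_rad_volume hn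
  obtain ⟨K, hK, hedge⟩ := exists_edge_plateau_le
  refine ⟨6 * K * V, by positivity, fun a b N hN ha hb => ?_⟩
  have hN0 : 0 < N := by linarith
  have c1 : Cut (a - N) (a + 2 * N) (plateau (a - N) (a + 2 * N) N) :=
    plateau_cut (by linarith) hN0
  have c2 : Cut (b - 2 * N) (b + N) (plateau (b - 2 * N) (b + N) N) :=
    plateau_cut (by linarith) hN0
  have c0 : Cut a b (plateau a b N) := plateau_cut (by linarith) hN0
  have v1 := hvol _ _ _ (by linarith) c1.ccut (plateau_nonneg _ _ _) (plateau_le_one _ _ _)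
  have v2 := hvol _ _ _ (by linarith) c2.ccut (plateau_nonneg _ _ _) (plateau_le_one _ _ _)
  have i1 := c1.ccut.int (n := n) (n / 2) (f := fun _ => K / N) continuous_const
  have i2 := c2.ccut.int (n := n) (n / 2) (f := fun _ => K / N) continuous_const
  have i0 := c0.edge_ccut.int (n := n) (n / 2) (f := fun _ => 1) continuous_const
  simp only [one_mul] at i0
  calc _ ≤ ∫ x : Eu n, (K / N * rad (n / 2) (plateau (a - N) (a + 2 * N) N) x
        + K / N * rad (n / 2) (plateau (b - 2 * N) (b + N) N) x) := by
        refine integral_mono i0 (i1.add i2) fun x => ?_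
        have := mul_le_mul_of_nonneg_left (hedge a b N (Real.log (‖x‖ ^ 2)) hN)
          (Real.exp_pos (-(n / 2) * Real.log (‖x‖ ^ 2))).le
        simp only [rad]
        linarith
    _ = K / N * (∫ x : Eu n, rad (n / 2) (plateau (a - N) (a + 2 * N) N) x)
        + K / N * ∫ x : Eu n, rad (n / 2) (plateau (b - 2 * N) (b + N) N) x := by
        rw [integral_add i1 i2, integral_const_mul, integral_const_mul]
    _ ≤ K / N * (V * (3 * N)) + K / N * (V * (3 * N)) := by
        have hKN : 0 ≤ K / N := by positivity
        refine add_le_add (mul_le_mul_of_nonneg_left (v1.trans_eq (by ring)) hKN)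
          (mul_le_mul_of_nonneg_left (v2.trans_eq (by ring)) hKN)
    _ = 6 * K * V := by field_simp; ring

/-- The error terms of a plateau are bounded. -/
theorem Scale.exists_err_bound (h : Scale C U P) (hn : 1 ≤ n) : ∃ V, 0 ≤ V ∧ ∀ a b N : ℝ,
    1 ≤ N → 5 + N ≤ a → 5 + 2 * N ≤ b →
      ∫ x, errDens U P x * rad (n / 2) (edge (plateau a b N)) x ≤ V := by
  obtain ⟨V, hV, hvol⟩ := exists_edge_volume hn
  have hC := h.one
  refine ⟨2 * C * V, by positivity, fun a b N hN ha hb => ?_⟩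
  have c0 : CCut a b (edge (plateau a b N)) :=
    (plateau_cut (by linarith) (by linarith)).edge_ccut
  refine (rad_integral_mono (k := n / 2) (g := fun _ => 2 * C) c0 c0 h.continuous_errDens
    continuous_const fun x hx => mul_le_mul_of_nonneg_right ?_ (edge_nonneg _ _)).trans ?_
  · have h8 := eight_le_norm hx
    have h1 := h.pres x h8
    have h2 : √(velSq U x) ≤ C := Real.sqrt_le_iff.2 ⟨by linarith, by nlinarith [h.vel x h8]⟩
    unfold errDens
    linarith
  · rw [integral_const_mul]
    exact mul_le_mul_of_nonneg_left (hvol a b N hN ha hb) (by positivity)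

/-- In high dimension a power of the positive part of the head pressure is integrable. -/
theorem Scale.head_power (h : Scale C U P) (hn : 5 ≤ n) : ∃ B, ∀ b, 6 + 2 ≤ b →
    ∫ x, max (scHead U P x) 0 ^ ((n : ℝ) / 2 - 1) * rad (n / 2) (plateau 6 b 1) x ≤ B := by
  obtain ⟨V, hV, hvol⟩ := exists_edge_volume (n := n) (by lia)
  have hn' : (5 : ℝ) ≤ n := by exact_mod_cast hn
  have hC := h.one
  set q : ℝ := (n : ℝ) / 2 - 1 with hqdef
  have hq : 1 < q := by linarith
  have hq0 : 0 < q := by linarith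
  have hq1 : 0 < q - 1 := by linarith
  set K := q / (4 * (q - 1)) with hKdef
  have hK : 0 ≤ K := by positivity
  refine ⟨(2 + K * (2 * n + 8 + 2 * C)) * ((2 * C + 1) ^ q * V), fun b hb => ?_⟩
  set θ := plateau 6 b 1
  have hθ : Cut 6 b θ := plateau_cut (by norm_num) one_pos
  have hθ0 : ∀ t, 0 ≤ θ t := plateau_nonneg 6 b 1
  obtain ⟨β, β', β'', sβ, cβ', cβ'', dβ, dβ', pβ', pβ, pβ'', ineq, lo, up⟩ :=
    exists_convex_profile hq (Real.exp_pos (-b))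
  have sH := sm_head h.sol.smU h.sol.smP
  set H := head U P with hHdef
  set W : Eu n → ℝ := fun x => β (H x)
  have sW : Sm W := sβ.comp sH
  have cW := sW.continuous
  have cg := h.continuous_radial
  set G : Eu n → ℝ := fun x => β'' (H x) * ∑ i, pd i H x ^ 2
  have cG : Continuous G := (cβ''.comp sH.continuous).mul
    (continuous_finsetSum _ fun i _ => ((sH.pd i).continuous).pow 2)
  have ht : ∀ k, Test {x | 2 < ‖x‖} (rad k θ : Eu n → ℝ) := fun k =>
    ⟨(hθ.test _).smooth, (hθ.test _).compact, (hθ.test _).supp.trans (ann_subset hθ.five)⟩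
  have hWG : ∀ x, -euler W x ≤ W x + K * (‖x‖ ^ 2 * G x) := by
    intro x
    have e : euler W x = β' (H x) * ∑ i, x i * pd i H x := by
      unfold euler
      rw [Finset.mul_sum]
      refine Finset.sum_congr rfl fun i _ => ?_
      rw [pd_comp sH (dβ (H x))]
      ring
    have cs := Finset.sum_mul_sq_le_sq_mul_sq Finset.univ (fun i => x i) fun i => pd i H x
    rw [← EuclideanSpace.real_norm_sq_eq] at cs
    rw [e]
    set z := ∑ i, x i * pd i H x
    have hG0 : 0 ≤ ‖x‖ ^ 2 * G x := mul_nonneg (sq_nonneg _) (mul_nonneg (pβ'' _)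
      (Finset.sum_nonneg fun i _ => sq_nonneg _))
    have h1 : (β' (H x) * z) ^ 2 ≤ 4 * (W x * (K * (‖x‖ ^ 2 * G x))) := by
      calc _ = β' (H x) ^ 2 * z ^ 2 := by ring
        _ ≤ (q / (q - 1) * (β (H x) * β'' (H x))) * (‖x‖ ^ 2 * ∑ i, pd i H x ^ 2) :=
          mul_le_mul (ineq _) cs (sq_nonneg _) (mul_nonneg (div_pos hq0 hq1).le
            (mul_nonneg (pβ _) (pβ'' _)))
        _ = _ := by
          simp only [W, G, hKdef]
          field_simp
    have h2 : 0 ≤ W x + K * (‖x‖ ^ 2 * G x) := add_nonneg (pβ _) (mul_nonneg hK hG0)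
    refine (neg_le_abs _).trans (abs_le_of_sq_le_sq ?_ h2)
    nlinarith [sq_nonneg (W x - K * (‖x‖ ^ 2 * G x))]
  have convex := h.sol.convex_head (ht 0) (rad_nonneg hθ0) sβ cβ'' dβ dβ' pβ'
  have ie := hθ.edge_ccut.int 1 cW
  have convex' : ∫ x, G x * rad 0 θ x
      ≤ (2 * n + 8 + 2 * C) * ∫ x, W x * rad 1 (edge θ) x := by
    refine convex.trans ?_
    rw [← integral_const_mul]
    refine integral_mono (((ht 0).lap.add ((ht 0).transp h.sol.smU)).int cW)
      (ie.const_mul _) fun x => ?_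
    have hl := hθ.lap_rad (n := n) 0 x
    have hr := hθ.transp_rad 0 U x
    rw [zero_add] at hl hr
    rw [hl, hr]
    by_cases hx : 5 ≤ Real.log (‖x‖ ^ 2)
    · obtain ⟨-, -, hgC, -⟩ := h.bounds hx
      unfold rad edge
      simp only [hθ.dprof_dprof]
      unfold dprof
      set E := Real.exp (-1 * Real.log (‖x‖ ^ 2))
      set s := Real.log (‖x‖ ^ 2)
      have hE : 0 ≤ W x * E := mul_nonneg (pβ _) (Real.exp_pos _).le
      have h1 : radial U x * deriv θ s ≤ C * |deriv θ s| :=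
        (le_abs_self _).trans ((abs_mul _ _).trans_le
          (mul_le_mul_of_nonneg_right hgC (abs_nonneg _)))
      have h2 : (n - 2) * deriv θ s ≤ (n - 2) * |deriv θ s| :=
        mul_le_mul_of_nonneg_left (le_abs_self _) (by linarith)
      have h3 := le_abs_self (deriv (deriv θ) s)
      have h4 : 0 ≤ |deriv θ s| := abs_nonneg _
      have h5 : 0 ≤ |deriv (deriv θ) s| := abs_nonneg _
      have h6 : 0 ≤ (2 * n + 2 * C) * |deriv (deriv θ) s| := by positivity
      have h7 : 2 * n * deriv θ s + 4 * (deriv (deriv θ) s - deriv θ s)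
          + 2 * (radial U x * deriv θ s)
          ≤ (2 * n + 8 + 2 * C) * (|deriv θ s| + |deriv (deriv θ) s|) := by linarith
      have h8 := mul_le_mul_of_nonneg_left h7 hE
      calc _ = W x * E * (2 * n * deriv θ s + 4 * (deriv (deriv θ) s - deriv θ s)
          + 2 * (radial U x * deriv θ s)) := by ring
        _ ≤ _ := h8
        _ = _ := by ring
    · have hz : ∀ {η}, CCut 6 b η → η (Real.log (‖x‖ ^ 2)) = 0 := fun hη =>
        hη.zero _ fun h1 => hx (by linarith [h1.1])
      simp only [rad, hz (hθ.dprof_cut 0).ccut, hz ((hθ.dprof_cut 0).dprof_cut 1).ccut,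
        hz hθ.edge_ccut, mul_zero, add_zero, le_refl]
  have key : (n - 3) * ∫ x, W x * rad 1 θ x
      ≤ (2 + K * (2 * n + 8 + 2 * C)) * ∫ x, W x * rad 1 (edge θ) x := by
    have e1 := euler_ibp (ht 1) sW
    have i1 := hθ.ccut.int 1 cW
    have i1' := hθ.deriv_cut.ccut.int 1 cW
    have iG := hθ.ccut.int 0 cG
    have e2 : ∫ x, W x * (n * rad 1 θ x + euler (rad 1 θ) x)
        = (n - 2) * (∫ x, W x * rad 1 θ x) + 2 * ∫ x, W x * rad 1 (deriv θ) x := by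
      rw [← integral_const_mul, ← integral_const_mul,
        ← integral_add (i1.const_mul _) (i1'.const_mul _)]
      refine integral_congr_ae (Eventually.of_forall fun x => ?_)
      simp only [hθ.euler_rad, rad, dprof]
      ring
    have e3 : -∫ x, euler W x * rad 1 θ x
        ≤ (∫ x, W x * rad 1 θ x) + K * ∫ x, G x * rad 0 θ x := by
      rw [← integral_neg, ← integral_const_mul, ← integral_add i1 (iG.const_mul _)]
      refine integral_mono (hθ.ccut.int 1 (sm_euler sW).continuous).neg
        (i1.add (iG.const_mul _)) fun x => ?_
      have e4 := hθ.ccut.normSq_mul_rad 0 x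
      rw [zero_add] at e4
      simp only
      rw [← e4]
      have := mul_le_mul_of_nonneg_right (hWG x) (rad_nonneg (k := 1) hθ0 x)
      linarith
    have e5 : -∫ x, W x * rad 1 (deriv θ) x ≤ ∫ x, W x * rad 1 (edge θ) x := by
      rw [← integral_neg]
      refine integral_mono i1'.neg ie fun x => ?_
      have : -deriv θ (Real.log (‖x‖ ^ 2)) ≤ edge θ (Real.log (‖x‖ ^ 2)) := by
        unfold edge
        linarith [neg_abs_le (deriv θ (Real.log (‖x‖ ^ 2))),
          abs_nonneg (deriv (deriv θ) (Real.log (‖x‖ ^ 2)))]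
      have := mul_le_mul_of_nonneg_left this (mul_nonneg (pβ (H x))
        (Real.exp_pos (-1 * Real.log (‖x‖ ^ 2))).le)
      simp only [rad, W]
      linarith
    have e6 := mul_le_mul_of_nonneg_left convex' hK
    rw [e2] at e1
    linarith
  have hW0 : 0 ≤ ∫ x, W x * rad 1 θ x :=
    integral_nonneg fun x => mul_nonneg (pβ _) (rad_nonneg hθ0 x)
  calc _ ≤ ∫ x, W x * rad 1 θ x := by
        refine integral_mono (hθ.ccut.int _
          ((h.continuous_scHead.max continuous_const).rpow_const fun _ => Or.inr hq0.le))
          (hθ.ccut.int 1 cW) fun x => ?_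
        by_cases hx : 5 ≤ Real.log (‖x‖ ^ 2)
        · have h8 := eight_le_norm hx
          have hs : 0 < ‖x‖ ^ 2 := by positivity
          have e1 : max (scHead U P x) 0 = ‖x‖ ^ 2 * max (H x) 0 := by
            rw [mul_max_of_nonneg _ _ hs.le, mul_zero]
            rfl
          simp only [rad]
          rw [e1, Real.mul_rpow hs.le (le_max_right _ _), Real.rpow_def_of_pos hs]
          have e2 : Real.exp (-1 * Real.log (‖x‖ ^ 2)) = Real.exp (Real.log (‖x‖ ^ 2) * q)
              * Real.exp (-(n / 2) * Real.log (‖x‖ ^ 2)) := by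
            rw [← Real.exp_add]
            congr 1
            rw [hqdef]
            ring
          rw [e2]
          have := mul_le_mul_of_nonneg_right (lo (H x)) (mul_nonneg (mul_nonneg
            (Real.exp_pos (Real.log (‖x‖ ^ 2) * q)).le
            (Real.exp_pos (-(n / 2) * Real.log (‖x‖ ^ 2))).le) (hθ0 (Real.log (‖x‖ ^ 2))))
          linarith
        · have hz : θ (Real.log (‖x‖ ^ 2)) = 0 :=
            hθ.zero _ fun h1 => hx (by linarith [h1.1])
          simp only [rad, hz, mul_zero, le_refl]
    _ ≤ (n - 3) * ∫ x, W x * rad 1 θ x := le_mul_of_one_le_left hW0 (by linarith)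
    _ ≤ _ := key
    _ ≤ _ := by
        refine mul_le_mul_of_nonneg_left ?_ (by positivity)
        refine le_trans ?_ (mul_le_mul_of_nonneg_left (hvol 6 b 1 le_rfl (by norm_num)
          (by linarith)) (by positivity))
        rw [← integral_const_mul]
        refine integral_mono ie (hθ.edge_ccut.int (n / 2) (f := fun _ => (2 * C + 1) ^ q)
          continuous_const) fun x => ?_
        by_cases hx : Real.log (‖x‖ ^ 2) ∈ Icc 6 b
        · have h8 := eight_le_norm (x := x) (by linarith [hx.1])
          have hs : 0 < ‖x‖ ^ 2 := by positivity
          have e1 : Real.exp (-b) ≤ 1 / ‖x‖ ^ 2 := by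
            rw [Real.exp_neg, ← one_div]
            exact one_div_le_one_div_of_le hs ((Real.log_le_iff_le_exp hs).1 hx.2)
          have e2 : |H x| ≤ C / ‖x‖ ^ 2 := by
            rw [le_div_iff₀ hs]
            have := h.pres x h8
            rwa [scHead, abs_mul, abs_of_pos hs, mul_comm] at this
          have e3 : W x ≤ ((2 * C + 1) / ‖x‖ ^ 2) ^ q :=
            (up (H x)).trans (Real.rpow_le_rpow (by positivity)
              (by linarith [add_div (2 * C) 1 (‖x‖ ^ 2), mul_div_assoc 2 C (‖x‖ ^ 2)]) hq0.le)
          rw [Real.div_rpow (by linarith) hs.le, le_div_iff₀ (by positivity),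
            Real.rpow_def_of_pos hs] at e3
          have e4 : Real.exp (-1 * Real.log (‖x‖ ^ 2)) = Real.exp (Real.log (‖x‖ ^ 2) * q)
              * Real.exp (-(n / 2) * Real.log (‖x‖ ^ 2)) := by
            rw [← Real.exp_add]
            congr 1
            rw [hqdef]
            ring
          simp only [rad]
          rw [e4]
          have := mul_le_mul_of_nonneg_right e3 (mul_nonneg
            (Real.exp_pos (-(n / 2) * Real.log (‖x‖ ^ 2))).le
            (edge_nonneg θ (Real.log (‖x‖ ^ 2))))
          linarith
        · simp only [rad, hθ.edge_ccut.zero _ hx, mul_zero]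
          exact mul_nonneg (by positivity) (mul_nonneg (Real.exp_pos _).le (edge_nonneg _ _))

end

section

variable {n : ℕ} {C : ℝ} {U : Fin n → Eu n → ℝ} {P : Eu n → ℝ}

theorem le_add_rpow_div {h κ q : ℝ} (hh : 0 ≤ h) (hκ : 0 < κ) (hq : 1 < q) :
    h ≤ κ + h ^ q / κ ^ (q - 1) := by
  have hp : 0 < κ ^ (q - 1) := Real.rpow_pos_of_pos hκ _
  have hq' : 0 ≤ h ^ q / κ ^ (q - 1) := div_nonneg (Real.rpow_nonneg hh _) hp.le
  rcases le_total h κ with h1 | h1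
  · linarith
  · have h0 : 0 < h := hκ.trans_le h1
    have h2 : h ≤ h ^ q / κ ^ (q - 1) := by
      rw [le_div_iff₀ hp]
      calc h * κ ^ (q - 1) ≤ h * h ^ (q - 1) :=
            mul_le_mul_of_nonneg_left (Real.rpow_le_rpow hκ.le h1 (by linarith)) hh
        _ = h ^ (1 + (q - 1)) := by rw [Real.rpow_add h0, Real.rpow_one]
        _ = h ^ q := by ring_nf
    linarith

/-- In high dimension the positive part of the head pressure is small on far windows. -/
theorem Scale.head_small (h : Scale C U P) (hn : 5 ≤ n) {L δ : ℝ} (hL : 0 < L) (hδ : 0 < δ) :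
    ∃ T, 5 + L + 1 ≤ T ∧ ∀ t, T ≤ t → ∀ η, CCut (t - L) (t + L) η → (∀ s, 0 ≤ η s) →
      (∀ s, η s ≤ 1) → ∫ x, max (scHead U P x) 0 * rad (n / 2) η x ≤ δ := by
  obtain ⟨V, hV, hvol⟩ := exists_rad_volume (n := n) (by lia)
  obtain ⟨B, hB⟩ := h.head_power hn
  have hn' : (5 : ℝ) ≤ n := by exact_mod_cast hn
  set q : ℝ := (n : ℝ) / 2 - 1 with hqdef
  have hq : 1 < q := by linarith
  have hcp : Continuous fun x => max (scHead U P x) 0 := h.continuous_scHead.max continuous_const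
  have hcq : Continuous fun x => max (scHead U P x) 0 ^ q :=
    hcp.rpow_const fun _ => Or.inr (by linarith)
  set κ := δ / (4 * (V * L) + 1) with hκdef
  have hVL : 0 ≤ V * L := by positivity
  have hκ : 0 < κ := by positivity
  have hκ2 : κ * (2 * (V * L)) ≤ δ / 2 := by
    rw [hκdef, div_mul_eq_mul_div, div_le_iff₀ (by positivity)]
    nlinarith
  have hp : 0 < κ ^ (q - 1) := Real.rpow_pos_of_pos hκ _
  obtain ⟨T, hT, H⟩ := tail_window_small hcq
    (fun x => Real.rpow_nonneg (le_max_right _ _) _) (by norm_num) hB L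
    (δ / 2 * κ ^ (q - 1)) (by positivity)
  refine ⟨T, hT, fun t ht η hη h0 h1 => ?_⟩
  have H := H t ht η hη h1
  have hv := hvol _ _ η (by linarith) hη h0 h1
  calc _ ≤ ∫ x, (κ * 1 + (κ ^ (q - 1))⁻¹ * max (scHead U P x) 0 ^ q) * rad (n / 2) η x := by
        refine rad_integral_mono hη hη hcp
          (continuous_const.add (hcq.const_mul _)) fun x _ =>
          mul_le_mul_of_nonneg_right ?_ (h0 _)
        rw [mul_one, inv_mul_eq_div]
        exact le_add_rpow_div (le_max_right _ _) hκ hq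
    _ = κ * (∫ x : Eu n, 1 * rad (n / 2) η x)
        + (κ ^ (q - 1))⁻¹ * ∫ x, max (scHead U P x) 0 ^ q * rad (n / 2) η x :=
        hη.integral_lin _ _ _ continuous_const hcq
    _ ≤ κ * (V * (t + L - (t - L))) + (κ ^ (q - 1))⁻¹ * (δ / 2 * κ ^ (q - 1)) := by
        simp only [one_mul]
        exact add_le_add (mul_le_mul_of_nonneg_left hv hκ.le)
          (mul_le_mul_of_nonneg_left H (inv_nonneg.2 hp.le))
    _ = κ * (2 * (V * L)) + δ / 2 := by field_simp; ring
    _ ≤ δ := by linarith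

/-- The scaled velocity is small in mean square on far windows. -/
theorem Scale.vel_small (h : Scale C U P) (hn : 4 ≤ n) {ε : ℝ} (hε : 0 < ε) :
    ∃ T, 9 ≤ T ∧ ∀ t, T ≤ t →
      ∫ x, velSq U x * rad (n / 2) (plateau (t - 3) (t + 3) 1) x ≤ ε := by
  obtain ⟨c, hc, hcon⟩ := h.control hn
  obtain ⟨V₁, hV₁, herr⟩ := h.exists_err_bound (by lia)
  have hcA := h.continuous_velSq
  have hcD := h.continuous_errDens
  rcases hn.eq_or_lt with h4 | h5
  · obtain ⟨T, hT, H⟩ := tail_window_small (a := 6) (C := c * V₁) hcA (velSq_nonneg U)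
      (by norm_num) (fun b hb => by
        have h1 := (hcon 6 b (plateau 6 b 1) (plateau_cut (by norm_num) one_pos)
          (plateau_nonneg _ _ _)).1
        have h2 := herr 6 b 1 le_rfl (by norm_num) (by linarith)
        have h3 : (n : ℝ) - 4 = 0 := by rw [← h4]; norm_num
        rw [h3, zero_mul, zero_add] at h1
        exact h1.trans (mul_le_mul_of_nonneg_left h2 hc)) 3 ε hε
    exact ⟨T, by linarith, fun t ht => H t ht _
      (plateau_cut (by linarith) one_pos).ccut (plateau_le_one _ _ _)⟩
  obtain ⟨V, hV, hvol⟩ := exists_rad_volume (n := n) (by lia)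
  obtain ⟨K, hK, hedge⟩ := exists_edge_plateau_le
  have hn' : (5 : ℝ) ≤ n := by exact_mod_cast h5
  have hn4 : (0 : ℝ) ≤ n - 4 := by linarith
  set C' := c * ((n - 4) * 1 + V₁) + c * (1 + V₁) with hC'
  have hC'0 : 0 ≤ C' := by positivity
  set κ := ε / (80 * (c * K * V) + 1) with hκdef
  have hcKV : 0 ≤ c * K * V := by positivity
  have hκ : 0 < κ := by positivity
  have hκ2 : 20 * (c * K * V) * κ ≤ ε / 4 := by
    rw [hκdef, mul_div_assoc', div_le_iff₀ (by positivity)]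
    nlinarith
  set D := 2 * (c * K * C') * (1 + 1 / κ) with hD
  have hD0 : 0 ≤ D := by positivity
  set N := 3 + 4 * D / ε with hNdef
  have hN3 : 3 ≤ N := by have : 0 ≤ 4 * D / ε := by positivity
                         linarith
  have hN0 : 0 < N := by linarith
  have hDN : D / N ≤ ε / 4 := by
    rw [div_le_iff₀ hN0, hNdef]
    have : ε / 4 * (3 + 4 * D / ε) = ε * 3 / 4 + D := by field_simp
    linarith
  set δ := ε / (2 * (c * (n - 4) + 1)) with hδdef
  have hcn : 0 ≤ c * (n - 4) := by positivity
  have hδ : 0 < δ := by positivity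
  have hδ2 : c * (n - 4) * δ ≤ ε / 2 := by
    rw [hδdef, mul_div_assoc', div_le_iff₀ (by positivity)]
    nlinarith
  have hch := h.continuous_scHead
  have hcp : Continuous fun x => max (scHead U P x) 0 := hch.max continuous_const
  obtain ⟨T₁, hT₁, H₁⟩ := h.head_small h5 (L := 5 * N) (by linarith) one_pos
  obtain ⟨T₂, hT₂, H₂⟩ := h.head_small h5 (L := 2 * N) (by linarith) hδ
  refine ⟨max (max T₁ T₂) (5 + 7 * N), le_max_of_le_right (by linarith), fun t ht => ?_⟩
  have ht₁ : T₁ ≤ t := (le_max_left _ _).trans ((le_max_left _ _).trans ht)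
  have ht₂ : T₂ ≤ t := (le_max_right _ _).trans ((le_max_left _ _).trans ht)
  have ht₃ : 5 + 7 * N ≤ t := (le_max_right _ _).trans ht
  set θ₁ := plateau (t - 5 * N) (t + 5 * N) (2 * N)
  set θ₂ := plateau (t - 2 * N) (t + 2 * N) N
  have k₁ : Cut (t - 5 * N) (t + 5 * N) θ₁ := plateau_cut (by linarith) (by linarith)
  have k₂ : Cut (t - 2 * N) (t + 2 * N) θ₂ := plateau_cut (by linarith) hN0
  have p₁ : ∀ s, 0 ≤ θ₁ s := plateau_nonneg _ _ _
  have p₂ : ∀ s, 0 ≤ θ₂ s := plateau_nonneg _ _ _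
  have l₁ : ∀ s, θ₁ s ≤ 1 := plateau_le_one _ _ _
  have e₁ : ∫ x, (1 * velSq U x + 1 * |scHead U P x|) * rad (n / 2) θ₁ x ≤ C' := by
    rw [k₁.ccut.integral_lin _ _ _ hcA hch.abs, one_mul, one_mul, hC']
    obtain ⟨c1, c2⟩ := hcon _ _ θ₁ k₁ p₁
    have a1 := H₁ t ht₁ θ₁ k₁.ccut p₁ l₁
    have a2 := herr (t - 5 * N) (t + 5 * N) (2 * N) (by linarith) (by linarith) (by linarith)
    have a3 := mul_le_mul_of_nonneg_left
      (add_le_add (mul_le_mul_of_nonneg_left a1 hn4) a2) hc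
    have a4 := mul_le_mul_of_nonneg_left (add_le_add a1 a2) hc
    linarith
  have e₂ : ∫ x, errDens U P x * rad (n / 2) (edge θ₂) x
      ≤ 2 * K / N * (κ * (10 * N * V) + (1 + 1 / κ) * C') := by
    have hcs : Continuous fun x => 1 * velSq U x + 1 * |scHead U P x| :=
      (hcA.const_mul 1).add (hch.abs.const_mul 1)
    have hKN : 0 ≤ 2 * K / N := by positivity
    calc _ ≤ ∫ x, (2 * K / N * κ * 1 + 2 * K / N * (1 + 1 / κ)
          * (1 * velSq U x + 1 * |scHead U P x|)) * rad (n / 2) θ₁ x := by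
          refine rad_integral_mono k₂.edge_ccut k₁.ccut hcD
            (continuous_const.add (hcs.const_mul _)) fun x _ => ?_
          set s := Real.log (‖x‖ ^ 2)
          have b1 : edge θ₂ s ≤ 2 * K / N * θ₁ s := by
            by_cases hs : s ∈ Icc (t - 3 * N) (t + 3 * N)
            · have := hedge (t - 2 * N) (t + 2 * N) N s (by linarith)
              have g1 := plateau_le_one (t - 2 * N - N) (t - 2 * N + 2 * N) N s
              have g2 := plateau_le_one (t + 2 * N - 2 * N) (t + 2 * N + N) N s
              rw [show θ₁ s = 1 from plateau_eq_one (by linarith) (by linarith [hs.1])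
                (by linarith [hs.2])]
              refine this.trans ?_
              calc _ ≤ K / N * (1 + 1) :=
                    mul_le_mul_of_nonneg_left (add_le_add g1 g2) (by positivity)
                _ = _ := by ring
            · rw [k₂.edge_ccut.zero s fun h' => hs
                ⟨by linarith [h'.1], by linarith [h'.2]⟩]
              exact mul_nonneg hKN (p₁ s)
          have b2 : errDens U P x ≤ κ + (1 + 1 / κ) * (velSq U x + |scHead U P x|) := by
            have hv := velSq_nonneg U x
            have g1 : √(velSq U x) ≤ κ + 1 / κ * velSq U x := by
              have g2 := Real.sq_sqrt hv
              have g3 : √(velSq U x) * κ ≤ κ * κ + velSq U x := by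
                nlinarith [sq_nonneg (√(velSq U x) - κ), sq_nonneg (√(velSq U x) + κ)]
              rw [one_div, inv_mul_eq_div, ← sub_le_iff_le_add', le_div_iff₀ hκ]
              linarith
            have g4 : 0 ≤ 1 / κ * |scHead U P x| := by positivity
            unfold errDens
            linarith
          calc _ ≤ (κ + (1 + 1 / κ) * (velSq U x + |scHead U P x|)) * (2 * K / N * θ₁ s) :=
                mul_le_mul b2 b1 (edge_nonneg _ _) ((errDens_nonneg U P x).trans b2)
            _ = _ := by ring
      _ = 2 * K / N * κ * (∫ x : Eu n, 1 * rad (n / 2) θ₁ x) + 2 * K / N * (1 + 1 / κ)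
          * ∫ x, (1 * velSq U x + 1 * |scHead U P x|) * rad (n / 2) θ₁ x :=
          k₁.ccut.integral_lin _ _ _ continuous_const hcs
      _ ≤ 2 * K / N * κ * (V * (t + 5 * N - (t - 5 * N))) + 2 * K / N * (1 + 1 / κ) * C' := by
          simp only [one_mul] at e₁ ⊢
          exact add_le_add (mul_le_mul_of_nonneg_left
            (hvol _ _ θ₁ (by linarith) k₁.ccut p₁ l₁) (by positivity))
            (mul_le_mul_of_nonneg_left e₁ (by positivity))
      _ = _ := by ring
  have e₃ := (hcon _ _ θ₂ k₂ p₂).1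
  have a1 := H₂ t ht₂ θ₂ k₂.ccut p₂ (plateau_le_one _ _ _)
  calc _ ≤ ∫ x, velSq U x * rad (n / 2) θ₂ x := by
        refine rad_integral_mono (a := t - 3) (b := t + 3)
          (plateau_cut (by linarith) one_pos).ccut k₂.ccut hcA hcA fun x _ =>
          mul_le_mul_of_nonneg_left ?_ (velSq_nonneg U x)
        by_cases hs : Real.log (‖x‖ ^ 2) ∈ Icc (t - 3) (t + 3)
        · rw [show θ₂ (Real.log (‖x‖ ^ 2)) = 1 from plateau_eq_one hN0
            (by linarith [hs.1]) (by linarith [hs.2])]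
          exact plateau_le_one _ _ _ _
        · rw [(plateau_cut (a := t - 3) (b := t + 3) (by linarith) one_pos).zero _ hs]
          exact p₂ _
    _ ≤ _ := e₃
    _ ≤ c * ((n - 4) * δ + 2 * K / N * (κ * (10 * N * V) + (1 + 1 / κ) * C')) :=
        mul_le_mul_of_nonneg_left (add_le_add (mul_le_mul_of_nonneg_left a1 hn4) e₂) hc
    _ = c * (n - 4) * δ + 20 * (c * K * V) * κ + D / N := by
        rw [hD]; field_simp; ring
    _ ≤ ε := by linarith

end

section

variable {n : ℕ} {C : ℝ} {U : Fin n → Eu n → ℝ} {P : Eu n → ℝ}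

/-- After normalizing the pressure, a solution with critical decay is scale-invariantly bounded. -/
theorem Ext.exists_scale (hn : 2 ≤ n) (h : Ext C U P) : ∃ C' c, Scale C' U (fun x => P x - c) := by
  obtain ⟨c, K, hK, hP⟩ := h.exists_pressure_limit hn
  have hv : ∀ x : Eu n, 8 ≤ ‖x‖ → velSq U x ≤ n * C ^ 2 := fun x hx => by
    have hx0 : 0 < ‖x‖ := by linarith
    have : nsq U x ≤ ∑ _i : Fin n, (C / ‖x‖) ^ 2 := Finset.sum_le_sum fun i _ => by
      rw [← sq_abs]
      exact pow_le_pow_left₀ (abs_nonneg _) (h.bound x (by linarith) i) 2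
    calc _ ≤ ‖x‖ ^ 2 * ∑ _i : Fin n, (C / ‖x‖) ^ 2 :=
          mul_le_mul_of_nonneg_left this (sq_nonneg _)
      _ = n * C ^ 2 := by
        rw [Finset.sum_const, Finset.card_univ, Fintype.card_fin, nsmul_eq_mul]
        field_simp
  refine ⟨n * C ^ 2 + K + 1, c, h.sol.sub_const c, ?_, fun x hx => ?_, fun x hx => ?_⟩
  · have : 0 ≤ n * C ^ 2 := by positivity
    linarith
  · linarith [hv x hx]
  · have hx0 : 0 < ‖x‖ ^ 2 := by have : 0 < ‖x‖ := by linarith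
                                 positivity
    have h1 := hP x hx
    rw [le_div_iff₀ hx0] at h1
    have h2 := velSq_nonneg U x
    have h3 : scHead U (fun x => P x - c) x = velSq U x / 2 + ‖x‖ ^ 2 * (P x - c) := by
      unfold scHead head velSq
      ring
    rw [h3]
    refine (abs_add_le _ _).trans ?_
    rw [abs_mul, abs_of_pos hx0, abs_of_nonneg (by positivity)]
    linarith [hv x hx]

/-- The components of the velocity are dominated by the windowed density on a ball. -/
theorem sq_le_windowed_density {R : ℝ} (hR : 8 ≤ R) {x y : Eu n} (hx : ‖x‖ = R)
    (hy : dist y x ≤ R / 2) (k : Fin n) :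
    U k y ^ 2 ≤ 4 * Real.exp 1 ^ n * R ^ n / R ^ 2 * (velSq U y * rad (n / 2)
      (plateau (Real.log (R ^ 2) - 3) (Real.log (R ^ 2) + 3) 1) y) := by
  have hR0 : 0 < R := by linarith
  have hR2 : 0 < R ^ 2 := by positivity
  set t := Real.log (R ^ 2) with ht
  have hd := abs_le.1 ((abs_norm_sub_norm_le y x).trans_eq (dist_eq_norm y x).symm)
  rw [hx] at hd
  have y1 : R / 2 ≤ ‖y‖ := by linarith [hd.1]
  have y2 : ‖y‖ ≤ 3 * R / 2 := by linarith [hd.2]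
  have y3 : R ^ 2 / 4 ≤ ‖y‖ ^ 2 := by nlinarith
  have y4 : ‖y‖ ^ 2 ≤ 4 * R ^ 2 := by nlinarith
  have hy0 : 0 < ‖y‖ ^ 2 := by linarith
  have h2 : (4 : ℝ) ≤ Real.exp 2 := by
    linarith [Real.quadratic_le_exp_of_nonneg (x := 2) (by norm_num)]
  have het : Real.exp t = R ^ 2 := Real.exp_log hR2
  have t1 : t - 2 ≤ Real.log (‖y‖ ^ 2) := by
    rw [Real.le_log_iff_exp_le hy0, Real.exp_sub, het]
    exact (div_le_div_of_nonneg_left hR2.le (by norm_num) h2).trans y3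
  have t2 : Real.log (‖y‖ ^ 2) ≤ t + 2 := by
    rw [Real.log_le_iff_le_exp hy0, Real.exp_add, het]
    nlinarith
  have hpl : plateau (t - 3) (t + 3) 1 (Real.log (‖y‖ ^ 2)) = 1 :=
    plateau_eq_one one_pos (by linarith) (by linarith)
  have e1 : Real.exp (-(n / 2) * (t + 2)) = (Real.exp 1 ^ n * R ^ n)⁻¹ := by
    have h3 : R ^ n = Real.exp (n * Real.log R) := by
      rw [Real.exp_nat_mul, Real.exp_log hR0]
    rw [h3, ← Real.exp_nat_mul, ← Real.exp_add, ← Real.exp_neg, ht, Real.log_pow]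
    congr 1
    push_cast
    ring
  have e2 : (Real.exp 1 ^ n * R ^ n)⁻¹ ≤ Real.exp (-(n / 2) * Real.log (‖y‖ ^ 2)) := by
    rw [← e1, Real.exp_le_exp]
    exact mul_le_mul_of_nonpos_left t2 (by have : (0 : ℝ) ≤ n := n.cast_nonneg
                                           linarith)
  have e3 : U k y ^ 2 ≤ nsq U y :=
    Finset.single_le_sum (f := fun i => U i y ^ 2) (fun i _ => sq_nonneg _) (Finset.mem_univ k)
  rw [rad, hpl, mul_one, velSq]
  have hex : 0 < Real.exp 1 ^ n * R ^ n := by positivity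
  calc _ ≤ nsq U y := e3
    _ = 4 * Real.exp 1 ^ n * R ^ n / R ^ 2
        * ((R ^ 2 / 4 * nsq U y) * (Real.exp 1 ^ n * R ^ n)⁻¹) := by field_simp
    _ ≤ _ := by
      refine mul_le_mul_of_nonneg_left ?_ (by positivity)
      exact mul_le_mul (mul_le_mul_of_nonneg_right y3 (nsq_nonneg U y)) e2 (by positivity)
        (mul_nonneg hy0.le (nsq_nonneg U y))

theorem abs_le_add_div_mul_sq {v κ : ℝ} (hκ : 0 < κ) : |v| ≤ κ + 1 / κ * v ^ 2 := by
  have g3 : |v| * κ ≤ κ * κ + v ^ 2 := by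
    nlinarith [sq_nonneg (|v| - κ), sq_nonneg (|v| + κ), sq_abs v]
  rw [one_div, inv_mul_eq_div, ← sub_le_iff_le_add', le_div_iff₀ hκ]
  linarith

/-- Averages of the velocity are controlled by windowed integrals. -/
theorem Scale.abs_avg_le (h : Scale C U P) {φ : Eu n → ℝ} (hφ : Test (Bl n) φ) {Φ : ℝ}
    (hΦ : ∀ z, |φ z| ≤ Φ) {R τ κ : ℝ} (hR : 8 ≤ R) (hR9 : 8 ≤ Real.log (R ^ 2)) (hτ : 0 < τ)
    (hτ2 : τ ≤ 1 / 2) (hκ : 0 < κ) {x : Eu n} (hx : ‖x‖ = R) (k : Fin n) :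
    R * |avg φ (U k) x (τ * R)| ≤ κ * (∫ z, |φ z|) + 4 * Real.exp 1 ^ n * Φ / (κ * τ ^ n)
      * ∫ y, velSq U y * rad (n / 2)
        (plateau (Real.log (R ^ 2) - 3) (Real.log (R ^ 2) + 3) 1) y := by
  have hR0 : 0 < R := by linarith
  have hs : 0 < τ * R := by positivity
  set t := Real.log (R ^ 2)
  set g : Eu n → ℝ := fun y => velSq U y * rad (n / 2) (plateau (t - 3) (t + 3) 1) y
  have hcut : Cut (t - 3) (t + 3) (plateau (t - 3) (t + 3) 1) :=
    plateau_cut (by linarith) one_pos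
  have hg0 : ∀ y, 0 ≤ g y := fun y =>
    mul_nonneg (velSq_nonneg U y) (rad_nonneg (plateau_nonneg _ _ _) y)
  have hgi : Integrable g := hcut.ccut.int _ h.continuous_velSq
  have hΦ0 : 0 ≤ Φ := (abs_nonneg _).trans (hΦ 0)
  have hai : Integrable fun z => |φ z| :=
    (hφ.smooth.continuous.integrable_of_hasCompactSupport hφ.compact).abs
  have hcomp : ∫ z, g (x + (τ * R) • z) = ((τ * R) ^ n)⁻¹ * ∫ y, g y := by
    rw [Measure.integral_comp_smul volume (fun z => g (x + z)) (τ * R),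
      integral_add_left_eq_self, finrank_euclideanSpace_fin, abs_of_pos (by positivity),
      smul_eq_mul]
  have hgs : Integrable fun z => g (x + (τ * R) • z) :=
    (hgi.comp_add_left x).comp_smul hs.ne'
  set D := 4 * Real.exp 1 ^ n * R ^ n / R ^ 2
  have hκR : 0 < κ / R := by positivity
  calc _ ≤ R * ∫ z, (κ / R * |φ z| + 1 / (κ / R) * Φ * D * g (x + (τ * R) • z)) := by
        refine mul_le_mul_of_nonneg_left ?_ hR0.le
        refine abs_integral_le_integral_abs.trans (MeasureTheory.integral_mono ?_
          ((hai.const_mul _).add (hgs.const_mul _)) fun z => ?_)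
        · refine Integrable.abs (hφ.int ?_)
          exact (h.sol.smU k).continuous.comp (by fun_prop)
        · simp only
          by_cases hz : z ∈ Bl n
          · have hd := dist_add_smul_le hs.le hz x
            have h1 := sq_le_windowed_density (U := U) hR hx (hd.trans (by nlinarith)) k
            have h2 := abs_le_add_div_mul_sq (v := U k (x + (τ * R) • z)) hκR
            rw [abs_mul]
            calc _ ≤ (κ / R + 1 / (κ / R) * U k (x + (τ * R) • z) ^ 2) * |φ z| :=
                  mul_le_mul_of_nonneg_right h2 (abs_nonneg _)
              _ = κ / R * |φ z| + 1 / (κ / R) * (U k (x + (τ * R) • z) ^ 2 * |φ z|) := by ring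
              _ ≤ κ / R * |φ z| + 1 / (κ / R) * (D * g (x + (τ * R) • z) * Φ) := by
                  gcongr
                  · exact mul_nonneg (by positivity) (hg0 _)
                  · exact hΦ z
              _ = _ := by ring
          · rw [hφ.zero hz]
            simp only [mul_zero, abs_zero, zero_add]
            exact mul_nonneg (by positivity) (hg0 _)
    _ = R * (κ / R * (∫ z, |φ z|) + 1 / (κ / R) * Φ * D * (((τ * R) ^ n)⁻¹ * ∫ y, g y)) := by
        rw [integral_add (hai.const_mul _) (hgs.const_mul _), integral_const_mul,
          integral_const_mul, hcomp]
    _ = _ := by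
        simp only [D]
        rw [mul_pow]
        field_simp

/-- Solutions with critical decay in an exterior domain decay faster than critically. -/
theorem Ext.decay (hn : 4 ≤ n) (h : Ext C U P) {ε : ℝ} (hε : 0 < ε) :
    ∃ R₀ : ℝ, ∀ x : Eu n, R₀ ≤ ‖x‖ → ∀ k, ‖x‖ * |U k x| ≤ ε := by
  obtain ⟨C', c, hS⟩ := h.exists_scale (by lia)
  obtain ⟨ψ, φ, hk⟩ := exists_kern n
  obtain ⟨K, hK, hav⟩ := hk.velocity_avg
  obtain ⟨Φ, hΦ⟩ := hk.test.compact.exists_bound_of_continuous hk.test.smooth.continuous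
  simp only [Real.norm_eq_abs] at hΦ
  have hΦ0 : 0 ≤ Φ := (abs_nonneg _).trans (hΦ 0)
  have hI : 0 ≤ ∫ z, |φ z| := integral_nonneg fun z => abs_nonneg _
  set I := ∫ z, |φ z|
  set τ := ε / (12 * (K * C ^ 2) + 2 * ε) with hτdef
  have hKC : 0 ≤ K * C ^ 2 := by positivity
  have hτ : 0 < τ := by positivity
  have hτ2 : τ ≤ 1 / 2 := by
    rw [hτdef, div_le_iff₀ (by positivity)]
    linarith
  have hτ3 : 4 * (K * C ^ 2) * τ ≤ ε / 3 := by
    rw [hτdef, mul_div_assoc', div_le_iff₀ (by positivity)]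
    nlinarith
  set κ := ε / (3 * I + 1) with hκdef
  have hκ : 0 < κ := by positivity
  have hκ3 : κ * I ≤ ε / 3 := by
    rw [hκdef, div_mul_eq_mul_div, div_le_iff₀ (by positivity)]
    nlinarith
  set D := 4 * Real.exp 1 ^ n * Φ / (κ * τ ^ n)
  have hD : 0 ≤ D := by positivity
  set η := ε / (3 * D + 1) with hηdef
  have hη : 0 < η := by positivity
  have hη3 : D * η ≤ ε / 3 := by
    rw [hηdef, mul_div_assoc', div_le_iff₀ (by positivity)]
    nlinarith
  obtain ⟨T, hT, H⟩ := hS.vel_small hn hη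
  refine ⟨Real.exp T, fun x hx k => ?_⟩
  set R := ‖x‖ with hR
  have hR8 : 8 ≤ R := by linarith [Real.add_one_le_exp T]
  have hR0 : 0 < R := by linarith
  have ht : T ≤ Real.log (R ^ 2) := by
    rw [Real.le_log_iff_exp_le (by positivity)]
    nlinarith
  have h1 := hav _ _ _ x (τ * R) (2 * C / R) h.sol (by positivity) (fun y hy => by
    have hd := abs_le.1 ((abs_norm_sub_norm_le y x).trans_eq (dist_eq_norm y x).symm)
    have hyR : R / 2 ≤ ‖y‖ := by nlinarith [hd.1]
    have hy2 : 2 < ‖y‖ := by linarith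
    refine ⟨hy2, fun k => (h.bound y hy2 k).trans ?_⟩
    rw [div_le_div_iff₀ (by linarith) hR0]
    nlinarith [h.nonneg]) k
  have h2 := hS.abs_avg_le hk.test hΦ hR8 (by linarith) hτ hτ2 hκ hR.symm k
  have h3 := mul_le_mul_of_nonneg_left (H _ ht) hD
  have h4 : R * (K * (2 * C / R) ^ 2 * (τ * R)) = 4 * (K * C ^ 2) * τ := by
    field_simp
    ring
  have h5 := mul_le_mul_of_nonneg_left h1 hR0.le
  have h6 : |U k x| ≤ |avg φ (U k) x (τ * R)| + |avg φ (U k) x (τ * R) - U k x| := by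
    have := abs_sub_abs_le_abs_sub (U k x) (avg φ (U k) x (τ * R))
    rw [abs_sub_comm] at this
    linarith
  have h7 := mul_le_mul_of_nonneg_left h6 hR0.le
  linarith

end

section

variable {n : ℕ}

/-- A smooth cutoff vanishing near the closed unit ball. -/
noncomputable def extCut (x : Eu n) : ℝ := Real.smoothTransition (‖x‖ ^ 2 - 3)

theorem sm_extCut_mul {f : Eu n → ℝ} (hf : ContDiffOn ℝ ∞ f {x | 1 < ‖x‖}) :
    Sm (fun x => extCut x * f x) := by
  refine contDiff_iff_contDiffAt.2 fun x => ?_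
  by_cases hx : 1 < ‖x‖
  · have hc : ContDiff ℝ ∞ (extCut : Eu n → ℝ) :=
      Real.smoothTransition.contDiff.comp ((contDiff_norm_sq ℝ).sub contDiff_const)
    exact hc.contDiffAt.mul (hf.contDiffAt
      ((isOpen_lt continuous_const continuous_norm).mem_nhds hx))
  · have : (fun x => extCut x * f x) =ᶠ[𝓝 x] fun _ => 0 := by
      have hm : {y : Eu n | ‖y‖ ^ 2 < 3} ∈ 𝓝 x :=
        (isOpen_lt (by fun_prop) continuous_const).mem_nhds (by
          change ‖x‖ ^ 2 < 3
          nlinarith [norm_nonneg x])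
      filter_upwards [hm] with y hy
      change ‖y‖ ^ 2 < 3 at hy
      rw [extCut, Real.smoothTransition.zero_of_nonpos (by linarith), zero_mul]
    exact contDiffAt_const.congr_of_eventuallyEq this

theorem extCut_eq_one {x : Eu n} (hx : 2 < ‖x‖) : extCut x = 1 :=
  Real.smoothTransition.one_of_one_le (by nlinarith)

/-- A solution in the exterior of the unit ball agrees with globally smooth functions far out. -/
theorem ext_of_exterior {v : Fin n → Eu n → ℝ} {p : Eu n → ℝ} {C : ℝ} (hC : 0 ≤ C)
    (hv : ∀ j, ContDiffOn ℝ ∞ (v j) {x | 1 < ‖x‖}) (hp : ContDiffOn ℝ ∞ p {x | 1 < ‖x‖})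
    (hns : ∀ x, 1 < ‖x‖ → ∀ j,
      -(∑ i, pd i (pd i (v j)) x) + (∑ i, v i x * pd i (v j) x) + pd j p x = 0)
    (hdiv : ∀ x, 1 < ‖x‖ → ∑ i, pd i (v i) x = 0)
    (hb : ∀ x, 1 < ‖x‖ → ∀ j, |v j x| ≤ C / ‖x‖) :
    Ext C (fun j x => extCut x * v j x) fun x => extCut x * p x := by
  have hS : IsOpen {x : Eu n | 2 < ‖x‖} := isOpen_lt continuous_const continuous_norm
  have e0 : ∀ (f : Eu n → ℝ) x, x ∈ {x : Eu n | 2 < ‖x‖} → extCut x * f x = f x :=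
    fun f x hx => by rw [extCut_eq_one hx, one_mul]
  have e1 : ∀ (f : Eu n → ℝ) i x, x ∈ {x : Eu n | 2 < ‖x‖} →
      pd i (fun x => extCut x * f x) x = pd i f x :=
    fun f i x hx => pd_congr_on hS (e0 f) hx i
  have e2 : ∀ (f : Eu n → ℝ) i x, x ∈ {x : Eu n | 2 < ‖x‖} →
      pd i (pd i (fun x => extCut x * f x)) x = pd i (pd i f) x :=
    fun f i x hx => pd_congr_on hS (e1 f i) hx i
  refine ⟨⟨hS, fun j => sm_extCut_mul (hv j), sm_extCut_mul hp, fun x hx j => ?_,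
    fun x hx => ?_⟩, hC, fun x hx k => ?_⟩
  · have h1 : (1 : ℝ) < ‖x‖ := one_lt_two.trans hx
    have := hns x h1 j
    simp only [lap, e2 _ _ x hx, e1 _ _ x hx, e0 _ x hx]
    linarith
  · have h1 : (1 : ℝ) < ‖x‖ := one_lt_two.trans hx
    simp only [e1 _ _ x hx, hdiv x h1]
  · rw [e0 _ x hx]
    exact hb x (one_lt_two.trans hx) k

end

end SteadyNS

end

/-- **Little-o decay in exterior domains, n ≥ 4.**  If `(u, p)` is a smooth solution of
the steady Navier-Stokes equations on `ℝⁿ \ closedBall 0 1`, `n ≥ 4`, with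
`|u(x)| ≤ C/|x|` for `|x| ≥ 1`, then `|x| |u(x)| → 0` as `|x| → ∞`,
i.e. `u(x) = o(1/|x|)` at infinity. -/
theorem steady_NS_exterior_little_o_decay {n : ℕ} (hn : 4 ≤ n)
    (u : EuclideanSpace ℝ (Fin n) → EuclideanSpace ℝ (Fin n))
    (p : EuclideanSpace ℝ (Fin n) → ℝ)
    (hu : ContDiffOn ℝ (⊤ : ℕ∞) u {x : EuclideanSpace ℝ (Fin n) | 1 < ‖x‖})
    (hp : ContDiffOn ℝ (⊤ : ℕ∞) p {x : EuclideanSpace ℝ (Fin n) | 1 < ‖x‖})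
    (hNS : ∀ x : EuclideanSpace ℝ (Fin n), 1 < ‖x‖ → ∀ j : Fin n,
      -(∑ i : Fin n, fderiv ℝ (fun y => fderiv ℝ (fun z => u z j) y
            (EuclideanSpace.single i 1)) x (EuclideanSpace.single i 1)) +
        (∑ i : Fin n, u x i * fderiv ℝ (fun z => u z j) x (EuclideanSpace.single i 1)) +
        fderiv ℝ p x (EuclideanSpace.single j 1) = 0)
    (hdiv : ∀ x : EuclideanSpace ℝ (Fin n), 1 < ‖x‖ →
      ∑ i : Fin n, fderiv ℝ (fun z => u z i) x (EuclideanSpace.single i 1) = 0)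
    (C : ℝ) (hC : 0 < C)
    (hbound : ∀ x : EuclideanSpace ℝ (Fin n), 1 ≤ ‖x‖ → ‖u x‖ ≤ C / ‖x‖) :
    ∀ ε : ℝ, 0 < ε → ∃ R : ℝ, ∀ x : EuclideanSpace ℝ (Fin n),
      R ≤ ‖x‖ → ‖x‖ * ‖u x‖ < ε := by
  intro ε hε
  have hext := SteadyNS.ext_of_exterior (v := fun j x => u x j) (p := p) hC.le
    (fun j => ((EuclideanSpace.proj j).contDiff (𝕜 := ℝ)).comp_contDiffOn hu) hp hNS hdiv
    (fun x hx j => (PiLp.norm_apply_le (u x) j).trans (hbound x hx.le))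
  have hn0 : (0 : ℝ) < n := by exact_mod_cast (by lia : 0 < n)
  obtain ⟨R, hR⟩ := hext.decay hn (ε := ε / (2 * n)) (by positivity)
  refine ⟨max R 3, fun x hx => ?_⟩
  have hx3 : 3 ≤ ‖x‖ := (le_max_right _ _).trans hx
  have hx2 : 2 < ‖x‖ := by linarith
  have h1 : ∀ k, ‖x‖ * |u x k| ≤ ε / (2 * n) := fun k => by
    have := hR x ((le_max_left _ _).trans hx) k
    rwa [SteadyNS.extCut_eq_one hx2, one_mul] at this
  have h2 : ‖u x‖ ≤ ∑ k, |u x k| := by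
    calc ‖u x‖ = ‖∑ k, EuclideanSpace.single k (u x k)‖ := by
          congr 1
          ext j
          simp
      _ ≤ ∑ k, ‖EuclideanSpace.single k (u x k)‖ := norm_sum_le _ _
      _ = _ := by simp
  calc ‖x‖ * ‖u x‖ ≤ ‖x‖ * ∑ k, |u x k| := mul_le_mul_of_nonneg_left h2 (norm_nonneg _)
    _ = ∑ k, ‖x‖ * |u x k| := Finset.mul_sum _ _ _
    _ ≤ ∑ _k : Fin n, ε / (2 * n) := Finset.sum_le_sum fun k _ => h1 k
    _ = ε / 2 := by
      rw [Finset.sum_const, Finset.card_univ, Fintype.card_fin, nsmul_eq_mul]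
      field_simp
    _ < ε := by linarith
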